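/- arXiv:1403.5430 — 3 statements merged into one kernel-verified Lean document; each statement's English description precedes it below -/
import Mathlib

section
/- Let k ≥ 2 and let G be a finite simple graph of order n whose average degree 2·e(G)/n is strictly greater than k−2 and whose minimum degree is at least k−4. Then G contains every tree of order k as a subgraph. -/
open SimpleGraph

namespace ErdosSos

open scoped Classical

variable {V W : Type*}

/-- The neighbourhood of `x` as a finset. -/
noncomputable def nb [Fintype V] (G : SimpleGraph V) (x : V) : Finset V :=
  Finset.univ.filter (G.Adj x)

@[simp]
theorem mem_nb [Fintype V] {G : SimpleGraph V} {x y : V} : y ∈ nb G x ↔ G.Adj x y := by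
  simp [nb]

/-- `f` embeds the subgraph of `T` induced on `S` into `G`. -/
structure Emb (T : SimpleGraph W) (G : SimpleGraph V) (S : Finset W) (f : W → V) : Prop where
  inj : ∀ s ∈ S, ∀ t ∈ S, f s = f t → s = t
  adj : ∀ s ∈ S, ∀ t ∈ S, T.Adj s t → G.Adj (f s) (f t)

variable {T : SimpleGraph W} {G : SimpleGraph V}

theorem Emb.mono {S S' : Finset W} {f : W → V} (h : Emb T G S f) (hS : S' ⊆ S) :
    Emb T G S' f :=
  ⟨fun s hs t ht => h.inj s (hS hs) t (hS ht), fun s hs t ht => h.adj s (hS hs) t (hS ht)⟩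

/-- Sending `w` to a new vertex `z`, whether or not `w` was embedded before. -/
theorem Emb.update {S : Finset W} {f : W → V} (h : Emb T G S f) {w : W} {z : V}
    (hz : ∀ b ∈ S, b ≠ w → f b ≠ z) (ha : ∀ b ∈ S, T.Adj w b → G.Adj z (f b)) :
    Emb T G (insert w S) (Function.update f w z) := by
  constructor
  · intro s hs t ht hst
    rw [Finset.mem_insert] at hs ht
    by_cases h1 : s = w <;> by_cases h2 : t = w
    · rw [h1, h2]
    · subst h1
      rw [Function.update_self, Function.update_of_ne h2] at hst
      exact absurd hst.symm (hz t (ht.resolve_left h2) h2)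
    · subst h2
      rw [Function.update_self, Function.update_of_ne h1] at hst
      exact absurd hst (hz s (hs.resolve_left h1) h1)
    · rw [Function.update_of_ne h1, Function.update_of_ne h2] at hst
      exact h.inj s (hs.resolve_left h1) t (ht.resolve_left h2) hst
  · intro s hs t ht hst
    rw [Finset.mem_insert] at hs ht
    by_cases h1 : s = w <;> by_cases h2 : t = w
    · subst h1 h2; exact absurd hst (T.irrefl)
    · subst h1
      rw [Function.update_self, Function.update_of_ne h2]
      exact ha t (ht.resolve_left h2) hst
    · subst h2
      rw [Function.update_self, Function.update_of_ne h1]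
      exact (ha s (hs.resolve_left h1) hst.symm).symm
    · rw [Function.update_of_ne h1, Function.update_of_ne h2]
      exact h.adj s (hs.resolve_left h1) t (ht.resolve_left h2) hst

theorem Emb.swap {S : Finset W} {f : W → V} (h : Emb T G S f) {w : W} {z : V} (hw : w ∈ S)
    (hz : ∀ b ∈ S, b ≠ w → f b ≠ z) (ha : ∀ b ∈ S, T.Adj w b → G.Adj z (f b)) :
    Emb T G S (Function.update f w z) := by
  have := h.update hz ha
  rwa [Finset.insert_eq_of_mem hw] at this

theorem emb_singleton (c : W) (v : V) : Emb T G {c} (fun _ => v) := by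
  constructor
  · intro s hs t ht _
    rw [Finset.mem_singleton] at hs ht
    rw [hs, ht]
  · intro s hs t ht hst
    rw [Finset.mem_singleton] at hs ht
    rw [hs, ht] at hst
    exact absurd hst T.irrefl

/-- `π` sends every vertex of the tree `T` rooted at `c` to its parent and fixes `c`;
`h` is the distance to the root. -/
structure IsParent (T : SimpleGraph W) (c : W) (π : W → W) (h : W → ℕ) : Prop where
  root : π c = c
  adj_iff : ∀ s t, T.Adj s t ↔ s ≠ t ∧ (π s = t ∨ π t = s)
  height : ∀ t, t ≠ c → h (π t) + 1 = h t
  height_root : h c = 0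

theorem IsParent.ne {c : W} {π : W → W} {h : W → ℕ} (H : IsParent T c π h) {t : W} (ht : t ≠ c) :
    π t ≠ t := by
  intro e
  have := H.height t ht
  rw [e] at this
  omega

theorem IsParent.ne_root {c : W} {π : W → W} {h : W → ℕ} (H : IsParent T c π h) {s t : W}
    (hst : π t = s) (hne : t ≠ s) : t ≠ c := by
  rintro rfl
  exact hne (H.root.symm.trans hst)

theorem IsParent.adj {c : W} {π : W → W} {h : W → ℕ} (H : IsParent T c π h) {t : W} (ht : t ≠ c) :
    T.Adj t (π t) :=
  (H.adj_iff _ _).2 ⟨(H.ne ht).symm, Or.inl rfl⟩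

theorem exists_isParent (hT : T.IsTree) (c : W) : ∃ π h, IsParent T c π h := by
  have hex : ∀ t, t ≠ c → ∃ s, T.Adj t s ∧ T.dist c s + 1 = T.dist c t := by
    intro t ht
    obtain ⟨p, hp⟩ := hT.connected.exists_walk_length_eq_dist t c
    cases p with
    | nil => exact absurd rfl ht
    | @cons _ s _ hts q =>
      refine ⟨s, hts, ?_⟩
      have h1 : T.dist s c ≤ q.length := dist_le q
      have h2 := hT.dist_eq_dist_add_one_of_adj c hts
      rw [Walk.length_cons] at hp
      rw [dist_comm (u := s)] at h1
      rw [dist_comm (u := t)] at hp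
      omega
  have hun : ∀ t s s', T.Adj t s → T.dist c s + 1 = T.dist c t → T.Adj t s' →
      T.dist c s' + 1 = T.dist c t → s = s' := by
    intro t s s' h1 h2 h3 h4
    obtain ⟨p, hp⟩ := hT.connected.exists_walk_length_eq_dist c s
    obtain ⟨p', hp'⟩ := hT.connected.exists_walk_length_eq_dist c s'
    have e1 : (p.concat h1.symm).IsPath :=
      Walk.isPath_of_length_eq_dist _ (by rw [Walk.length_concat]; omega)
    have e2 : (p'.concat h3.symm).IsPath :=
      Walk.isPath_of_length_eq_dist _ (by rw [Walk.length_concat]; omega)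
    have e3 := congrArg Subtype.val ((hT.isAcyclic.subsingleton_path _ _).elim ⟨_, e1⟩ ⟨_, e2⟩)
    have e4 := congrArg Walk.penultimate e3
    simpa using e4
  choose! π hπ using hex
  refine ⟨fun t => if t = c then c else π t, T.dist c, by simp, ?_, ?_, by simp⟩
  · intro s t
    constructor
    · intro hst
      refine ⟨hst.ne, ?_⟩
      rcases hT.dist_eq_dist_add_one_of_adj c hst with h | h
      · left
        have hs : s ≠ c := by rintro rfl; simp at h
        simp only [hs, if_false]
        exact hun s _ _ (hπ s hs).1 (hπ s hs).2 hst h.symm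
      · right
        have ht : t ≠ c := by rintro rfl; simp at h
        simp only [ht, if_false]
        exact hun t _ _ (hπ t ht).1 (hπ t ht).2 hst.symm h.symm
    · rintro ⟨hne, h | h⟩
      · by_cases hs : s = c
        · simp only [hs, if_true] at h; exact absurd (hs.trans h) hne
        · simp only [hs, if_false] at h; exact h ▸ (hπ s hs).1
      · by_cases ht : t = c
        · simp only [ht, if_true] at h; exact absurd (ht.trans h).symm hne
        · simp only [ht, if_false] at h; exact h ▸ (hπ t ht).1.symm
  · intro t ht
    simp only [ht, if_false]
    exact (hπ t ht).2

section

variable [Fintype V]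

theorem exists_adj_notMem {x : V} {A : Finset V} (hx : x ∈ A) (hA : A.card ≤ (nb G x).card) :
    ∃ y, y ∉ A ∧ G.Adj x y := by
  by_contra! hcon
  have hsub : nb G x ⊆ A.erase x := by
    intro y hy
    rw [mem_nb] at hy
    rw [Finset.mem_erase]
    refine ⟨hy.ne', ?_⟩
    by_contra h
    exact hcon y h hy
  have h1 := Finset.card_le_card hsub
  have h2 := Finset.card_erase_lt_of_mem hx
  omega

theorem exists_extension {c : W} {π : W → W} {h : W → ℕ} (H : IsParent T c π h) {d : ℕ}
    (hd : ∀ x, d ≤ (nb G x).card) {S S' : Finset W} (hSS : S' ⊆ S) (hc : c ∈ S')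
    (hS' : ∀ t ∈ S', π t ∈ S') (hS : ∀ t ∈ S, π t ∈ S) {f : W → V} (hf : Emb T G S' f)
    (hcard : S.card ≤ d + 1) :
    ∃ g, Emb T G S g ∧ ∀ t ∈ S', g t = f t := by
  induction hn : (S \ S').card generalizing S' f with
  | zero =>
    have : S ⊆ S' := by
      rw [Finset.card_eq_zero, Finset.sdiff_eq_empty_iff_subset] at hn
      exact hn
    exact ⟨f, hf.mono this, fun _ _ => rfl⟩
  | succ n ih =>
    have hne : (S \ S').Nonempty := by
      rw [← Finset.card_pos]; omega
    obtain ⟨s, hs, hmin⟩ := Finset.exists_min_image (S \ S') h hne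
    rw [Finset.mem_sdiff] at hs
    have hsc : s ≠ c := fun e => hs.2 (e ▸ hc)
    have hps : π s ∈ S' := by
      by_contra hcon
      have h1 := hmin (π s) (Finset.mem_sdiff.2 ⟨hS s hs.1, hcon⟩)
      have h2 := H.height s hsc
      omega
    have hlt : S'.card < S.card := Finset.card_lt_card
      ⟨hSS, fun hcon => hs.2 (hcon hs.1)⟩
    obtain ⟨z, hz, hadj⟩ := exists_adj_notMem (G := G) (x := f (π s)) (A := S'.image f)
      (Finset.mem_image_of_mem f hps)
      (by have h1 := Finset.card_image_le (s := S') (f := f); have := hd (f (π s)); omega)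
    have hemb := hf.update (w := s) (z := z)
      (fun b hb _ e => hz (e ▸ Finset.mem_image_of_mem f hb)) (by
        intro b hb hsb
        rcases ((H.adj_iff _ _).1 hsb).2 with e | e
        · rw [← e]; exact hadj.symm
        · exact absurd (e ▸ hS' b hb) hs.2)
    obtain ⟨g, hg, hgf⟩ := ih (S' := insert s S') (f := Function.update f s z)
      (Finset.insert_subset hs.1 hSS) (Finset.mem_insert_of_mem hc)
      (by
        intro t ht
        rw [Finset.mem_insert] at ht
        rcases ht with rfl | ht
        · exact Finset.mem_insert_of_mem hps
        · exact Finset.mem_insert_of_mem (hS' t ht)) hemb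
      (by
        rw [Finset.sdiff_insert, Finset.card_erase_of_mem (Finset.mem_sdiff.2 hs)]
        omega)
    refine ⟨g, hg, fun t ht => ?_⟩
    rw [hgf t (Finset.mem_insert_of_mem ht), Function.update_of_ne]
    rintro rfl
    exact hs.2 ht

theorem exists_leaves_extension {S P : Finset W} {g : W → V} {p : W} (hg : Emb T G S g)
    (hp : p ∈ S) (hPS : Disjoint P S) (hP : ∀ t ∈ P, ∀ u ∈ S ∪ P, T.Adj t u → u = p)
    (hcard : P.card ≤ (nb G (g p) \ S.image g).card) :
    ∃ g', Emb T G (S ∪ P) g' ∧ ∀ t ∈ S, g' t = g t := by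
  induction P using Finset.induction_on generalizing S g with
  | empty => exact ⟨g, by simpa using hg, fun _ _ => rfl⟩
  | @insert t P ht ih =>
    rw [Finset.card_insert_of_notMem ht] at hcard
    rw [Finset.disjoint_insert_left] at hPS
    obtain ⟨z, hz⟩ : (nb G (g p) \ S.image g).Nonempty := by
      rw [← Finset.card_pos]; omega
    rw [Finset.mem_sdiff, mem_nb] at hz
    have hemb := hg.update (w := t) (z := z)
      (fun b hb _ e => hz.2 (e ▸ Finset.mem_image_of_mem g hb)) (by
        intro b hb htb
        rw [hP t (by simp) b (by simp [hb]) htb]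
        exact hz.1.symm)
    have hup : ∀ s ∈ S, Function.update g t z s = g s := by
      intro s hs
      rw [Function.update_of_ne]
      rintro rfl
      exact hPS.1 hs
    have himg : (insert t S).image (Function.update g t z) = insert z (S.image g) := by
      rw [Finset.image_insert, Function.update_self, Finset.image_congr]
      exact hup
    have hins : insert t S ∪ P = S ∪ insert t P := by
      ext x; simp
    obtain ⟨g', h1, h2⟩ := ih (S := insert t S) (g := Function.update g t z) hemb
      (Finset.mem_insert_of_mem hp)
      (by
        rw [Finset.disjoint_insert_right]
        exact ⟨ht, hPS.2⟩)
      (by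
        intro u hu w hw
        rw [hins] at hw
        exact hP u (Finset.mem_insert_of_mem hu) w hw)
      (by
        rw [himg, hup p hp, Finset.sdiff_insert, Finset.card_erase_of_mem (by simp [hz])]
        omega)
    rw [hins] at h1
    exact ⟨g', h1, fun s hs => by rw [h2 s (Finset.mem_insert_of_mem hs), hup s hs]⟩

end

end ErdosSos

namespace ErdosSos

open scoped Classical

variable {V W : Type*}

variable {T : SimpleGraph W} {G : SimpleGraph V} [Fintype V]

/-- All neighbours of `v` have degree at most `d` and no neighbours outside the closed
neighbourhood of `v`. -/
def Bad (G : SimpleGraph V) (d : ℕ) (v : V) : Prop :=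
  ∀ x, G.Adj v x → (nb G x).card ≤ d ∧ ∀ y, G.Adj x y → y = v ∨ G.Adj v y

theorem exists_not_bad {d : ℕ} (havg : (d + 2) * Fintype.card V < ∑ x, (nb G x).card) :
    ∃ v, d + 3 ≤ (nb G v).card ∧ ¬ Bad G d v := by
  by_contra! hcon
  set B : Finset V := Finset.univ.filter (fun v => d + 3 ≤ (nb G v).card) with hB
  have hmem : ∀ v, v ∈ B ↔ d + 3 ≤ (nb G v).card := by simp [hB]
  have hsum : ∑ u, (nb G u ∩ B).card = ∑ u, if u ∈ B then (nb G u).card else 0 := by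
    have h1 : ∀ u, (nb G u ∩ B).card = ∑ v, if G.Adj u v ∧ v ∈ B then 1 else 0 := by
      intro u
      rw [← Finset.card_filter]
      congr 1
      ext x; simp
    have h2 : ∀ u, (if u ∈ B then (nb G u).card else 0)
        = ∑ v, if G.Adj v u ∧ u ∈ B then 1 else 0 := by
      intro u
      rw [← Finset.card_filter]
      split_ifs with hu
      · congr 1
        ext x; simp [hu, G.adj_comm]
      · simp [hu]
    simp_rw [h1, h2]
    rw [Finset.sum_comm]
  have hpt : ∀ u, (nb G u).card + (nb G u ∩ B).card
      ≤ d + 2 + if u ∈ B then (nb G u).card else 0 := by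
    intro u
    split_ifs with hu
    · have : nb G u ∩ B = ∅ := by
        rw [Finset.eq_empty_iff_forall_notMem]
        intro v hv
        rw [Finset.mem_inter, mem_nb, hmem] at hv
        have := (hcon u ((hmem u).1 hu) v hv.1).1
        omega
      rw [this, Finset.card_empty]
      omega
    · rw [hmem] at hu
      rcases Finset.eq_empty_or_nonempty (nb G u ∩ B) with he | ⟨v, hv⟩
      · rw [he, Finset.card_empty]
        omega
      · rw [Finset.mem_inter, mem_nb, hmem] at hv
        have h1 := hcon v hv.2 u hv.1.symm
        have h2 : (nb G u ∩ B).card ≤ 1 := by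
          have : Nonempty V := ⟨v⟩
          rw [Finset.card_le_one_iff_subset_singleton]
          refine ⟨v, fun w hw => ?_⟩
          rw [Finset.mem_inter, mem_nb, hmem] at hw
          rw [Finset.mem_singleton]
          rcases h1.2 w hw.1 with e | e
          · exact e
          · have := (hcon v hv.2 w e).1
            omega
        omega
  have hle := Finset.sum_le_sum (fun u (_ : u ∈ Finset.univ) => hpt u)
  rw [Finset.sum_add_distrib, Finset.sum_add_distrib, hsum, Finset.sum_const, Finset.card_univ,
    smul_eq_mul, mul_comm] at hle
  omega

theorem IsParent.exists_child {c : W} {π : W → W} {h : W → ℕ} (H : IsParent T c π h)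
    {S : Finset W} (hS : ∀ t ∈ S, π t ∈ S) {t : W} (ht : t ∈ S) (htc : t ≠ c) :
    ∃ r ∈ S, r ≠ c ∧ π r = c := by
  induction hn : h t generalizing t with
  | zero => have := H.height t htc; omega
  | succ n ih =>
    by_cases hp : π t = c
    · exact ⟨t, ht, htc, hp⟩
    · exact ih (hS t ht) hp (by have := H.height t htc; omega)

theorem exists_emb_or_star {c : W} {π : W → W} {h : W → ℕ} (H : IsParent T c π h) {d : ℕ}
    (hd : ∀ x, d ≤ (nb G x).card) {v : V} (hv : d + 3 ≤ (nb G v).card) (hbad : ¬ Bad G d v)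
    {S : Finset W} (hc : c ∈ S) (hS : ∀ t ∈ S, π t ∈ S) (hcard : S.card = d + 2) :
    (∃ g, Emb T G S g ∧ g c = v) ∨ ∃ p ∈ S, p ≠ c ∧ ∀ t ∈ S, t = c ∨ t = p ∨ π t = p := by
  obtain ⟨l, hl, hmax⟩ := Finset.exists_max_image S h ⟨c, hc⟩
  by_cases hl1 : h l ≤ 1
  · left
    obtain ⟨g, hg, hgc⟩ := exists_leaves_extension (P := S.erase c) (emb_singleton (T := T) (G := G) c v)
      (Finset.mem_singleton_self c) (by simp) (by
        intro t ht u hu htu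
        have huS : u ∈ S := by
          rw [Finset.mem_union, Finset.mem_singleton, Finset.mem_erase] at hu
          rcases hu with rfl | hu
          · exact hc
          · exact hu.2
        rw [Finset.mem_erase] at ht
        have h1 := H.height t ht.1
        have h2 := hmax t ht.2
        have h3 := hmax u huS
        rcases (H.adj_iff _ _).1 htu with ⟨hne, e | e⟩
        · subst e
          by_contra hcon
          have := H.height _ hcon
          omega
        · have := H.height u (H.ne_root e hne.symm)
          rw [e] at this
          omega) (by
        have h1 := Finset.le_card_sdiff {v} (nb G v)
        rw [Finset.card_singleton] at h1
        rw [Finset.card_erase_of_mem hc, Finset.image_singleton]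
        omega)
    refine ⟨g, ?_, by simpa using hgc c (by simp)⟩
    refine hg.mono ?_
    intro t ht
    by_cases e : t = c <;> simp [e, ht]
  push Not at hl1
  by_contra! hcon
  obtain ⟨hno, hstar⟩ := hcon
  have hlc : l ≠ c := by
    rintro rfl
    rw [H.height_root] at hl1
    omega
  obtain ⟨p, hp⟩ : ∃ p, p = π l := ⟨_, rfl⟩
  obtain ⟨q, hq⟩ : ∃ q, q = π p := ⟨_, rfl⟩
  have hhp := H.height l hlc
  rw [← hp] at hhp
  have hpc : p ≠ c := by
    intro e
    rw [e, H.height_root] at hhp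
    omega
  have hhq := H.height p hpc
  rw [← hq] at hhq
  have hpS : p ∈ S := hp ▸ hS l hl
  have hqS : q ∈ S := hq ▸ hS p hpS
  set P := S.filter (fun t => π t = p) with hP
  have memP : ∀ t, t ∈ P ↔ t ∈ S ∧ π t = p := by simp [hP]
  have hPh : ∀ t ∈ P, t ≠ c ∧ h t = h l := by
    intro t ht
    rw [memP] at ht
    have htc : t ≠ c := by
      rintro rfl
      exact hpc (ht.2.symm.trans H.root)
    have := H.height t htc
    rw [ht.2] at this
    exact ⟨htc, by omega⟩
  have hqp : q ≠ p := by
    intro e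
    rw [e] at hhq
    omega
  have hqP : q ∉ P := by
    intro e
    have := (hPh q e).2
    omega
  have hcP : c ∉ P := fun e => (hPh c e).1 rfl
  have hpP : p ∉ P := by
    intro e
    have := (hPh p e).2
    omega
  set S0 := (S.erase p) \ P with hS0
  have mem0 : ∀ t, t ∈ S0 ↔ t ∈ S ∧ t ≠ p ∧ t ∉ P := by
    intro t; simp only [hS0, Finset.mem_sdiff, Finset.mem_erase]; tauto
  have hc0 : c ∈ S0 := (mem0 c).2 ⟨hc, hpc.symm, hcP⟩
  have hq0 : q ∈ S0 := (mem0 q).2 ⟨hqS, hqp, hqP⟩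
  have hcl0 : ∀ t ∈ S0, π t ∈ S0 := by
    intro t ht
    by_cases htc : t = c
    · rw [htc, H.root]; exact hc0
    have ht' := (mem0 t).1 ht
    rw [mem0]
    refine ⟨hS t ht'.1, fun e => ht'.2.2 ((memP t).2 ⟨ht'.1, e⟩), fun e => ?_⟩
    have h1 := hPh _ e
    have h2 := H.height t htc
    have h3 := hmax t ht'.1
    omega
  have hPpos : 0 < P.card := Finset.card_pos.2 ⟨l, (memP l).2 ⟨hl, hp.symm⟩⟩
  have hcard0 : S0.card + P.card = d + 1 := by
    have h1 : P ⊆ S.erase p := by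
      intro t ht
      rw [Finset.mem_erase]
      exact ⟨fun e => hpP (e ▸ ht), ((memP t).1 ht).1⟩
    have h2 := Finset.card_sdiff_add_card_eq_card h1
    rw [Finset.card_erase_of_mem hpS] at h2
    rw [hS0]
    omega
  have hunion : ∀ t, t ∈ insert p S0 ∪ P ↔ t ∈ S := by
    intro t
    rw [Finset.mem_union, Finset.mem_insert, mem0]
    constructor
    · rintro ((rfl | h) | h)
      · exact hpS
      · exact h.1
      · exact ((memP t).1 h).1
    · intro h
      tauto
  have K : ∀ g, Emb T G S0 g → g c = v → ∀ z, (∀ t ∈ S0, g t ≠ z) → G.Adj z (g q) →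
      (nb G z \ S0.image g).card < P.card := by
    intro g hg hgc z hz hzq
    by_contra! hlt
    have hup : ∀ s ∈ S0, Function.update g p z s = g s := by
      intro s hs
      rw [Function.update_of_ne]
      exact ((mem0 s).1 hs).2.1
    have hemb := hg.update (w := p) (z := z) (fun b hb _ => hz b hb) (by
      intro b hb hpb
      rcases (H.adj_iff _ _).1 hpb with ⟨hne, e | e⟩
      · rw [← e, ← hq]; exact hzq
      · exact absurd ((memP b).2 ⟨((mem0 b).1 hb).1, e⟩) ((mem0 b).1 hb).2.2)
    have himg : (insert p S0).image (Function.update g p z) = insert z (S0.image g) := by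
      rw [Finset.image_insert, Function.update_self, Finset.image_congr]
      exact hup
    obtain ⟨g', hg', hgg⟩ := exists_leaves_extension (P := P) hemb
      (Finset.mem_insert_self p S0)
      (by
        rw [Finset.disjoint_insert_right]
        refine ⟨hpP, ?_⟩
        rw [Finset.disjoint_right]
        exact fun t ht => ((mem0 t).1 ht).2.2)
      (by
        intro t ht u hu htu
        rw [hunion] at hu
        rcases (H.adj_iff _ _).1 htu with ⟨hne, e | e⟩
        · rw [← e]; exact ((memP t).1 ht).2
        · have h1 := H.height u (H.ne_root e hne.symm)
          have h2 := hmax u hu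
          have h3 := hPh t ht
          rw [e] at h1
          omega)
      (by
        rw [himg, Function.update_self, Finset.sdiff_insert, Finset.erase_eq_of_notMem]
        · exact hlt
        · simp)
    refine hno g' (hg'.mono fun t ht => (hunion t).2 ht) ?_
    rw [hgg c (Finset.mem_insert_of_mem hc0), hup c hc0, hgc]
  have hK : ∀ g, Emb T G S0 g → g c = v → ∀ z, (∀ t ∈ S0, g t ≠ z) → G.Adj z (g q) →
      (∀ t ∈ S0, G.Adj z (g t)) ∧ (nb G z).card ≤ d := by
    intro g hg hgc z hz hzq
    have h1 := K g hg hgc z hz hzq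
    have h2 := Finset.card_inter_add_card_sdiff (nb G z) (S0.image g)
    have h3 : (S0.image g).card ≤ S0.card := Finset.card_image_le
    have h4 := hd z
    have h5 : (nb G z ∩ S0.image g).card ≤ (S0.image g).card :=
      Finset.card_le_card Finset.inter_subset_right
    refine ⟨fun t ht => ?_, by omega⟩
    have h6 := Finset.eq_of_subset_of_card_le
      (Finset.inter_subset_right : nb G z ∩ S0.image g ⊆ S0.image g) (by omega)
    have h7 := Finset.mem_image_of_mem g ht
    rw [← h6, Finset.mem_inter, mem_nb] at h7
    exact h7.1
  by_cases hqc : q = c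
  · obtain ⟨g, hg, hgc⟩ := exists_extension H hd (S := S0) (S' := {c}) (by simpa using hc0)
      (by simp) (by simp [H.root]) hcl0 (emb_singleton (T := T) (G := G) c v) (by omega)
    have hgc : g c = v := by simpa using hgc c (by simp)
    have hex : ∃ t ∈ S0, t ≠ c := by
      by_contra! hall
      obtain ⟨t, ht, h1, h2, h3⟩ := hstar p hpS hpc
      refine h1 (hall t ((mem0 t).2 ⟨ht, h2, fun e => h3 ((memP t).1 e).2⟩))
    obtain ⟨t, ht, htc⟩ := hex
    obtain ⟨p2, hp2, hp2c, hpp2⟩ := H.exists_child hcl0 ht htc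
    have hZcard : P.card + 2 ≤ (nb G v \ S0.image g).card := by
      have h1 := Finset.le_card_sdiff (S0.image g) (nb G v)
      have h3 : (S0.image g).card ≤ S0.card := Finset.card_image_le
      omega
    obtain ⟨z, hz⟩ : (nb G v \ S0.image g).Nonempty := by
      rw [← Finset.card_pos]; omega
    have hZ : ∀ z ∈ nb G v \ S0.image g, (∀ t ∈ S0, g t ≠ z) ∧ ∀ t ∈ S0, G.Adj z (g t) := by
      intro z hz
      rw [Finset.mem_sdiff, mem_nb] at hz
      have h1 : ∀ t ∈ S0, g t ≠ z := fun t ht e => hz.2 (e ▸ Finset.mem_image_of_mem g ht)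
      exact ⟨h1, (hK g hg hgc z h1 (by rw [hqc, hgc]; exact hz.1.symm)).1⟩
    have hzz := hZ z hz
    have hg1 := hg.swap hp2 (z := z) (fun b hb _ => hzz.1 b hb) (fun b hb _ => hzz.2 b hb)
    have hnot : ∀ t ∈ S0, Function.update g p2 z t ≠ g p2 := by
      intro t ht
      by_cases e : t = p2
      · rw [e, Function.update_self]
        exact (hzz.1 p2 hp2).symm
      · rw [Function.update_of_ne e]
        exact fun e' => e (hg.inj t ht p2 hp2 e')
    have hlt := K _ hg1 (by rw [Function.update_of_ne hp2c.symm, hgc]) (g p2) hnot (by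
      rw [hqc, Function.update_of_ne hp2c.symm]
      exact hg.adj p2 hp2 c hc0 (hpp2 ▸ H.adj hp2c))
    have hsub : (nb G v \ S0.image g).erase z ⊆
        nb G (g p2) \ S0.image (Function.update g p2 z) := by
      intro y hy
      rw [Finset.mem_erase] at hy
      have h1 := hZ y hy.2
      rw [Finset.mem_sdiff, mem_nb]
      refine ⟨(h1.2 p2 hp2).symm, fun e => ?_⟩
      rw [Finset.mem_image] at e
      obtain ⟨s, hs, e⟩ := e
      by_cases e1 : s = p2
      · rw [e1, Function.update_self] at e
        exact hy.1 e.symm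
      · rw [Function.update_of_ne e1] at e
        exact h1.1 s hs e
    have h1 := Finset.card_le_card hsub
    rw [Finset.card_erase_of_mem hz] at h1
    omega
  · have hbad' : ∃ y1, G.Adj v y1 ∧
        ((nb G y1).card ≤ d → ∃ s, G.Adj y1 s ∧ s ≠ v ∧ ¬ G.Adj v s) := by
      by_contra! hcon
      exact hbad fun x hx => ⟨(hcon x hx).1, fun y hy => by
        by_contra! h'
        exact h'.2 ((hcon x hx).2 y hy h'.1)⟩
    obtain ⟨y1, hy1, hy1s⟩ := hbad'
    obtain ⟨r1, hr1, hr1c, hpr1⟩ := H.exists_child hcl0 hq0 hqc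
    have hf0 := (emb_singleton (T := T) (G := G) c v).update (w := r1) (z := y1)
      (fun _ _ _ => hy1.ne) (fun _ _ _ => hy1.symm)
    obtain ⟨g, hg, hgf⟩ := exists_extension H hd (S := S0) (S' := {r1, c})
      (by
        intro t ht
        rw [Finset.mem_insert, Finset.mem_singleton] at ht
        rcases ht with rfl | rfl
        · exact hr1
        · exact hc0) (by simp)
      (by
        intro t ht
        rw [Finset.mem_insert, Finset.mem_singleton] at ht
        rcases ht with rfl | rfl
        · simp [hpr1]
        · simp [H.root]) hcl0 hf0 (by omega)
    have hgc : g c = v := by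
      rw [hgf c (by simp), Function.update_of_ne hr1c.symm]
    have hgr : g r1 = y1 := by
      rw [hgf r1 (by simp), Function.update_self]
    obtain ⟨z, hz, hqz⟩ := exists_adj_notMem (G := G) (Finset.mem_image_of_mem g hq0) (by
      have h3 : (S0.image g).card ≤ S0.card := Finset.card_image_le
      have := hd (g q)
      omega)
    have hz : ∀ t ∈ S0, g t ≠ z := fun t ht e => hz (e ▸ Finset.mem_image_of_mem g ht)
    have hzK := (hK g hg hgc z hz hqz.symm).1
    have hswap : ∀ t ∈ S0, Emb T G S0 (Function.update g t z) := fun t ht =>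
      hg.swap ht (fun b hb _ => hz b hb) (fun b hb _ => hzK b hb)
    have hnot : ∀ t ∈ S0, ∀ s ∈ S0, Function.update g t z s ≠ g t := by
      intro t ht s hs
      by_cases e : s = t
      · rw [e, Function.update_self]
        exact (hz t ht).symm
      · rw [Function.update_of_ne e]
        exact fun e' => e (hg.inj s hs t ht e')
    have hq' := hK _ (hswap q hq0) (by rw [Function.update_of_ne (Ne.symm hqc), hgc]) (g q)
      (hnot q hq0) (by rw [Function.update_self]; exact hqz)
    have hall : ∀ t ∈ S0, t ≠ c → (∀ s ∈ S0, G.Adj (g t) (Function.update g t z s)) ∧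
        (nb G (g t)).card ≤ d := by
      intro t ht htc
      by_cases e : t = q
      · subst e; exact hq'
      · refine hK _ (hswap t ht) (by rw [Function.update_of_ne (Ne.symm htc), hgc]) (g t)
          (hnot t ht) ?_
        rw [Function.update_of_ne (Ne.symm e)]
        have := hq'.1 t ht
        rw [Function.update_of_ne e] at this
        exact this.symm
    have hallv : ∀ t ∈ S0, t ≠ c → G.Adj v (g t) := by
      intro t ht htc
      have := (hall t ht htc).1 c hc0
      rw [Function.update_of_ne (Ne.symm htc), hgc] at this
      exact this.symm
    obtain ⟨s, hys, hsv, hnvs⟩ := hy1s (hgr ▸ (hall r1 hr1 hr1c).2)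
    have hs0 : ∀ t ∈ S0, g t ≠ s := by
      intro t ht e
      by_cases htc : t = c
      · rw [htc, hgc] at e; exact hsv e.symm
      · exact hnvs (e ▸ hallv t ht htc)
    by_cases hrq : r1 = q
    · refine hnvs ?_
      rw [← hgc]
      exact ((hK g hg hgc s hs0 (by rw [← hrq, hgr]; exact hys.symm)).1 c hc0).symm
    · have hsz : s ≠ z := by
        rintro rfl
        exact hnvs (hgc ▸ (hzK c hc0).symm)
      have h2 := (hswap r1 hr1).swap hq0 (z := y1)
        (fun b hb _ => hgr ▸ hnot r1 hr1 b hb)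
        (fun b hb _ => hgr ▸ (hall r1 hr1 hr1c).1 b hb)
      have h3 : ∀ t ∈ S0, Function.update (Function.update g r1 z) q y1 t ≠ s := by
        intro t ht
        by_cases e : t = q
        · rw [e, Function.update_self]
          exact hys.ne
        · rw [Function.update_of_ne e]
          by_cases e' : t = r1
          · rw [e', Function.update_self]
            exact hsz.symm
          · rw [Function.update_of_ne e']
            exact hs0 t ht
      have h4 := (hK _ h2 (by
        rw [Function.update_of_ne (Ne.symm hqc), Function.update_of_ne (Ne.symm hr1c), hgc]) s h3
        (by rw [Function.update_self]; exact hys.symm)).1 c hc0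
      rw [Function.update_of_ne (Ne.symm hqc), Function.update_of_ne (Ne.symm hr1c), hgc] at h4
      exact hnvs h4.symm

end ErdosSos

namespace ErdosSos

open scoped Classical

variable {V W : Type*}

variable {T : SimpleGraph W} {G : SimpleGraph V} [Fintype V] [Fintype W]

theorem card_succ_le_card_sdiff_add {x : V} {A : Finset V} (hx : x ∈ A) :
    (nb G x).card + 1 ≤ (nb G x \ A).card + A.card := by
  have h1 := Finset.card_inter_add_card_sdiff (nb G x) A
  have h2 : nb G x ∩ A ⊆ A.erase x := by
    intro y hy
    rw [Finset.mem_inter, mem_nb] at hy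
    exact Finset.mem_erase.2 ⟨hy.1.ne', hy.2⟩
  have h3 := Finset.card_le_card h2
  have h4 := Finset.card_erase_add_one hx
  omega

theorem exists_emb_of_leaves (hT : T.IsTree) {d : ℕ} (hd : ∀ x, d ≤ (nb G x).card) {p : W}
    {P : Finset W} (hP : ∀ t ∈ P, T.Adj p t ∧ ∀ u, T.Adj t u → u = p)
    (hW : Fintype.card W ≤ d + 1 + P.card) {v : V} (hv : Fintype.card W ≤ (nb G v).card + 1) :
    ∃ f, Emb T G Finset.univ f := by
  obtain ⟨π, h, H⟩ := exists_isParent hT p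
  have hpP : p ∉ P := fun e => T.irrefl (hP p e).1
  have hPc : (Finset.univ \ P).card + P.card = Fintype.card W := by
    rw [Finset.card_sdiff_add_card_eq_card (Finset.subset_univ P), Finset.card_univ]
  have hpS : p ∈ Finset.univ \ P := by simpa using hpP
  obtain ⟨g, hg, hgc⟩ := exists_extension H hd (S := Finset.univ \ P) (S' := {p}) (by simpa using hpP)
    (by simp) (by simp [H.root])
    (by
      intro t ht
      by_cases e : t = p
      · rw [e, H.root]; exact hpS
      · rw [Finset.mem_sdiff]
        exact ⟨Finset.mem_univ _, fun hcon => e ((hP _ hcon).2 t (H.adj e).symm)⟩)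
    (emb_singleton p v) (by omega)
  have hgc : g p = v := by simpa using hgc p (by simp)
  obtain ⟨g', hg', -⟩ := exists_leaves_extension hg hpS Finset.disjoint_sdiff
    (fun t ht u _ htu => (hP t ht).2 u htu) (by
      have h1 := card_succ_le_card_sdiff_add (G := G) (Finset.mem_image_of_mem g hpS)
      have h2 : ((Finset.univ \ P).image g).card ≤ _ := Finset.card_image_le
      rw [hgc] at h1 ⊢
      omega)
  exact ⟨g', hg'.mono fun t _ => by simp⟩

/-- Lemma for rooted embeddings of all but two vertices, `c` being sent to `v`. -/
theorem exists_emb_or_exists_rooted (hT : T.IsTree) {c : W} {π : W → W} {h : W → ℕ}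
    (H : IsParent T c π h) {d : ℕ} (hd : ∀ x, d ≤ (nb G x).card)
    (hsm : d ≤ 2 → ∀ x, d + 1 ≤ (nb G x).card) (hW : Fintype.card W = d + 4)
    {v : V} (hv : d + 3 ≤ (nb G v).card) (hbad : ¬ Bad G d v)
    {S : Finset W} (hc : c ∈ S) (hS : ∀ t ∈ S, π t ∈ S) (hcard : S.card = d + 2)
    (hout : ∀ u, u ∉ S → π u ∈ S → π u = c) :
    (∃ f, Emb T G Finset.univ f) ∨ ∃ g, Emb T G S g ∧ g c = v := by
  by_cases hd2 : d ≤ 2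
  · right
    obtain ⟨g, hg, hgc⟩ := exists_extension H (hsm hd2) (S := S) (S' := {c}) (by simpa using hc)
      (by simp) (by simp [H.root]) hS (emb_singleton (T := T) (G := G) c v) (by omega)
    exact ⟨g, hg, by simpa using hgc c (by simp)⟩
  · rcases exists_emb_or_star H hd hv hbad hc hS hcard with h | ⟨p, hp, hpc, hstar⟩
    · exact Or.inr h
    · left
      refine exists_emb_of_leaves hT hd (p := p) (P := (S.erase c).erase p) (v := v) ?_ ?_ (by omega)
      · intro t ht
        rw [Finset.mem_erase, Finset.mem_erase] at ht
        have hpt : π t = p := by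
          rcases hstar t ht.2.2 with e | e | e
          · exact absurd e ht.2.1
          · exact absurd e ht.1
          · exact e
        have hht := H.height t ht.2.1
        have hhp := H.height p hpc
        refine ⟨hpt ▸ (H.adj ht.2.1).symm, fun u htu => ?_⟩
        rcases (H.adj_iff _ _).1 htu with ⟨hne, e | e⟩
        · exact e.symm.trans hpt
        · have hhu := H.height u (H.ne_root e hne.symm)
          by_cases hu : u ∈ S
          · rcases hstar u hu with e' | e' | e'
            · rw [e', H.root] at e; exact absurd e.symm ht.2.1
            · exact e'
            · exact absurd (e.symm.trans e') ht.1
          · have := hout u hu (e ▸ ht.2.2)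
            exact absurd (e.symm.trans this) ht.2.1
      · rw [Finset.card_erase_of_mem (Finset.mem_erase.2 ⟨hpc, hp⟩), Finset.card_erase_of_mem hc]
        omega

theorem exists_emb_of_two_leaves (hT : T.IsTree) {d : ℕ} (hd : ∀ x, d ≤ (nb G x).card)
    (hsm : d ≤ 2 → ∀ x, d + 1 ≤ (nb G x).card) (hW : Fintype.card W = d + 4)
    {v : V} (hv : d + 3 ≤ (nb G v).card) (hbad : ¬ Bad G d v)
    {p l l' : W} (hl : T.Adj p l ∧ ∀ u, T.Adj l u → u = p)
    (hl' : T.Adj p l' ∧ ∀ u, T.Adj l' u → u = p) (hne : l ≠ l') :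
    ∃ f, Emb T G Finset.univ f := by
  obtain ⟨π, h, H⟩ := exists_isParent hT p
  set P : Finset W := {l, l'} with hP
  have hPl : ∀ t ∈ P, T.Adj p t ∧ ∀ u, T.Adj t u → u = p := by
    intro t ht
    rw [hP, Finset.mem_insert, Finset.mem_singleton] at ht
    rcases ht with rfl | rfl
    · exact hl
    · exact hl'
  have hP2 : P.card = 2 := Finset.card_pair hne
  have hpP : p ∉ P := fun e => T.irrefl (hPl p e).1
  have hPc : (Finset.univ \ P).card + P.card = Fintype.card W := by
    rw [Finset.card_sdiff_add_card_eq_card (Finset.subset_univ P), Finset.card_univ]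
  have hpS : p ∈ Finset.univ \ P := by simpa using hpP
  rcases exists_emb_or_exists_rooted hT H hd hsm hW hv hbad hpS
    (by
      intro t ht
      by_cases e : t = p
      · rw [e, H.root]; exact hpS
      · rw [Finset.mem_sdiff]
        exact ⟨Finset.mem_univ _, fun hcon => e ((hPl _ hcon).2 t (H.adj e).symm)⟩)
    (by omega)
    (by
      intro u hu _
      have hu : u ∈ P := by simpa using hu
      have : u ≠ p := fun e => hpP (e ▸ hu)
      exact (hPl u hu).2 _ (H.adj this)) with h | ⟨g, hg, hgc⟩
  · exact h
  · obtain ⟨g', hg', -⟩ := exists_leaves_extension hg hpS Finset.disjoint_sdiff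
      (fun t ht u _ htu => (hPl t ht).2 u htu) (by
        have h1 := card_succ_le_card_sdiff_add (G := G) (Finset.mem_image_of_mem g hpS)
        have h2 : ((Finset.univ \ P).image g).card ≤ _ := Finset.card_image_le
        rw [hgc] at h1 ⊢
        omega)
    exact ⟨g', hg'.mono fun t _ => by simp⟩

/-- A tree rooted at `c`, with a pendant path `a`, `b` hanging from `c`. -/
structure Pendant (T : SimpleGraph W) (c : W) (π : W → W) (h : W → ℕ) (a b : W) : Prop
    extends IsParent T c π h where
  parent_b : π b = c
  parent_a : π a = b
  b_ne : b ≠ c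
  child_b : ∀ u, π u = b → u = a
  child_a : ∀ u, π u ≠ a

omit [Fintype V] in
theorem exists_pendant (hT : T.IsTree) (hW : 3 ≤ Fintype.card W)
    (hone : ∀ p l l', T.Adj p l → (∀ u, T.Adj l u → u = p) → T.Adj p l' →
      (∀ u, T.Adj l' u → u = p) → l = l') :
    ∃ c π h a b, Pendant T c π h a b := by
  have : Nonempty W := by
    rw [← Fintype.card_pos_iff]; omega
  obtain ⟨r⟩ := this
  obtain ⟨π, h, H⟩ := exists_isParent hT r
  obtain ⟨a, -, hmax⟩ := Finset.exists_max_image Finset.univ h ⟨r, Finset.mem_univ r⟩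
  have hleaf : ∀ t, t ≠ r → h t = h a → T.Adj (π t) t ∧ ∀ u, T.Adj t u → u = π t := by
    intro t ht hta
    refine ⟨(H.adj ht).symm, fun u htu => ?_⟩
    rcases (H.adj_iff _ _).1 htu with ⟨hne, e | e⟩
    · exact e.symm
    · have h1 := H.height u (H.ne_root e hne.symm)
      have h2 := hmax u (Finset.mem_univ u)
      rw [e] at h1
      omega
  have ha2 : 2 ≤ h a := by
    by_contra! hlt
    have hall : ∀ t, t ≠ r → π t = r ∧ h t = h a := by
      intro t ht
      have h1 := H.height t ht
      have h2 := hmax t (Finset.mem_univ t)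
      refine ⟨?_, by omega⟩
      by_contra hcon
      have := H.height _ hcon
      omega
    have h2 : 1 < (Finset.univ.erase r).card := by
      rw [Finset.card_erase_of_mem (Finset.mem_univ r), Finset.card_univ]
      omega
    obtain ⟨t, ht, t', ht', hne⟩ := Finset.one_lt_card.1 h2
    have ht := Finset.ne_of_mem_erase ht
    have ht' := Finset.ne_of_mem_erase ht'
    have e1 := hleaf t ht (hall t ht).2
    have e2 := hleaf t' ht' (hall t' ht').2
    rw [(hall t ht).1] at e1
    rw [(hall t' ht').1] at e2
    exact hne (hone r t t' e1.1 e1.2 e2.1 e2.2)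
  have har : a ≠ r := by
    rintro rfl
    rw [H.height_root] at ha2
    omega
  have hha := H.height a har
  obtain ⟨b, hb⟩ : ∃ b, b = π a := ⟨_, rfl⟩
  rw [← hb] at hha
  have hbr : b ≠ r := by
    rintro rfl
    rw [H.height_root] at hha
    omega
  have hhb := H.height b hbr
  obtain ⟨c, hc⟩ : ∃ c, c = π b := ⟨_, rfl⟩
  rw [← hc] at hhb
  have hbc : b ≠ c := by
    intro e; rw [e] at hhb; omega
  have hac : a ≠ c := by
    rintro rfl; omega
  have hab : a ≠ b := by
    intro e; rw [e] at hha; omega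
  have adj_ab : T.Adj a b := hb ▸ H.adj har
  have adj_bc : T.Adj b c := hc ▸ H.adj hbr
  have nb_a : ∀ u, T.Adj a u → u = b := fun u hu => hb ▸ (hleaf a har rfl).2 u hu
  have nb_b : ∀ u, T.Adj b u → u = a ∨ u = c := by
    intro u hu
    rcases (H.adj_iff _ _).1 hu with ⟨hne, e | e⟩
    · right; rw [hc, e]
    · left
      have hur := H.ne_root e hne.symm
      have h1 := H.height u hur
      rw [e] at h1
      have h2 := hleaf u hur (by omega)
      have h3 := hleaf a har rfl
      rw [e] at h2
      rw [← hb] at h3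
      exact hone b u a h2.1 h2.2 h3.1 h3.2
  obtain ⟨π', h', H'⟩ := exists_isParent hT c
  have pb : π' b = c := by
    rcases ((H'.adj_iff _ _).1 adj_bc).2 with e | e
    · exact e
    · rw [H'.root] at e; exact absurd e.symm hbc
  have pa : π' a = b := by
    rcases ((H'.adj_iff _ _).1 adj_ab).2 with e | e
    · exact e
    · rw [pb] at e; exact absurd e.symm hac
  refine ⟨c, π', h', a, b, H', pb, pa, hbc, fun u hu => ?_, fun u hu => ?_⟩
  · have hub : u ≠ b := by
      rintro rfl
      exact hbc (hu.symm.trans pb)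
    rcases nb_b u ((H'.adj_iff _ _).2 ⟨hub.symm, Or.inr hu⟩) with e | e
    · exact e
    · rw [e, H'.root] at hu
      exact absurd hu.symm hbc
  · have hua : u ≠ a := by
      rintro rfl
      exact hab (hu.symm.trans pa)
    have := nb_a u ((H'.adj_iff _ _).2 ⟨hua.symm, Or.inr hu⟩)
    rw [this, pb] at hu
    exact hac hu.symm

end ErdosSos

namespace ErdosSos

open scoped Classical

variable {V W : Type*}

variable {T : SimpleGraph W} {G : SimpleGraph V} [Fintype V] [Fintype W]

/-- A tree of order `d + 4` with a pendant path that does not embed into `G`. -/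
structure Critical (T : SimpleGraph W) (G : SimpleGraph V) (d : ℕ) (v : V) (c : W) (π : W → W)
    (h : W → ℕ) (a b : W) : Prop extends Pendant T c π h a b where
  not_emb : ∀ f, ¬ Emb T G Finset.univ f
  le_deg : ∀ x, d ≤ (nb G x).card
  lt_deg : d ≤ 2 → ∀ x, d + 1 ≤ (nb G x).card
  card_eq : Fintype.card W = d + 4
  le_deg_v : d + 3 ≤ (nb G v).card
  not_bad : ¬ Bad G d v
  leaf_unique : ∀ t t', t ≠ c → t' ≠ c → π t = π t' → (∀ u, π u ≠ t) → (∀ u, π u ≠ t') → t = t'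

/-- All vertices but `a` and `b`. -/
noncomputable def rest (a b : W) : Finset W := Finset.univ.filter (fun t => t ≠ a ∧ t ≠ b)

@[simp]
theorem mem_rest {a b t : W} : t ∈ rest a b ↔ t ≠ a ∧ t ≠ b := by simp [rest]

/-- An embedding of `rest a b` with `c` sent to `v`. -/
def Valid (T : SimpleGraph W) (G : SimpleGraph V) (v : V) (c a b : W) (f : W → V) : Prop :=
  Emb T G (rest a b) f ∧ f c = v

/-- Neighbours of `v` not used by `f`. -/
noncomputable def free (G : SimpleGraph V) (v : V) (a b : W) (f : W → V) : Finset V :=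
  nb G v \ (rest a b).image f

theorem mem_free {v : V} {a b : W} {f : W → V} {z : V} :
    z ∈ free G v a b f ↔ G.Adj v z ∧ ∀ t ∈ rest a b, f t ≠ z := by
  simp [free]

/-- Vertices of `rest a b` whose image is not adjacent to `z`. -/
noncomputable def miss (G : SimpleGraph V) (a b : W) (f : W → V) (z : V) : Finset W :=
  (rest a b).filter (fun t => ¬ G.Adj z (f t))

omit [Fintype V] in
theorem mem_miss {a b : W} {f : W → V} {z : V} {t : W} :
    t ∈ miss G a b f z ↔ t ∈ rest a b ∧ ¬ G.Adj z (f t) := by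
  simp only [miss, Finset.mem_filter]

namespace Critical

variable {d : ℕ} {v : V} {c : W} {π : W → W} {h : W → ℕ} {a b : W}

theorem a_ne_c (C : Critical T G d v c π h a b) : a ≠ c := by
  rintro rfl
  exact C.b_ne (C.parent_a.symm.trans C.root)

theorem a_ne_b (C : Critical T G d v c π h a b) : a ≠ b := by
  rintro rfl
  exact C.b_ne (C.parent_a.symm.trans C.parent_b)

theorem c_mem (C : Critical T G d v c π h a b) : c ∈ rest a b :=
  mem_rest.2 ⟨C.a_ne_c.symm, C.b_ne.symm⟩

theorem parent_mem (C : Critical T G d v c π h a b) {t : W} (ht : t ∈ rest a b) :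
    π t ∈ rest a b := by
  rw [mem_rest] at ht ⊢
  exact ⟨C.child_a t, fun e => ht.1 (C.child_b t e)⟩

theorem card_rest (C : Critical T G d v c π h a b) : (rest a b).card = d + 2 := by
  have h1 : rest a b = (Finset.univ.erase a).erase b := by
    ext t; simp [and_comm]
  rw [h1, Finset.card_erase_of_mem (by simpa using C.a_ne_b.symm),
    Finset.card_erase_of_mem (Finset.mem_univ a), Finset.card_univ, C.card_eq]
  omega

theorem adj_b (C : Critical T G d v c π h a b) {t : W} (ht : t ∈ rest a b) (hbt : T.Adj b t) :
    t = c := by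
  rcases ((C.adj_iff _ _).1 hbt).2 with e | e
  · exact e.symm.trans C.parent_b
  · exact absurd (C.child_b t e) (mem_rest.1 ht).1

theorem adj_a (C : Critical T G d v c π h a b) {t : W} (hbt : T.Adj a t) : t = b := by
  rcases ((C.adj_iff _ _).1 hbt).2 with e | e
  · exact e.symm.trans C.parent_a
  · exact absurd e (C.child_a t)

theorem extend (C : Critical T G d v c π h a b) {g : W → V} (hg : Emb T G (rest a b) g) {x y : V}
    (hx : ∀ t ∈ rest a b, g t ≠ x) (hy : ∀ t ∈ rest a b, g t ≠ y) (hcx : G.Adj (g c) x)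
    (hxy : G.Adj x y) : False := by
  have h1 := hg.update (w := b) (z := x) (fun t ht _ => hx t ht) (by
    intro t ht hbt
    rw [C.adj_b ht hbt]
    exact hcx.symm)
  have h2 := h1.update (w := a) (z := y) (by
    intro t ht _
    rcases Finset.mem_insert.1 ht with rfl | ht
    · rw [Function.update_self]; exact hxy.ne
    · rw [Function.update_of_ne (mem_rest.1 ht).2]; exact hy t ht) (by
    intro t _ hat
    rw [C.adj_a hat, Function.update_self]
    exact hxy.symm)
  refine C.not_emb _ (h2.mono ?_)
  intro t _
  by_cases e1 : t = a <;> by_cases e2 : t = b <;> simp [e1, e2]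

theorem exists_of_free_adj (C : Critical T G d v c π h a b) {f : W → V}
    (hf : Valid T G v c a b f) {z x : V} (hz : z ∈ free G v a b f) (hzx : G.Adj z x) :
    ∃ t ∈ rest a b, f t = x := by
  by_contra! hcon
  rw [mem_free] at hz
  exact C.extend hf.1 hz.2 hcon (hf.2.symm ▸ hz.1) hzx

theorem not_adj_free (C : Critical T G d v c π h a b) {f : W → V}
    (hf : Valid T G v c a b f) {z x : V} (hz : z ∈ free G v a b f) (hx : x ∈ free G v a b f) :
    ¬ G.Adj z x := by
  intro e
  obtain ⟨t, ht, e⟩ := C.exists_of_free_adj hf hz e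
  exact (mem_free.1 hx).2 t ht e

theorem valid_swap (C : Critical T G d v c π h a b) {f : W → V} (hf : Valid T G v c a b f) {z : V}
    (hz : z ∈ free G v a b f) {w : W} (hw : w ∈ rest a b) (hwc : w ≠ c)
    (hm : ∀ m ∈ miss G a b f z, ¬ T.Adj w m) : Valid T G v c a b (Function.update f w z) := by
  rw [mem_free] at hz
  refine ⟨hf.1.swap hw (fun t ht _ => hz.2 t ht) ?_, ?_⟩
  · intro t ht hwt
    by_contra hcon
    exact hm t (mem_miss.2 ⟨ht, hcon⟩) hwt
  · rw [Function.update_of_ne hwc.symm]; exact hf.2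

theorem mem_free_swap (C : Critical T G d v c π h a b) {f : W → V} (_hf : Valid T G v c a b f)
    {z z' : V} (hz' : z' ∈ free G v a b f) (hne : z ≠ z')
    {w : W} : z' ∈ free G v a b (Function.update f w z) := by
  rw [mem_free] at hz' ⊢
  refine ⟨hz'.1, fun t ht => ?_⟩
  by_cases e : t = w
  · rw [e, Function.update_self]; exact hne
  · rw [Function.update_of_ne e]; exact hz'.2 t ht

theorem image_mem_free_swap (C : Critical T G d v c π h a b) {f : W → V}
    (hf : Valid T G v c a b f) {z : V} (hz : z ∈ free G v a b f) {w : W} (hw : w ∈ rest a b)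
    (hvw : G.Adj v (f w)) : f w ∈ free G v a b (Function.update f w z) := by
  rw [mem_free] at hz ⊢
  refine ⟨hvw, fun t ht => ?_⟩
  by_cases e : t = w
  · rw [e, Function.update_self]; exact (hz.2 w hw).symm
  · rw [Function.update_of_ne e]
    exact fun e' => e (hf.1.inj t ht w hw e')

theorem root_notMem_miss (C : Critical T G d v c π h a b) {f : W → V}
    (hf : Valid T G v c a b f) {z : V} (hz : z ∈ free G v a b f) : c ∉ miss G a b f z := by
  intro e
  rw [mem_miss, hf.2] at e
  exact e.2 (mem_free.1 hz).1.symm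

theorem exists_child_mem_miss (C : Critical T G d v c π h a b) {f : W → V}
    (hf : Valid T G v c a b f) {z z' : V} (hz : z ∈ free G v a b f) (hz' : z' ∈ free G v a b f)
    (hne : z ≠ z') : ∃ p ∈ miss G a b f z, p ≠ c ∧ π p = c := by
  by_contra! hcon
  have hz1 := mem_free.1 hz
  have hz2 := mem_free.1 hz'
  have h1 := hf.1.swap C.c_mem (z := z) (fun t ht _ => hz1.2 t ht) (by
    intro t ht hct
    by_contra hn
    have htm := mem_miss.2 ⟨ht, hn⟩
    rcases (C.adj_iff _ _).1 hct with ⟨hne', e | e⟩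
    · exact hne' (C.root.symm.trans e)
    · exact hcon t htm hne'.symm e)
  refine C.extend h1 (x := v) (y := z') ?_ ?_ ?_ hz2.1
  · intro t ht
    by_cases e : t = c
    · rw [e, Function.update_self]; exact hz1.1.ne'
    · rw [Function.update_of_ne e]
      exact fun e' => e (hf.1.inj t ht c C.c_mem (e'.trans hf.2.symm))
  · intro t ht
    by_cases e : t = c
    · rw [e, Function.update_self]; exact hne
    · rw [Function.update_of_ne e]; exact hz2.2 t ht
  · rw [Function.update_self]; exact hz1.1.symm

theorem mem_miss_or_exists (C : Critical T G d v c π h a b) {f : W → V}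
    (hf : Valid T G v c a b f) {z z' : V} (hz : z ∈ free G v a b f) (hz' : z' ∈ free G v a b f)
    (hne : z ≠ z') {w : W} (hw : w ∈ rest a b) (hwc : w ≠ c) :
    w ∈ miss G a b f z' ∨ ∃ m ∈ miss G a b f z, T.Adj w m := by
  by_contra! hcon
  have hz1 := mem_free.1 hz
  have hz2 := mem_free.1 hz'
  have h1 := C.valid_swap hf hz hw hwc hcon.2
  refine C.extend h1.1 (x := z') (y := f w) (mem_free.1 (C.mem_free_swap hf hz' hne)).2 ?_ ?_ ?_
  · intro t ht
    by_cases e : t = w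
    · rw [e, Function.update_self]; exact (hz1.2 w hw).symm
    · rw [Function.update_of_ne e]
      exact fun e' => e (hf.1.inj t ht w hw e')
  · rw [h1.2]; exact hz2.1
  · by_contra hn
    exact hcon.1 (mem_miss.2 ⟨hw, hn⟩)

theorem card_miss (C : Critical T G d v c π h a b) {f : W → V}
    (hf : Valid T G v c a b f) {z : V} (hz : z ∈ free G v a b f) :
    (miss G a b f z).card + (nb G z).card = d + 2 := by
  have h1 : nb G z = ((rest a b).filter (fun t => G.Adj z (f t))).image f := by
    ext x
    rw [mem_nb, Finset.mem_image]
    constructor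
    · intro hzx
      obtain ⟨t, ht, rfl⟩ := C.exists_of_free_adj hf hz hzx
      exact ⟨t, Finset.mem_filter.2 ⟨ht, hzx⟩, rfl⟩
    · rintro ⟨t, ht, rfl⟩
      exact (Finset.mem_filter.1 ht).2
  rw [h1, Finset.card_image_of_injOn, ← C.card_rest, add_comm]
  · exact Finset.card_filter_add_card_filter_not _
  · intro s hs t ht
    rw [Finset.mem_coe, Finset.mem_filter] at hs ht
    exact hf.1.inj s hs.1 t ht.1

theorem exists_two_free (C : Critical T G d v c π h a b) {f : W → V}
    (hf : Valid T G v c a b f) : ∃ z ∈ free G v a b f, ∃ z' ∈ free G v a b f, z ≠ z' := by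
  rw [← Finset.one_lt_card]
  have h1 := card_succ_le_card_sdiff_add (G := G) (Finset.mem_image_of_mem f C.c_mem)
  rw [hf.2] at h1
  have h2 : ((rest a b).image f).card ≤ _ := Finset.card_image_le
  have h3 := C.card_rest
  have h4 := C.le_deg_v
  rw [free]
  omega

theorem card_rest_le_three (C : Critical T G d v c π h a b) {p : W}
    (hall : ∀ w ∈ rest a b, w = c ∨ w = p ∨ π w = p) (hp : p ≠ c) : (rest a b).card ≤ 3 := by
  have h1 : (((rest a b).erase c).erase p).card ≤ 1 := by
    rw [Finset.card_le_one]
    have hch : ∀ t ∈ ((rest a b).erase c).erase p, t ≠ c ∧ π t = p ∧ ∀ u, π u ≠ t := by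
      intro t ht
      rw [Finset.mem_erase, Finset.mem_erase] at ht
      have hpt : π t = p := by
        rcases hall t ht.2.2 with e | e | e
        · exact absurd e ht.2.1
        · exact absurd e ht.1
        · exact e
      refine ⟨ht.2.1, hpt, fun u hu => ?_⟩
      have htr := mem_rest.1 ht.2.2
      have huc : u ≠ c := by
        rintro rfl
        exact ht.2.1 (hu.symm.trans C.root)
      by_cases hur : u ∈ rest a b
      · rcases hall u hur with e | e | e
        · exact huc e
        · have e1 := C.height t ht.2.1
          have e2 := C.height u huc
          rw [hu, e] at e2
          rw [hpt] at e1
          omega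
        · exact ht.1 (hu.symm.trans e)
      · rw [mem_rest, not_and_or, not_not, not_not] at hur
        rcases hur with rfl | rfl
        · exact htr.2 (hu.symm.trans C.parent_a)
        · exact ht.2.1 (hu.symm.trans C.parent_b)
    intro t ht t' ht'
    have e1 := hch t ht
    have e2 := hch t' ht'
    exact C.leaf_unique t t' e1.1 e2.1 (e1.2.1.trans e2.2.1.symm) e1.2.2 e2.2.2
  have h2 := Finset.pred_card_le_card_erase (a := p) (s := (rest a b).erase c)
  have h3 := Finset.pred_card_le_card_erase (a := c) (s := rest a b)
  omega

end Critical

/-- The sets `M` and `M'` are disjoint edges `p q`, `p' q'` of the tree with `p`, `p'` children of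
the root `c`, and cover all of `S` except `c`. -/
def Split (c : W) (π : W → W) (S M M' : Finset W) : Prop :=
  ∃ p q p' q', M = {p, q} ∧ M' = {p', q'} ∧ p ≠ c ∧ p' ≠ c ∧ q ≠ c ∧ q' ≠ c ∧ π p = c ∧ π q = p ∧
    π p' = c ∧ π q' = p' ∧ p ≠ p' ∧ ∀ t ∈ S, t = c ∨ t ∈ M ∨ t ∈ M'

omit [Fintype W] in
theorem Split.symm {c : W} {π : W → W} {S M M' : Finset W} (h : Split c π S M M') :
    Split c π S M' M := by
  obtain ⟨p, q, p', q', h1, h2, h3, h4, h5, h6, h7, h8, h9, h10, h11, h12⟩ := h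
  exact ⟨p', q', p, q, h2, h1, h4, h3, h6, h5, h9, h10, h7, h8, h11.symm, fun t ht => by
    have := h12 t ht
    tauto⟩

omit [Fintype W] in
theorem eq_or_eq_of_card_le_two {M : Finset W} {p q : W} (hM : M.card ≤ 2) (hp : p ∈ M)
    (hq : q ∈ M) (hne : p ≠ q) : M = {p, q} := by
  symm
  apply Finset.eq_of_subset_of_card_le
  · intro x hx
    rw [Finset.mem_insert, Finset.mem_singleton] at hx
    rcases hx with rfl | rfl <;> assumption
  · rw [Finset.card_pair hne]; exact hM

theorem Critical.eq_or_split {d : ℕ} {v : V} {c : W} {π : W → W} {h : W → ℕ} {a b : W}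
    (C : Critical T G d v c π h a b) (hd : 2 ≤ d) {M M' : Finset W}
    (hM2 : M.card ≤ 2) (hM2' : M'.card ≤ 2)
    (hc : c ∉ M) (hc' : c ∉ M') (hS : M ⊆ rest a b) (hS' : M' ⊆ rest a b)
    (hp : ∃ p ∈ M, p ≠ c ∧ π p = c) (hp' : ∃ p ∈ M', p ≠ c ∧ π p = c)
    (h1 : ∀ w ∈ rest a b, w ≠ c → w ∈ M' ∨ ∃ m ∈ M, T.Adj w m)
    (h2 : ∀ w ∈ rest a b, w ≠ c → w ∈ M ∨ ∃ m ∈ M', T.Adj w m) :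
    M = M' ∨ Split c π (rest a b) M M' := by
  have hcommon : ∀ p, p ∈ M → p ∈ M' → p ≠ c → π p = c → M = M' := by
    intro p hpM hpM' hpc hpp
    by_contra hne
    have hadjp : ∀ w, w ≠ c → T.Adj w p → π w = p := by
      intro w hwc hw
      rcases ((C.adj_iff _ _).1 hw).2 with e | e
      · exact e
      · exact absurd (e.symm.trans hpp) hwc
    have hpart : ∀ w ∈ rest a b, w = c ∨ w = p ∨ π w = p := by
      intro w hw
      by_contra! hD
      have hDp : ¬ T.Adj w p := fun e => hD.2.2 (hadjp w hD.1 e)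
      have hcase : ∀ m m', m ∈ M → m' ∈ M' → m ≠ p → m' ≠ p → T.Adj w m → T.Adj w m' →
          False := by
        intro m m' hm hm' hmp hmp' hwm hwm'
        have hMe := eq_or_eq_of_card_le_two hM2 hpM hm hmp.symm
        have hMe' := eq_or_eq_of_card_le_two hM2' hpM' hm' hmp'.symm
        have hmm : m ≠ m' := by
          rintro rfl
          exact hne (hMe.trans hMe'.symm)
        have hmc : m ≠ c := fun e => hc (e ▸ hm)
        have hmc' : m' ≠ c := fun e => hc' (e ▸ hm')
        have hpm : π m = p := by
          rcases h1 m (hS hm) hmc with e | ⟨x, hx, hmx⟩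
          · rw [hMe', Finset.mem_insert, Finset.mem_singleton] at e
            exact absurd e (by tauto)
          · rw [hMe, Finset.mem_insert, Finset.mem_singleton] at hx
            rcases hx with rfl | rfl
            · exact hadjp m hmc hmx
            · exact absurd hmx T.irrefl
        have hpm' : π m' = p := by
          rcases h2 m' (hS' hm') hmc' with e | ⟨x, hx, hmx⟩
          · rw [hMe, Finset.mem_insert, Finset.mem_singleton] at e
            exact absurd e.symm (by tauto)
          · rw [hMe', Finset.mem_insert, Finset.mem_singleton] at hx
            rcases hx with rfl | rfl
            · exact hadjp m' hmc' hmx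
            · exact absurd hmx T.irrefl
        have e1 : π w = m := by
          rcases ((C.adj_iff _ _).1 hwm).2 with e | e
          · exact e
          · exact absurd (e.symm.trans hpm) hD.2.1
        have e2 : π w = m' := by
          rcases ((C.adj_iff _ _).1 hwm').2 with e | e
          · exact e
          · exact absurd (e.symm.trans hpm') hD.2.1
        exact hmm (e1.symm.trans e2)
      have hpw : p ≠ w := fun e => hD.2.1 e.symm
      rcases h1 w hw hD.1 with e1 | ⟨m, hm, hwm⟩ <;> rcases h2 w hw hD.1 with e2 | ⟨m', hm', hwm'⟩
      · exact hne ((eq_or_eq_of_card_le_two hM2 hpM e2 hpw).trans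
          (eq_or_eq_of_card_le_two hM2' hpM' e1 hpw).symm)
      · rw [eq_or_eq_of_card_le_two hM2' hpM' e1 hpw, Finset.mem_insert,
          Finset.mem_singleton] at hm'
        rcases hm' with rfl | rfl
        · exact hDp hwm'
        · exact T.irrefl hwm'
      · rw [eq_or_eq_of_card_le_two hM2 hpM e2 hpw, Finset.mem_insert,
          Finset.mem_singleton] at hm
        rcases hm with rfl | rfl
        · exact hDp hwm
        · exact T.irrefl hwm
      · refine hcase m m' hm hm' ?_ ?_ hwm hwm'
        · rintro rfl; exact hDp hwm
        · rintro rfl; exact hDp hwm'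
    have := C.card_rest_le_three hpart hpc
    have := C.card_rest
    omega
  obtain ⟨p, hpM, hpc, hpp⟩ := hp
  obtain ⟨p', hpM', hpc', hpp'⟩ := hp'
  by_cases e1 : p ∈ M'
  · exact Or.inl (hcommon p hpM e1 hpc hpp)
  by_cases e2 : p' ∈ M
  · exact Or.inl (hcommon p' e2 hpM' hpc' hpp')
  right
  have hstep : ∀ p (N : Finset W), c ∉ N → p ≠ c → π p = c → (∃ m ∈ N, T.Adj p m) →
      ∃ q ∈ N, q ≠ c ∧ π q = p ∧ q ≠ p := by
    rintro p N hcN hpc hpp ⟨m, hm, hpm⟩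
    have hmc : m ≠ c := fun e => hcN (e ▸ hm)
    refine ⟨m, hm, hmc, ?_, hpm.ne'⟩
    rcases ((C.adj_iff _ _).1 hpm).2 with e | e
    · exact absurd (e.symm.trans hpp) hmc
    · exact e
  obtain ⟨q, hq, hqc, hqp, hqne⟩ := hstep p M hc hpc hpp ((h1 p (hS hpM) hpc).resolve_left e1)
  obtain ⟨q', hq', hqc', hqp', hqne'⟩ := hstep p' M' hc' hpc' hpp'
    ((h2 p' (hS' hpM') hpc').resolve_left e2)
  have hMe := eq_or_eq_of_card_le_two hM2 hpM hq hqne.symm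
  have hMe' := eq_or_eq_of_card_le_two hM2' hpM' hq' hqne'.symm
  have hpne : p ≠ p' := fun e => e1 (e ▸ hpM')
  refine ⟨p, q, p', q', hMe, hMe', hpc, hpc', hqc, hqc', hpp, hqp, hpp', hqp', hpne, ?_⟩
  intro t ht
  by_contra! hcon
  obtain ⟨htc, ht1, ht2⟩ := hcon
  obtain ⟨m, hm, htm⟩ := (h1 t ht htc).resolve_left ht2
  obtain ⟨m', hm', htm'⟩ := (h2 t ht htc).resolve_left ht1
  have key : ∀ p q m, p ≠ c → π p = c → π q = p → t ≠ p → (m = p ∨ m = q) → T.Adj t m →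
      π t = m := by
    intro p q m hpc hpp hqp htp hm htm
    rcases ((C.adj_iff _ _).1 htm).2 with e | e
    · exact e
    · rcases hm with rfl | rfl
      · exact absurd (e.symm.trans hpp) htc
      · exact absurd (e.symm.trans hqp) htp
  rw [hMe, Finset.mem_insert, Finset.mem_singleton] at hm ht1
  rw [hMe', Finset.mem_insert, Finset.mem_singleton] at hm' ht2
  have k1 := key p q m hpc hpp hqp (fun e => ht1 (Or.inl e)) hm htm
  have k2 := key p' q' m' hpc' hpp' hqp' (fun e => ht2 (Or.inl e)) hm' htm'
  have k3 := k1.symm.trans k2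
  rcases hm with rfl | rfl <;> rcases hm' with rfl | rfl
  · exact hpne k3
  · rw [k3, hqp'] at hpp; exact hpc' hpp
  · rw [← k3, hqp] at hpp'; exact hpc hpp'
  · rw [k3, hqp'] at hqp; exact hpne hqp.symm

end ErdosSos

namespace ErdosSos

open scoped Classical

variable {V W : Type*}

theorem Split.card_eq_two {c : W} {π : W → W} {S M M' : Finset W} (h : Split c π S M M') :
    M.card = 2 := by
  obtain ⟨p, q, p', q', h1, h2, h3, h4, h5, h6, h7, h8, h9, h10, h11, h12⟩ := h
  rw [h1, Finset.card_pair]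
  rintro rfl
  exact h3 (h8.symm.trans h7)

theorem Split.disjoint {c : W} {π : W → W} {S M M' : Finset W} (h : Split c π S M M') :
    ∀ t ∈ M, t ∉ M' := by
  obtain ⟨p, q, p', q', h1, h2, h3, h4, h5, h6, h7, h8, h9, h10, h11, h12⟩ := h
  intro t ht ht'
  rw [h1, Finset.mem_insert, Finset.mem_singleton] at ht
  rw [h2, Finset.mem_insert, Finset.mem_singleton] at ht'
  grind

variable {T : SimpleGraph W} {G : SimpleGraph V} [Fintype V] [Fintype W]

namespace Critical

variable {d : ℕ} {v : V} {c : W} {π : W → W} {h : W → ℕ} {a b : W}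

theorem not_adj_of_split (C : Critical T G d v c π h a b) {S M M' : Finset W}
    (hs : Split c π S M M') : ∀ t ∈ M, ∀ m ∈ M', ¬ T.Adj t m := by
  obtain ⟨p, q, p', q', h1, h2, h3, h4, h5, h6, h7, h8, h9, h10, h11, h12⟩ := hs
  intro t ht t' ht' hadj
  rw [h1, Finset.mem_insert, Finset.mem_singleton] at ht
  rw [h2, Finset.mem_insert, Finset.mem_singleton] at ht'
  have := ((C.adj_iff _ _).1 hadj).2
  grind

theorem eq_or_split_miss (C : Critical T G d v c π h a b) (hd : 2 ≤ d) {f : W → V}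
    (hf : Valid T G v c a b f) {z z' : V} (hz : z ∈ free G v a b f) (hz' : z' ∈ free G v a b f)
    (hne : z ≠ z') : miss G a b f z = miss G a b f z' ∨
      Split c π (rest a b) (miss G a b f z) (miss G a b f z') := by
  have h1 := C.card_miss hf hz
  have h2 := C.card_miss hf hz'
  have h3 := C.le_deg z
  have h4 := C.le_deg z'
  exact C.eq_or_split hd (by omega) (by omega) (C.root_notMem_miss hf hz)
    (C.root_notMem_miss hf hz') (Finset.filter_subset _ _) (Finset.filter_subset _ _)
    (C.exists_child_mem_miss hf hz hz' hne) (C.exists_child_mem_miss hf hz' hz hne.symm)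
    (fun w hw hwc => C.mem_miss_or_exists hf hz hz' hne hw hwc)
    (fun w hw hwc => C.mem_miss_or_exists hf hz' hz hne.symm hw hwc)

theorem not_split_of_miss_eq (C : Critical T G d v c π h a b) {f : W → V}
    (hf : Valid T G v c a b f) {z z' : V} (hz : z ∈ free G v a b f) (hz' : z' ∈ free G v a b f)
    (hne : z ≠ z') (heq : miss G a b f z = miss G a b f z') {M' : Finset W} (hM' : M' ⊆ rest a b)
    (hs : Split c π (rest a b) (miss G a b f z) M') : False := by
  have hs' := hs
  obtain ⟨p, q, p', q', h1, h2, h3, h4, h5, h6, h7, h8, h9, h10, h11, h12⟩ := hs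
  have hp' : p' ∈ M' := by rw [h2]; simp
  rcases C.mem_miss_or_exists hf hz hz' hne (hM' hp') h4 with e | ⟨m, hm, e⟩
  · exact hs'.symm.disjoint p' hp' (heq ▸ e)
  · exact C.not_adj_of_split hs' m hm p' hp' e.symm

theorem good_of_split (C : Critical T G d v c π h a b) {f : W → V}
    (hf : Valid T G v c a b f) {z : V} (hz : z ∈ free G v a b f)
    (hv : ∀ t ∈ rest a b, t ≠ c → G.Adj v (f t)) {M : Finset W}
    (hs : Split c π (rest a b) (miss G a b f z) M) :
    (nb G z).card ≤ d ∧ ∀ y, G.Adj z y → y = v ∨ G.Adj v y := by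
  have h1 := C.card_miss hf hz
  rw [hs.card_eq_two] at h1
  refine ⟨by omega, fun y hzy => ?_⟩
  obtain ⟨t, ht, rfl⟩ := C.exists_of_free_adj hf hz hzy
  by_cases e : t = c
  · left; rw [e]; exact hf.2
  · exact Or.inr (hv t ht e)

theorem good_image_of_split (C : Critical T G d v c π h a b) (hd : 2 ≤ d) {f : W → V}
    (hf : Valid T G v c a b f) {z z' : V} (hz : z ∈ free G v a b f) (hz' : z' ∈ free G v a b f)
    (hne : z ≠ z') (hv : ∀ t ∈ rest a b, t ≠ c → G.Adj v (f t))
    (hs : Split c π (rest a b) (miss G a b f z) (miss G a b f z')) {t : W}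
    (ht : t ∈ miss G a b f z) :
    (nb G (f t)).card ≤ d ∧ ∀ y, G.Adj (f t) y → y = v ∨ G.Adj v y := by
  have htr := (mem_miss.1 ht).1
  have htc : t ≠ c := by
    rintro rfl
    exact C.root_notMem_miss hf hz ht
  have hf' := C.valid_swap hf hz' htr htc (C.not_adj_of_split hs t ht)
  have hx := C.image_mem_free_swap hf hz' htr (hv t htr htc)
  have hz1 := C.mem_free_swap hf hz hne.symm (w := t)
  have hmiss : miss G a b (Function.update f t z') z = miss G a b f z := by
    ext s
    by_cases e : s = t
    · subst e
      refine ⟨fun _ => ht, fun _ => mem_miss.2 ⟨htr, ?_⟩⟩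
      rw [Function.update_self]
      exact C.not_adj_free hf hz hz'
    · rw [mem_miss, mem_miss, Function.update_of_ne e]
  have hxz : z ≠ f t := ((mem_free.1 hz).2 t htr).symm
  have hsub : miss G a b f z' ⊆ rest a b := Finset.filter_subset _ _
  rcases C.eq_or_split_miss hd hf' hz1 hx hxz with e | e
  · exact (C.not_split_of_miss_eq hf' hz1 hx hxz e hsub (by rw [hmiss]; exact hs)).elim
  · refine C.good_of_split hf' hx (fun s hs hsc => ?_) e.symm
    by_cases es : s = t
    · rw [es, Function.update_self]; exact (mem_free.1 hz').1
    · rw [Function.update_of_ne es]; exact hv s hs hsc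

theorem le_card_free_add (C : Critical T G d v c π h a b) {f : W → V}
    (hf : Valid T G v c a b f) : d + 3 ≤ (free G v a b f).card +
      (((rest a b).erase c).filter (fun t => G.Adj v (f t))).card := by
  have h1 := Finset.card_inter_add_card_sdiff (nb G v) ((rest a b).image f)
  have h2 : nb G v ∩ (rest a b).image f ⊆
      (((rest a b).erase c).filter (fun t => G.Adj v (f t))).image f := by
    intro y hy
    rw [Finset.mem_inter, mem_nb, Finset.mem_image] at hy
    obtain ⟨hy, t, ht, rfl⟩ := hy
    refine Finset.mem_image_of_mem f (Finset.mem_filter.2 ⟨Finset.mem_erase.2 ⟨?_, ht⟩, hy⟩)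
    rintro rfl
    rw [hf.2] at hy
    exact G.irrefl hy
  have h3 := (Finset.card_le_card h2).trans Finset.card_image_le
  have h4 := C.le_deg_v
  rw [free]
  omega

theorem miss_eq (C : Critical T G d v c π h a b) (hd : 2 ≤ d) {f : W → V}
    (hf : Valid T G v c a b f) {z z' : V} (hz : z ∈ free G v a b f) (hz' : z' ∈ free G v a b f) :
    miss G a b f z = miss G a b f z' := by
  by_cases hne : z = z'
  · rw [hne]
  rcases C.eq_or_split_miss hd hf hz hz' hne with e | hs
  · exact e
  exfalso
  have hsub : ∀ z, miss G a b f z ⊆ rest a b := fun z => Finset.filter_subset _ _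
  have hd3 : d = 3 := by
    have h1 : rest a b ⊆ {c} ∪ miss G a b f z ∪ miss G a b f z' := by
      obtain ⟨p, q, p', q', h1, h2, h3, h4, h5, h6, h7, h8, h9, h10, h11, h12⟩ := hs
      intro t ht
      have := h12 t ht
      simp only [Finset.mem_union, Finset.mem_singleton]
      tauto
    have h2 := Finset.card_le_card h1
    have h3 := Finset.card_union_le ({c} ∪ miss G a b f z) (miss G a b f z')
    have h4 := Finset.card_union_le {c} (miss G a b f z)
    rw [hs.card_eq_two, Finset.card_singleton] at h4
    rw [hs.symm.card_eq_two] at h3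
    rw [C.card_rest] at h2
    have h5 := C.card_miss hf hz
    rw [hs.card_eq_two] at h5
    by_contra hd3
    have := C.lt_deg (by omega) z
    omega
  have hfree : free G v a b f ⊆ {z, z'} := by
    intro x hx
    rw [Finset.mem_insert, Finset.mem_singleton]
    by_contra! hcon
    rcases C.eq_or_split_miss hd hf hz hx hcon.1.symm with e | e
    · exact C.not_split_of_miss_eq hf hz hx hcon.1.symm e (hsub z') hs
    · have h1 : miss G a b f z' ⊆ miss G a b f x := by
        intro t ht
        have h2 := hs.symm.disjoint t ht
        obtain ⟨p, q, p', q', -, -, -, -, -, -, -, -, -, -, -, h12⟩ := e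
        rcases h12 t (hsub _ ht) with e | e | e
        · rw [e] at ht; exact absurd ht (C.root_notMem_miss hf hz')
        · exact absurd e h2
        · exact e
      have h2 := Finset.eq_of_subset_of_card_le h1
        (by rw [e.symm.card_eq_two, hs.symm.card_eq_two])
      exact C.not_split_of_miss_eq hf hz' hx hcon.2.symm h2 (hsub z) hs.symm
  have hv : ∀ t ∈ rest a b, t ≠ c → G.Adj v (f t) := by
    have h1 := C.le_card_free_add hf
    have h2 := (Finset.card_le_card hfree).trans Finset.card_le_two
    have h3 := C.card_rest
    have h4 := Finset.card_erase_of_mem C.c_mem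
    have h5 := Finset.eq_of_subset_of_card_le
      (Finset.filter_subset (fun t => G.Adj v (f t)) ((rest a b).erase c)) (by omega)
    intro t ht htc
    have h6 : t ∈ (rest a b).erase c := Finset.mem_erase.2 ⟨htc, ht⟩
    rw [← h5] at h6
    exact (Finset.mem_filter.1 h6).2
  refine C.not_bad fun x hx => ?_
  by_cases hxf : x ∈ free G v a b f
  · have := hfree hxf
    rw [Finset.mem_insert, Finset.mem_singleton] at this
    rcases this with rfl | rfl
    · exact C.good_of_split hf hz hv hs
    · exact C.good_of_split hf hz' hv hs.symm
  · rw [mem_free] at hxf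
    push Not at hxf
    obtain ⟨t, ht, rfl⟩ := hxf hx
    have htc : t ≠ c := by
      rintro rfl
      rw [hf.2] at hx
      exact G.irrefl hx
    have h12 := hs
    obtain ⟨p, q, p', q', -, -, -, -, -, -, -, -, -, -, -, h12⟩ := h12
    rcases h12 t ht with e | e | e
    · exact absurd e htc
    · exact C.good_image_of_split hd hf hz hz' hne hv hs e
    · exact C.good_image_of_split hd hf hz' hz (Ne.symm hne) hv hs.symm e

theorem exists_miss_eq_pair (C : Critical T G d v c π h a b) (hd : 2 ≤ d) {f : W → V}
    (hf : Valid T G v c a b f) : ∃ p ∈ rest a b, ∃ m ∈ rest a b, p ≠ c ∧ m ≠ c ∧ m ≠ p ∧ π p = c ∧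
      (∀ z ∈ free G v a b f, miss G a b f z = {p, m}) ∧
      ∀ t ∈ rest a b, t = c ∨ t = p ∨ t = m ∨ π t = p ∨ π t = m ∨ t = π m := by
  obtain ⟨z, hz, z', hz', hne⟩ := C.exists_two_free hf
  obtain ⟨p, hp, hpc, hpp⟩ := C.exists_child_mem_miss hf hz hz' hne
  have hstep : ∀ w ∈ rest a b, w ≠ c → w ∈ miss G a b f z ∨ ∃ m ∈ miss G a b f z, T.Adj w m := by
    intro w hw hwc
    have := C.mem_miss_or_exists hf hz hz' hne hw hwc
    rwa [← C.miss_eq hd hf hz hz'] at this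
  by_cases hex : ∃ m ∈ miss G a b f z, m ≠ p
  · obtain ⟨m, hm, hmp⟩ := hex
    have hcard := C.card_miss hf hz
    have hdz := C.le_deg z
    have heq := eq_or_eq_of_card_le_two (by omega) hp hm hmp.symm
    refine ⟨p, (mem_miss.1 hp).1, m, (mem_miss.1 hm).1, hpc, ?_, hmp, hpp, ?_, ?_⟩
    · rintro rfl
      exact C.root_notMem_miss hf hz hm
    · intro x hx
      rw [← heq]
      exact C.miss_eq hd hf hx hz
    · intro t ht
      by_cases htc : t = c
      · exact Or.inl htc
      have := hstep t ht htc
      rw [heq] at this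
      simp only [Finset.mem_insert, Finset.mem_singleton, exists_eq_or_imp, exists_eq_left,
        C.adj_iff] at this
      grind
  · exfalso
    push Not at hex
    have h1 : (rest a b).card ≤ 3 := by
      refine C.card_rest_le_three (p := p) (fun w hw => ?_) hpc
      by_cases hwc : w = c
      · exact Or.inl hwc
      rcases hstep w hw hwc with e | ⟨m, hm, e⟩
      · exact Or.inr (Or.inl (hex w e))
      · rw [hex m hm] at e
        rcases ((C.adj_iff _ _).1 e).2 with e | e
        · exact Or.inr (Or.inr e)
        · exact absurd (e.symm.trans hpp) hwc
    rw [C.card_rest] at h1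
    omega

end Critical

end ErdosSos

namespace ErdosSos

open scoped Classical

variable {V W : Type*}

theorem IsParent.exists_emb_of_list {T : SimpleGraph W} {G : SimpleGraph V} [Fintype W] {c : W}
    {π : W → W} {h : W → ℕ} (H : IsParent T c π h) (L : List (W × V))
    (hcov : ∀ t, t ∈ L.map Prod.fst) (h1 : (L.map Prod.fst).Nodup) (h2 : (L.map Prod.snd).Nodup)
    (h3 : ∀ e ∈ L, e.1 = c ∨ ∃ e' ∈ L, π e.1 = e'.1 ∧ G.Adj e.2 e'.2) :
    ∃ f, Emb T G Finset.univ f := by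
  have hex : ∀ t, ∃ x, (t, x) ∈ L := by
    intro t
    obtain ⟨e, he, rfl⟩ := List.mem_map.1 (hcov t)
    exact ⟨e.2, he⟩
  choose g hg using hex
  have hpar : ∀ t, t ≠ c → G.Adj (g t) (g (π t)) := by
    intro t ht
    rcases h3 _ (hg t) with e | ⟨e', he', e1, e2⟩
    · exact absurd e ht
    · have := List.inj_on_of_nodup_map h1 he' (hg (π t)) e1.symm
      rw [this] at e2
      exact e2
  refine ⟨g, fun s _ t _ hst => ?_, fun s _ t _ hst => ?_⟩
  · exact congrArg Prod.fst (List.inj_on_of_nodup_map h2 (hg s) (hg t) hst)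
  · rcases (H.adj_iff _ _).1 hst with ⟨hne, e | e⟩
    · exact e ▸ hpar s (H.ne_root e hne)
    · exact e ▸ (hpar t (H.ne_root e hne.symm)).symm

variable {T : SimpleGraph W} {G : SimpleGraph V} [Fintype V] [Fintype W]

namespace Critical

variable {d : ℕ} {v : V} {c : W} {π : W → W} {h : W → ℕ} {a b : W}

theorem three_le (C : Critical T G d v c π h a b) {f : W → V} (hf : Valid T G v c a b f) {z : V}
    (hz : z ∈ free G v a b f) (h2 : (miss G a b f z).card = 2) : 3 ≤ d := by
  by_contra hcon
  have := C.card_miss hf hz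
  have := C.lt_deg (by omega) z
  omega

/-- A tree vertex all of whose possible children are excluded is the only leaf at its parent. -/
theorem eq_of_childless (C : Critical T G d v c π h a b) {p t t' : W} (hp : p ≠ c)
    (ht : t ∈ rest a b) (ht' : t' ∈ rest a b) (hpt : π t = p) (hpt' : π t' = p)
    (hc : ∀ u ∈ rest a b, π u ≠ t) (hc' : ∀ u ∈ rest a b, π u ≠ t') : t = t' := by
  have hne : ∀ t, π t = p → t ≠ c := by
    rintro t hpt rfl
    exact hp (hpt.symm.trans C.root)
  have key : ∀ t ∈ rest a b, t ≠ c → (∀ u ∈ rest a b, π u ≠ t) → ∀ u, π u ≠ t := by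
    intro t ht htc hc u
    by_cases hu : u ∈ rest a b
    · exact hc u hu
    · rw [mem_rest, not_and_or, not_not, not_not] at hu
      rcases hu with rfl | rfl
      · rw [C.parent_a]; exact (mem_rest.1 ht).2.symm
      · rw [C.parent_b]; exact htc.symm
  exact C.leaf_unique t t' (hne t hpt) (hne t' hpt') (hpt.trans hpt'.symm)
    (key t ht (hne t hpt) hc) (key t' ht' (hne t' hpt') hc')

theorem false_of_adj (C : Critical T G d v c π h a b) {f : W → V} (hf : Valid T G v c a b f)
    {p m l n : W} (hp : p ∈ rest a b) (hm : m ∈ rest a b) (hl : l ∈ rest a b) (hn : n ∈ rest a b)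
    (hpc : p ≠ c) (hmp : m ≠ p) (hpp : π p = c) (hpm : π m = p) (hpl : π l = p)
    (hpn : π n = m) (hlm : l ≠ m)
    (hcov : ∀ t ∈ rest a b, t = c ∨ t = p ∨ t = m ∨ t = l ∨ t = n)
    {z z' : V} (hne : z ≠ z') (hz : ∀ t ∈ rest a b, f t ≠ z) (hz' : ∀ t ∈ rest a b, f t ≠ z')
    (ha : ∀ t ∈ rest a b, t ≠ p → t ≠ m → G.Adj z (f t))
    (ha' : ∀ t ∈ rest a b, t ≠ p → t ≠ m → G.Adj z' (f t)) : False := by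
  have hroot := C.root
  have hpa := C.parent_a
  have hpb := C.parent_b
  have hc := C.c_mem
  have hnm := C.ne (t := m) (by grind)
  have hab := C.a_ne_b
  have hinj : ∀ s ∈ rest a b, ∀ t ∈ rest a b, s ≠ t → f s ≠ f t :=
    fun s hs t ht hst e => hst (hf.1.inj s hs t ht e)
  have hadj : ∀ t ∈ rest a b, t ≠ c → G.Adj (f t) (f (π t)) :=
    fun t ht htc => hf.1.adj t ht _ (C.parent_mem ht) (C.adj htc)
  have hr : ∀ t ∈ rest a b, t ≠ a ∧ t ≠ b := fun t ht => mem_rest.1 ht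
  have hcl : ∀ t, t = c ∨ t = p ∨ t = m ∨ t = l ∨ t = n ∨ t = a ∨ t = b := by
    intro t
    by_cases e : t ∈ rest a b
    · have := hcov t e; tauto
    · rw [mem_rest] at e; tauto
  have hnc : n ≠ c := by
    rintro rfl
    grind
  have hlp : l ≠ p := by
    rintro rfl
    grind
  have hlc : l ≠ c := by
    rintro rfl
    grind
  have hnm' : n ≠ m := by
    rintro rfl
    exact hnm hpn
  have hmc : m ≠ c := by
    rintro rfl
    grind
  have hnp : n ≠ p := by
    rintro rfl
    grind
  obtain ⟨g, hg⟩ := C.exists_emb_of_list (G := G)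
    [(p, z), (l, f c), (m, f l), (n, z'), (c, f n), (b, f m), (a, f p)]
    (by intro t; have := hcl t; simp; tauto) (by simp; grind) (by simp; grind) (by
      intro e he
      simp only [List.mem_cons, List.not_mem_nil, or_false] at he
      rcases he with rfl | rfl | rfl | rfl | rfl | rfl | rfl
      · exact Or.inr ⟨(c, f n), by simp, hpp, ha n hn hnp hnm'⟩
      · exact Or.inr ⟨(p, z), by simp, hpl, (ha c hc hpc.symm hmc.symm).symm⟩
      · exact Or.inr ⟨(p, z), by simp, hpm, (ha l hl hlp hlm).symm⟩
      · exact Or.inr ⟨(m, f l), by simp, hpn, ha' l hl hlp hlm⟩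
      · exact Or.inl rfl
      · exact Or.inr ⟨(c, f n), by simp, hpb, by simpa [hpn] using (hadj n hn hnc).symm⟩
      · exact Or.inr ⟨(b, f m), by simp, hpa, by simpa [hpm] using (hadj m hm hmc).symm⟩)
  exact C.not_emb g hg

/-- `e` is outside the image of `f` apart from `f p`, and adjacent to all of it except `f m`
and `f p`. -/
def Full (G : SimpleGraph V) (a b : W) (f : W → V) (p m : W) (e : V) : Prop :=
  ∀ t ∈ rest a b, t ≠ p → f t ≠ e ∧ (t ≠ m → G.Adj e (f t))

/-- Adjacency between images of tree vertices and vertices that are `Full`. -/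
def Link (G : SimpleGraph V) (f : W → V) (m : W) {ι : Type*} : W ⊕ ι → W ⊕ ι → Prop
  | Sum.inl s, Sum.inl t => G.Adj (f s) (f t)
  | Sum.inl s, Sum.inr _ => s ≠ m
  | Sum.inr _, Sum.inl t => t ≠ m
  | Sum.inr _, Sum.inr _ => False

theorem false_of_list (C : Critical T G d v c π h a b) {f : W → V} (hf : Valid T G v c a b f)
    {p m : W} {ι : Type*} {e : ι → V} (he : Function.Injective e)
    (hfull : ∀ i, Full G a b f p m (e i)) (L : List (W × (W ⊕ ι)))
    (hcov : ∀ t, t ∈ L.map Prod.fst) (h1 : (L.map Prod.fst).Nodup) (h2 : (L.map Prod.snd).Nodup)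
    (hmem : ∀ x ∈ L, ∀ s, x.2 = Sum.inl s → s ∈ rest a b ∧ s ≠ p)
    (h3 : ∀ x ∈ L, x.1 = c ∨ ∃ y ∈ L, π x.1 = y.1 ∧ Link G f m x.2 y.2) : False := by
  obtain ⟨g, hg⟩ := C.exists_emb_of_list (G := G) (L.map (Prod.map id (Sum.elim f e)))
    (by simpa [Function.comp_def] using hcov) (by simpa [Function.comp_def] using h1) (by
      rw [List.map_map]
      have : Prod.snd ∘ Prod.map id (Sum.elim f e) = Sum.elim f e ∘ (Prod.snd : W × (W ⊕ ι) → _) :=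
        rfl
      rw [this, ← List.map_map]
      refine List.Nodup.map_on ?_ h2
      simp only [List.mem_map]
      rintro s ⟨x, hx, rfl⟩ t ⟨y, hy, rfl⟩ hxy
      rcases hs : x.2 with s | i <;> rcases ht : y.2 with t | j <;>
        simp only [hs, ht, Sum.elim_inl, Sum.elim_inr] at hxy
      · rw [hf.1.inj s (hmem x hx s hs).1 t (hmem y hy t ht).1 hxy]
      · exact absurd hxy (hfull j s (hmem x hx s hs).1 (hmem x hx s hs).2).1
      · exact absurd hxy.symm (hfull i t (hmem y hy t ht).1 (hmem y hy t ht).2).1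
      · rw [he hxy]) (by
      intro x hx'
      obtain ⟨x, hx, rfl⟩ := List.mem_map.1 hx'
      rcases h3 x hx with e | ⟨y, hy, e, hxy⟩
      · exact Or.inl e
      · refine Or.inr ⟨_, List.mem_map_of_mem hy, e, ?_⟩
        rcases hs : x.2 with s | i <;> rcases ht : y.2 with t | j <;>
          simp only [hs, ht, Link, Prod.map_snd, Sum.elim_inl, Sum.elim_inr] at hxy ⊢
        · exact hxy
        · exact ((hfull j s (hmem x hx s hs).1 (hmem x hx s hs).2).2 hxy).symm
        · exact (hfull i t (hmem y hy t ht).1 (hmem y hy t ht).2).2 hxy)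
  exact C.not_emb g hg

end Critical

end ErdosSos

namespace ErdosSos

open scoped Classical

variable {V W : Type*} {T : SimpleGraph W} {G : SimpleGraph V} [Fintype V] [Fintype W]

namespace Critical

variable {d : ℕ} {v : V} {c : W} {π : W → W} {h : W → ℕ} {a b : W}

theorem exists_full (C : Critical T G d v c π h a b) (hd : 2 ≤ d) {f : W → V}
    (hf : Valid T G v c a b f) {p m : W} (hp : p ∈ rest a b) (hpc : p ≠ c) (hmc : m ≠ c)
    (hpp : π p = c) (hpm : π m ≠ p) (hmiss : ∀ z ∈ free G v a b f, miss G a b f z = {p, m})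
    {k : ℕ} (hk : k ≤ (free G v a b f).card + 1) :
    ∃ e : Fin k → V, Function.Injective e ∧ ∀ i, Full G a b f p m (e i) := by
  have h0 : f p ∉ free G v a b f := fun e => (mem_free.1 e).2 p hp rfl
  have hvp : G.Adj v (f p) := by
    have := hf.1.adj p hp _ (C.parent_mem hp) (C.adj hpc)
    rw [hpp, hf.2] at this
    exact this.symm
  have hfree : ∀ z ∈ free G v a b f, Full G a b f p m z := by
    intro z hz t ht htp
    refine ⟨(mem_free.1 hz).2 t ht, fun htm => ?_⟩
    by_contra hcon
    have := mem_miss.2 ⟨ht, hcon⟩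
    rw [hmiss z hz, Finset.mem_insert, Finset.mem_singleton] at this
    tauto
  have hfull : ∀ z ∈ insert (f p) (free G v a b f), Full G a b f p m z := by
    intro z hz
    rcases Finset.mem_insert.1 hz with rfl | hz
    swap
    · exact hfree z hz
    obtain ⟨z, hz, z', hz', hne⟩ := C.exists_two_free hf
    have hv := C.valid_swap hf hz hp hpc (by
      intro t ht hadj
      rw [hmiss z hz, Finset.mem_insert, Finset.mem_singleton] at ht
      rcases ht with rfl | rfl
      · exact hadj.ne rfl
      · rcases ((C.adj_iff _ _).1 hadj).2 with e | e
        · exact hmc (e.symm.trans hpp)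
        · exact hpm e)
    have heq := C.miss_eq hd hv (C.image_mem_free_swap hf hz hp hvp) (C.mem_free_swap hf hz' hne)
    intro t ht htp
    refine ⟨fun e => htp (hf.1.inj t ht p hp e), fun htm => ?_⟩
    by_contra hcon
    have h1 : t ∈ miss G a b (Function.update f p z) (f p) :=
      mem_miss.2 ⟨ht, by rwa [Function.update_of_ne htp]⟩
    rw [heq, mem_miss, Function.update_of_ne htp] at h1
    exact h1.2 ((hfree z' hz' t ht htp).2 htm)
  rw [← Finset.card_insert_of_notMem h0] at hk
  refine ⟨fun i => ((insert (f p) (free G v a b f)).equivFin.symm (Fin.castLE hk i)).1, ?_, ?_⟩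
  · intro i j hij
    simpa using hij
  · exact fun i => hfull _ (Subtype.prop _)

theorem adj_parent (C : Critical T G d v c π h a b) {f : W → V} (hf : Valid T G v c a b f) (t : W)
    (hta : t ≠ a) (htb : t ≠ b) (htc : t ≠ c) : G.Adj (f t) (f (π t)) :=
  have ht := mem_rest.2 ⟨hta, htb⟩
  hf.1.adj t ht _ (C.parent_mem ht) (C.adj htc)

theorem eq_or_eq_or_mem_rest (_C : Critical T G d v c π h a b) (t : W) :
    t = a ∨ t = b ∨ t ∈ rest a b := by
  rw [mem_rest]
  tauto

theorem false_of_root (C : Critical T G d v c π h a b) {f : W → V}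
    (hf : Valid T G v c a b f) {p m l n : W} (hnd : [c, p, m, l, n, a, b].Nodup)
    (hcov : ∀ t ∈ rest a b, t = c ∨ t = p ∨ t = m ∨ t = l ∨ t = n)
    (hp : π p = c) (hm : π m = c) (hl : π l = p) (hn : π n = m)
    {e : Fin 3 → V} (he : Function.Injective e) (hfull : ∀ i, Full G a b f p m (e i)) : False := by
  have hroot := C.root
  have hpa := C.parent_a
  have hpb := C.parent_b
  have hadj := C.adj_parent hf
  have hnd' := List.nodup_reverse.2 hnd
  simp only [List.reverse_cons, List.reverse_nil, List.nil_append, List.cons_append,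
    List.nodup_cons, List.mem_cons, List.not_mem_nil, or_false, not_or, not_false_eq_true,
    List.nodup_nil, and_true] at hnd hnd'
  refine C.false_of_list hf he hfull
    [(b, .inl c), (a, .inl m), (p, .inl l), (m, .inl n), (c, .inr 0), (l, .inr 1),
      (n, .inr 2)] ?_ ?_ ?_ ?_ ?_
  · intro t
    have := C.eq_or_eq_or_mem_rest t
    have := hcov t
    simp only [List.map_cons, List.map_nil, List.mem_cons, List.not_mem_nil, or_false]
    clear hnd hnd' hp hm hl hn hroot hpa hpb
    grind only
  · simp [*]
  · simp [*]
  · simp [*]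
  · have em : G.Adj (f m) (f c) := hm ▸ hadj m (by tauto) (by tauto) (by tauto)
    have em' := em.symm
    simp [Link, *]
    try tauto

theorem false_of_grandchild_right (C : Critical T G d v c π h a b) {f : W → V}
    (hf : Valid T G v c a b f) {p w m n : W} (hnd : [c, p, w, m, n, a, b].Nodup)
    (hcov : ∀ t ∈ rest a b, t = c ∨ t = p ∨ t = w ∨ t = m ∨ t = n)
    (hp : π p = c) (hm : π m = w) (hw : π w = p) (hn : π n = m)
    {e : Fin 3 → V} (he : Function.Injective e) (hfull : ∀ i, Full G a b f p m (e i)) : False := by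
  have hroot := C.root
  have hpa := C.parent_a
  have hpb := C.parent_b
  have hadj := C.adj_parent hf
  have hnd' := List.nodup_reverse.2 hnd
  simp only [List.reverse_cons, List.reverse_nil, List.nil_append, List.cons_append,
    List.nodup_cons, List.mem_cons, List.not_mem_nil, or_false, not_or, not_false_eq_true,
    List.nodup_nil, and_true] at hnd hnd'
  refine C.false_of_list hf he hfull
    [(p, .inl c), (b, .inl w), (a, .inl m), (c, .inr 0), (m, .inl n), (w, .inr 1),
      (n, .inr 2)] ?_ ?_ ?_ ?_ ?_
  · intro t
    have := C.eq_or_eq_or_mem_rest t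
    have := hcov t
    simp only [List.map_cons, List.map_nil, List.mem_cons, List.not_mem_nil, or_false]
    clear hnd hnd' hp hm hw hn hroot hpa hpb
    grind only
  · simp [*]
  · simp [*]
  · simp [*]
  · have em : G.Adj (f m) (f w) := hm ▸ hadj m (by tauto) (by tauto) (by tauto)
    have em' := em.symm
    simp [Link, *]
    try tauto

theorem false_of_grandchild_adj (C : Critical T G d v c π h a b) {f : W → V}
    (hf : Valid T G v c a b f) {p w m l n : W} (hnd : [c, p, w, m, l, n, a, b].Nodup)
    (hcov : ∀ t ∈ rest a b, t = c ∨ t = p ∨ t = w ∨ t = m ∨ t = l ∨ t = n)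
    (hp : π p = c) (hm : π m = w) (hw : π w = p) (hl : π l = p) (hn : π n = m) (hvl : G.Adj v (f l))
    {e : Fin 3 → V} (he : Function.Injective e) (hfull : ∀ i, Full G a b f p m (e i)) : False := by
  have hroot := C.root
  have hpa := C.parent_a
  have hpb := C.parent_b
  have hadj := C.adj_parent hf
  have hnd' := List.nodup_reverse.2 hnd
  simp only [List.reverse_cons, List.reverse_nil, List.nil_append, List.cons_append,
    List.nodup_cons, List.mem_cons, List.not_mem_nil, or_false, not_or, not_false_eq_true,
    List.nodup_nil, and_true] at hnd hnd'
  refine C.false_of_list hf he hfull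
    [(p, .inl c), (b, .inl w), (a, .inl m), (c, .inr 0), (m, .inl n), (w, .inr 1), (n, .inr 2),
      (l, .inl l)] ?_ ?_ ?_ ?_ ?_
  · intro t
    have := C.eq_or_eq_or_mem_rest t
    have := hcov t
    simp only [List.map_cons, List.map_nil, List.mem_cons, List.not_mem_nil, or_false]
    clear hnd hnd' hp hm hw hl hn hroot hpa hpb
    grind only
  · simp [*]
  · simp [*]
  · simp [*]
  · have em : G.Adj (f m) (f w) := hm ▸ hadj m (by tauto) (by tauto) (by tauto)
    have em' := em.symm
    have ev : G.Adj (f l) (f c) := hf.2.symm ▸ hvl.symm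
    have ev' := ev.symm
    simp [Link, *]
    try tauto

theorem false_of_grandchild_not_adj (C : Critical T G d v c π h a b) {f : W → V}
    (hf : Valid T G v c a b f) {p w m l n : W} (hnd : [c, p, w, m, l, n, a, b].Nodup)
    (hcov : ∀ t ∈ rest a b, t = c ∨ t = p ∨ t = w ∨ t = m ∨ t = l ∨ t = n)
    (hp : π p = c) (hm : π m = w) (hw : π w = p) (hl : π l = p) (hn : π n = m)
    {e : Fin 4 → V} (he : Function.Injective e) (hfull : ∀ i, Full G a b f p m (e i)) : False := by
  have hroot := C.root
  have hpa := C.parent_a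
  have hpb := C.parent_b
  have hadj := C.adj_parent hf
  have hnd' := List.nodup_reverse.2 hnd
  simp only [List.reverse_cons, List.reverse_nil, List.nil_append, List.cons_append,
    List.nodup_cons, List.mem_cons, List.not_mem_nil, or_false, not_or, not_false_eq_true,
    List.nodup_nil, and_true] at hnd hnd'
  refine C.false_of_list hf he hfull
    [(b, .inl w), (a, .inl m), (p, .inl c), (m, .inl n), (c, .inr 0), (l, .inr 1), (w, .inr 2),
      (n, .inr 3)] ?_ ?_ ?_ ?_ ?_
  · intro t
    have := C.eq_or_eq_or_mem_rest t
    have := hcov t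
    simp only [List.map_cons, List.map_nil, List.mem_cons, List.not_mem_nil, or_false]
    clear hnd hnd' hp hm hw hl hn hroot hpa hpb
    grind only
  · simp [*]
  · simp [*]
  · simp [*]
  · have em : G.Adj (f m) (f w) := hm ▸ hadj m (by tauto) (by tauto) (by tauto)
    have em' := em.symm
    simp [Link, *]
    try tauto

theorem false_of_grandchild_left (C : Critical T G d v c π h a b) {f : W → V}
    (hf : Valid T G v c a b f) {p w m l : W} (hnd : [c, p, w, m, l, a, b].Nodup)
    (hcov : ∀ t ∈ rest a b, t = c ∨ t = p ∨ t = w ∨ t = m ∨ t = l)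
    (hp : π p = c) (hm : π m = w) (hw : π w = p) (hl : π l = p)
    {e : Fin 3 → V} (he : Function.Injective e) (hfull : ∀ i, Full G a b f p m (e i)) : False := by
  have hroot := C.root
  have hpa := C.parent_a
  have hpb := C.parent_b
  have hadj := C.adj_parent hf
  have hnd' := List.nodup_reverse.2 hnd
  simp only [List.reverse_cons, List.reverse_nil, List.nil_append, List.cons_append,
    List.nodup_cons, List.mem_cons, List.not_mem_nil, or_false, not_or, not_false_eq_true,
    List.nodup_nil, and_true] at hnd hnd'
  refine C.false_of_list hf he hfull
    [(b, .inl w), (a, .inl m), (p, .inl c), (m, .inl l), (c, .inr 0), (l, .inr 1),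
      (w, .inr 2)] ?_ ?_ ?_ ?_ ?_
  · intro t
    have := C.eq_or_eq_or_mem_rest t
    have := hcov t
    simp only [List.map_cons, List.map_nil, List.mem_cons, List.not_mem_nil, or_false]
    clear hnd hnd' hp hm hw hl hroot hpa hpb
    grind only
  · simp [*]
  · simp [*]
  · simp [*]
  · have em : G.Adj (f m) (f w) := hm ▸ hadj m (by tauto) (by tauto) (by tauto)
    have em' := em.symm
    simp [Link, *]
    try tauto

theorem false_of_side_both (C : Critical T G d v c π h a b) {f : W → V}
    (hf : Valid T G v c a b f) {p u m l n : W} (hnd : [c, p, u, m, l, n, a, b].Nodup)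
    (hcov : ∀ t ∈ rest a b, t = c ∨ t = p ∨ t = u ∨ t = m ∨ t = l ∨ t = n)
    (hp : π p = c) (hm : π m = u) (hu : π u = c) (hl : π l = p) (hn : π n = m)
    {e : Fin 3 → V} (he : Function.Injective e) (hfull : ∀ i, Full G a b f p m (e i)) : False := by
  have hroot := C.root
  have hpa := C.parent_a
  have hpb := C.parent_b
  have hadj := C.adj_parent hf
  have hnd' := List.nodup_reverse.2 hnd
  simp only [List.reverse_cons, List.reverse_nil, List.nil_append, List.cons_append,
    List.nodup_cons, List.mem_cons, List.not_mem_nil, or_false, not_or, not_false_eq_true,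
    List.nodup_nil, and_true] at hnd hnd'
  refine C.false_of_list hf he hfull
    [(c, .inr 0), (u, .inl u), (m, .inl m), (n, .inl n), (p, .inl l), (l, .inr 1), (b, .inl c),
      (a, .inr 2)] ?_ ?_ ?_ ?_ ?_
  · intro t
    have := C.eq_or_eq_or_mem_rest t
    have := hcov t
    simp only [List.map_cons, List.map_nil, List.mem_cons, List.not_mem_nil, or_false]
    clear hnd hnd' hp hm hu hl hn hroot hpa hpb
    grind only
  · simp [*]
  · simp [*]
  · simp [*]
  · have em : G.Adj (f m) (f u) := hm ▸ hadj m (by tauto) (by tauto) (by tauto)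
    have em' := em.symm
    have en : G.Adj (f n) (f m) := hn ▸ hadj n (by tauto) (by tauto) (by tauto)
    have en' := en.symm
    simp [Link, *]
    try tauto

theorem false_of_side_left (C : Critical T G d v c π h a b) {f : W → V}
    (hf : Valid T G v c a b f) {p u m l : W} (hnd : [c, p, u, m, l, a, b].Nodup)
    (hcov : ∀ t ∈ rest a b, t = c ∨ t = p ∨ t = u ∨ t = m ∨ t = l)
    (hp : π p = c) (hm : π m = u) (hu : π u = c) (hl : π l = p)
    {e : Fin 3 → V} (he : Function.Injective e) (hfull : ∀ i, Full G a b f p m (e i)) : False := by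
  have hroot := C.root
  have hpa := C.parent_a
  have hpb := C.parent_b
  have hadj := C.adj_parent hf
  have hnd' := List.nodup_reverse.2 hnd
  simp only [List.reverse_cons, List.reverse_nil, List.nil_append, List.cons_append,
    List.nodup_cons, List.mem_cons, List.not_mem_nil, or_false, not_or, not_false_eq_true,
    List.nodup_nil, and_true] at hnd hnd'
  refine C.false_of_list hf he hfull
    [(c, .inr 0), (u, .inl u), (m, .inl m), (p, .inl l), (l, .inr 1), (b, .inl c),
      (a, .inr 2)] ?_ ?_ ?_ ?_ ?_
  · intro t
    have := C.eq_or_eq_or_mem_rest t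
    have := hcov t
    simp only [List.map_cons, List.map_nil, List.mem_cons, List.not_mem_nil, or_false]
    clear hnd hnd' hp hm hu hl hroot hpa hpb
    grind only
  · simp [*]
  · simp [*]
  · simp [*]
  · have em : G.Adj (f m) (f u) := hm ▸ hadj m (by tauto) (by tauto) (by tauto)
    have em' := em.symm
    simp [Link, *]
    try tauto

theorem false_of_side_right (C : Critical T G d v c π h a b) {f : W → V}
    (hf : Valid T G v c a b f) {p u m n : W} (hnd : [c, p, u, m, n, a, b].Nodup)
    (hcov : ∀ t ∈ rest a b, t = c ∨ t = p ∨ t = u ∨ t = m ∨ t = n)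
    (hp : π p = c) (hm : π m = u) (hu : π u = c) (hn : π n = m)
    {e : Fin 3 → V} (he : Function.Injective e) (hfull : ∀ i, Full G a b f p m (e i)) : False := by
  have hroot := C.root
  have hpa := C.parent_a
  have hpb := C.parent_b
  have hadj := C.adj_parent hf
  have hnd' := List.nodup_reverse.2 hnd
  simp only [List.reverse_cons, List.reverse_nil, List.nil_append, List.cons_append,
    List.nodup_cons, List.mem_cons, List.not_mem_nil, or_false, not_or, not_false_eq_true,
    List.nodup_nil, and_true] at hnd hnd'
  refine C.false_of_list hf he hfull
    [(c, .inl u), (p, .inl m), (a, .inl c), (m, .inl n), (b, .inr 0), (u, .inr 1),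
      (n, .inr 2)] ?_ ?_ ?_ ?_ ?_
  · intro t
    have := C.eq_or_eq_or_mem_rest t
    have := hcov t
    simp only [List.map_cons, List.map_nil, List.mem_cons, List.not_mem_nil, or_false]
    clear hnd hnd' hp hm hu hn hroot hpa hpb
    grind only
  · simp [*]
  · simp [*]
  · simp [*]
  · have em : G.Adj (f m) (f u) := hm ▸ hadj m (by tauto) (by tauto) (by tauto)
    have em' := em.symm
    simp [Link, *]
    try tauto

theorem false_of_deep_right (C : Critical T G d v c π h a b) {f : W → V}
    (hf : Valid T G v c a b f) {p w u m n : W} (hnd : [c, p, w, u, m, n, a, b].Nodup)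
    (hcov : ∀ t ∈ rest a b, t = c ∨ t = p ∨ t = w ∨ t = u ∨ t = m ∨ t = n)
    (hp : π p = c) (hm : π m = u) (hu : π u = w) (hw : π w = p) (hn : π n = m)
    {e : Fin 3 → V} (he : Function.Injective e) (hfull : ∀ i, Full G a b f p m (e i)) : False := by
  have hroot := C.root
  have hpa := C.parent_a
  have hpb := C.parent_b
  have hadj := C.adj_parent hf
  have hnd' := List.nodup_reverse.2 hnd
  simp only [List.reverse_cons, List.reverse_nil, List.nil_append, List.cons_append,
    List.nodup_cons, List.mem_cons, List.not_mem_nil, or_false, not_or, not_false_eq_true,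
    List.nodup_nil, and_true] at hnd hnd'
  refine C.false_of_list hf he hfull
    [(p, .inr 0), (b, .inr 1), (a, .inl w), (w, .inl u), (u, .inl m), (m, .inl n), (n, .inr 2),
      (c, .inl c)] ?_ ?_ ?_ ?_ ?_
  · intro t
    have := C.eq_or_eq_or_mem_rest t
    have := hcov t
    simp only [List.map_cons, List.map_nil, List.mem_cons, List.not_mem_nil, or_false]
    clear hnd hnd' hp hm hu hw hn hroot hpa hpb
    grind only
  · simp [*]
  · simp [*]
  · simp [*]
  · have em : G.Adj (f m) (f u) := hm ▸ hadj m (by tauto) (by tauto) (by tauto)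
    have em' := em.symm
    have en : G.Adj (f n) (f m) := hn ▸ hadj n (by tauto) (by tauto) (by tauto)
    have en' := en.symm
    simp [Link, *]
    try tauto

theorem false_of_deep_both (C : Critical T G d v c π h a b) {f : W → V}
    (hf : Valid T G v c a b f) {p w u m l n : W} (hnd : [c, p, w, u, m, l, n, a, b].Nodup)
    (hcov : ∀ t ∈ rest a b, t = c ∨ t = p ∨ t = w ∨ t = u ∨ t = m ∨ t = l ∨ t = n)
    (hp : π p = c) (hm : π m = u) (hu : π u = w) (hw : π w = p) (hl : π l = p) (hn : π n = m)
    {e : Fin 3 → V} (he : Function.Injective e) (hfull : ∀ i, Full G a b f p m (e i)) : False := by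
  have hroot := C.root
  have hpa := C.parent_a
  have hpb := C.parent_b
  have hadj := C.adj_parent hf
  have hnd' := List.nodup_reverse.2 hnd
  simp only [List.reverse_cons, List.reverse_nil, List.nil_append, List.cons_append,
    List.nodup_cons, List.mem_cons, List.not_mem_nil, or_false, not_or, not_false_eq_true,
    List.nodup_nil, and_true] at hnd hnd'
  refine C.false_of_list hf he hfull
    [(p, .inr 0), (b, .inr 1), (a, .inl w), (w, .inl u), (u, .inl m), (m, .inl n), (n, .inr 2),
      (c, .inl c), (l, .inl l)] ?_ ?_ ?_ ?_ ?_
  · intro t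
    have := C.eq_or_eq_or_mem_rest t
    have := hcov t
    simp only [List.map_cons, List.map_nil, List.mem_cons, List.not_mem_nil, or_false]
    clear hnd hnd' hp hm hu hw hl hn hroot hpa hpb
    grind only
  · simp [*]
  · simp [*]
  · simp [*]
  · have em : G.Adj (f m) (f u) := hm ▸ hadj m (by tauto) (by tauto) (by tauto)
    have em' := em.symm
    have en : G.Adj (f n) (f m) := hn ▸ hadj n (by tauto) (by tauto) (by tauto)
    have en' := en.symm
    simp [Link, *]
    try tauto

theorem false_of_deep_left (C : Critical T G d v c π h a b) {f : W → V}
    (hf : Valid T G v c a b f) {p w u m l : W} (hnd : [c, p, w, u, m, l, a, b].Nodup)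
    (hcov : ∀ t ∈ rest a b, t = c ∨ t = p ∨ t = w ∨ t = u ∨ t = m ∨ t = l)
    (hp : π p = c) (hm : π m = u) (hu : π u = w) (hw : π w = p) (hl : π l = p)
    {e : Fin 3 → V} (he : Function.Injective e) (hfull : ∀ i, Full G a b f p m (e i)) : False := by
  have hroot := C.root
  have hpa := C.parent_a
  have hpb := C.parent_b
  have hadj := C.adj_parent hf
  have hnd' := List.nodup_reverse.2 hnd
  simp only [List.reverse_cons, List.reverse_nil, List.nil_append, List.cons_append,
    List.nodup_cons, List.mem_cons, List.not_mem_nil, or_false, not_or, not_false_eq_true,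
    List.nodup_nil, and_true] at hnd hnd'
  refine C.false_of_list hf he hfull
    [(p, .inl u), (l, .inl m), (c, .inl w), (b, .inr 0), (a, .inl c), (w, .inr 1), (u, .inl l),
      (m, .inr 2)] ?_ ?_ ?_ ?_ ?_
  · intro t
    have := C.eq_or_eq_or_mem_rest t
    have := hcov t
    simp only [List.map_cons, List.map_nil, List.mem_cons, List.not_mem_nil, or_false]
    clear hnd hnd' hp hm hu hw hl hroot hpa hpb
    grind only
  · simp [*]
  · simp [*]
  · simp [*]
  · have em : G.Adj (f m) (f u) := hm ▸ hadj m (by tauto) (by tauto) (by tauto)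
    have em' := em.symm
    have eu : G.Adj (f u) (f w) := hu ▸ hadj u (by tauto) (by tauto) (by tauto)
    have eu' := eu.symm
    simp [Link, *]
    try tauto

theorem false_of_deep (C : Critical T G d v c π h a b) {f : W → V}
    (hf : Valid T G v c a b f) {p w u m : W} (hnd : [c, p, w, u, m, a, b].Nodup)
    (hcov : ∀ t ∈ rest a b, t = c ∨ t = p ∨ t = w ∨ t = u ∨ t = m)
    (hp : π p = c) (hm : π m = u) (hu : π u = w) (hw : π w = p)
    {e : Fin 3 → V} (he : Function.Injective e) (hfull : ∀ i, Full G a b f p m (e i)) : False := by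
  have hroot := C.root
  have hpa := C.parent_a
  have hpb := C.parent_b
  have hadj := C.adj_parent hf
  have hnd' := List.nodup_reverse.2 hnd
  simp only [List.reverse_cons, List.reverse_nil, List.nil_append, List.cons_append,
    List.nodup_cons, List.mem_cons, List.not_mem_nil, or_false, not_or, not_false_eq_true,
    List.nodup_nil, and_true] at hnd hnd'
  refine C.false_of_list hf he hfull
    [(a, .inr 0), (b, .inl c), (c, .inr 1), (p, .inl w), (w, .inr 2), (u, .inl u),
      (m, .inl m)] ?_ ?_ ?_ ?_ ?_
  · intro t
    have := C.eq_or_eq_or_mem_rest t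
    have := hcov t
    simp only [List.map_cons, List.map_nil, List.mem_cons, List.not_mem_nil, or_false]
    clear hnd hnd' hp hm hu hw hroot hpa hpb
    grind only
  · simp [*]
  · simp [*]
  · simp [*]
  · have em : G.Adj (f m) (f u) := hm ▸ hadj m (by tauto) (by tauto) (by tauto)
    have em' := em.symm
    simp [Link, *]
    try tauto

end Critical

end ErdosSos

namespace ErdosSos

open scoped Classical

variable {V W : Type*} {T : SimpleGraph W} {G : SimpleGraph V} [Fintype V] [Fintype W]

namespace Critical

variable {d : ℕ} {v : V} {c : W} {π : W → W} {h : W → ℕ} {a b : W}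

theorem five_le_card_rest (C : Critical T G d v c π h a b) {f : W → V}
    (hf : Valid T G v c a b f) {p m : W} (hmp : m ≠ p)
    (hmiss : ∀ z ∈ free G v a b f, miss G a b f z = {p, m}) : 5 ≤ (rest a b).card := by
  obtain ⟨z, hz, -⟩ := C.exists_two_free hf
  have h2 : (miss G a b f z).card = 2 := by rw [hmiss z hz, Finset.card_pair hmp.symm]
  have := C.three_le hf hz h2
  rw [C.card_rest]
  omega

theorem exists_of_cover (h5 : 5 ≤ (rest a b).card) (x y z w : W) :
    ∃ t ∈ rest a b, t ≠ x ∧ t ≠ y ∧ t ≠ z ∧ t ≠ w := by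
  by_contra! hcon
  have : rest a b ⊆ {x, y, z, w} := by
    intro t ht
    simp only [Finset.mem_insert, Finset.mem_singleton]
    have := hcon t ht
    tauto
  have := (Finset.card_le_card this).trans Finset.card_le_four
  omega

/-- The situation in which the images of all but two vertices `p`, `m` of `rest a b` are adjacent
to three or more common vertices, and `m` is not a child of `p`. -/
structure Far (G : SimpleGraph V) (v : V) (c : W) (π : W → W) (h : W → ℕ) (a b : W) (f : W → V)
    (p m u w : W) : Prop where
  hp : p ∈ rest a b
  hm : m ∈ rest a b
  hpp : π p = c
  hmu : π m = u
  huw : π u = w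
  hmp : m ≠ p
  hup : u ≠ p
  hhp : h p = 1
  hhm : h u + 1 = h m
  cov : ∀ t ∈ rest a b, t = c ∨ t = p ∨ t = m ∨ t = u ∨ t = w ∨
    (π t = p ∧ t ≠ m ∧ t ≠ u ∧ t ≠ w) ∨ π t = m
  left : ∀ t ∈ rest a b, ∀ t' ∈ rest a b, (π t = p ∧ t ≠ m ∧ t ≠ u ∧ t ≠ w) →
    (π t' = p ∧ t' ≠ m ∧ t' ≠ u ∧ t' ≠ w) → t = t'
  right : ∀ t ∈ rest a b, ∀ t' ∈ rest a b, π t = m → π t' = m → t = t'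
  full : ∀ k ≤ (free G v a b f).card + 1,
    ∃ e : Fin k → V, Function.Injective e ∧ ∀ i, Full G a b f p m (e i)

theorem Far.cases {f : W → V} {p m u w : W} (F : Far G v c π h a b f p m u w) :
    (∃ l ∈ rest a b, ∃ n ∈ rest a b, π l = p ∧ l ≠ m ∧ l ≠ u ∧ l ≠ w ∧ π n = m ∧
      ∀ t ∈ rest a b, t = c ∨ t = p ∨ t = m ∨ t = u ∨ t = w ∨ t = l ∨ t = n) ∨
    (∃ l ∈ rest a b, π l = p ∧ l ≠ m ∧ l ≠ u ∧ l ≠ w ∧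
      ∀ t ∈ rest a b, t = c ∨ t = p ∨ t = m ∨ t = u ∨ t = w ∨ t = l) ∨
    (∃ n ∈ rest a b, π n = m ∧
      ∀ t ∈ rest a b, t = c ∨ t = p ∨ t = m ∨ t = u ∨ t = w ∨ t = n) ∨
    (∀ t ∈ rest a b, t = c ∨ t = p ∨ t = m ∨ t = u ∨ t = w) := by
  by_cases hlx : ∃ l ∈ rest a b, π l = p ∧ l ≠ m ∧ l ≠ u ∧ l ≠ w
  · obtain ⟨l, hl, hl'⟩ := hlx
    by_cases hnx : ∃ n ∈ rest a b, π n = m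
    · obtain ⟨n, hn, hnm⟩ := hnx
      refine Or.inl ⟨l, hl, n, hn, hl'.1, hl'.2.1, hl'.2.2.1, hl'.2.2.2, hnm, fun t ht => ?_⟩
      have := F.cov t ht
      have := F.left t ht l hl
      have := F.right t ht n hn
      tauto
    · refine Or.inr (Or.inl ⟨l, hl, hl'.1, hl'.2.1, hl'.2.2.1, hl'.2.2.2, fun t ht => ?_⟩)
      have := F.cov t ht
      have := F.left t ht l hl
      have : π t ≠ m := fun e => hnx ⟨t, ht, e⟩
      tauto
  · have hl_none : ∀ t ∈ rest a b, ¬ (π t = p ∧ t ≠ m ∧ t ≠ u ∧ t ≠ w) :=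
      fun t ht e => hlx ⟨t, ht, e⟩
    by_cases hnx : ∃ n ∈ rest a b, π n = m
    · obtain ⟨n, hn, hnm⟩ := hnx
      refine Or.inr (Or.inr (Or.inl ⟨n, hn, hnm, fun t ht => ?_⟩))
      have := F.cov t ht
      have := hl_none t ht
      have := F.right t ht n hn
      tauto
    · refine Or.inr (Or.inr (Or.inr fun t ht => ?_))
      have := F.cov t ht
      have := hl_none t ht
      have : π t ≠ m := fun e => hnx ⟨t, ht, e⟩
      tauto

theorem false_of_far_root (C : Critical T G d v c π h a b) {f : W → V}
    (hf : Valid T G v c a b f) (h5 : 5 ≤ (rest a b).card) {p m : W}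
    (F : Far G v c π h a b f p m c c) : False := by
  have hpp := F.hpp
  have hmu := F.hmu
  have huw := F.huw
  have hmp := F.hmp
  have hup := F.hup
  have hhc := C.height_root
  have hhp := F.hhp
  have hhm := F.hhm
  have hab := C.a_ne_b
  obtain ⟨hca, hcb⟩ := mem_rest.1 C.c_mem
  obtain ⟨hpa, hpb⟩ := mem_rest.1 F.hp
  obtain ⟨hma, hmb⟩ := mem_rest.1 F.hm
  have hlh : ∀ l, π l = p → h l = 2 := fun l hl => by
    have := C.height l (fun e => by rw [e, C.root] at hl; rw [← hl] at hhp; omega)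
    rw [hl] at this
    omega
  have hnh : ∀ n, π n = m → h n = h m + 1 := fun n hn => by
    rw [← C.height n (fun e => by rw [e, C.root] at hn; rw [← hn] at hhm; omega), hn]
  obtain ⟨e, he, he'⟩ := F.full 3 (by
    have := Finset.one_lt_card.2 (C.exists_two_free hf)
    omega)
  rcases F.cases with ⟨l, hl, n, hn, hlp, hlm, hlu, hlw, hnm, hcov⟩ |
    ⟨l, hl, hlp, hlm, hlu, hlw, hcov⟩ | ⟨n, hn, hnm, hcov⟩ | hcov
  · have hhl := hlh l hlp
    have hhn := hnh n hnm
    obtain ⟨hla, hlb⟩ := mem_rest.1 hl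
    obtain ⟨hna, hnb⟩ := mem_rest.1 hn
    have hnd : [c, p, m, l, n, a, b].Nodup := by
      simp only [List.nodup_cons, List.mem_cons, List.not_mem_nil, or_false, not_or,
        not_false_eq_true, List.nodup_nil, and_true]
      and_intros <;> first
        | assumption | exact Ne.symm (by assumption) | (rintro rfl; omega)
        | (rintro rfl; exact hmp (hnm.symm.trans hlp))
    exact C.false_of_root hf hnd (fun t ht => by rcases hcov t ht with e | e | e | e | e | e | e <;> simp [e])
      hpp hmu hlp hnm he he'
  · have hhl := hlh l hlp
    obtain ⟨hla, hlb⟩ := mem_rest.1 hl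
    obtain ⟨t, ht, h1, h2, h3, h4⟩ := exists_of_cover h5 c p m l
    have := hcov t ht
    tauto
  · have hhn := hnh n hnm
    obtain ⟨hna, hnb⟩ := mem_rest.1 hn
    obtain ⟨t, ht, h1, h2, h3, h4⟩ := exists_of_cover h5 c p m n
    have := hcov t ht
    tauto
  · obtain ⟨t, ht, h1, h2, h3, h4⟩ := exists_of_cover h5 c p m c
    have := hcov t ht
    tauto


theorem false_of_far_side (C : Critical T G d v c π h a b) {f : W → V}
    (hf : Valid T G v c a b f) (h5 : 5 ≤ (rest a b).card) {p m u : W}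
    (F : Far G v c π h a b f p m u c) (huc : u ≠ c) : False := by
  have hpp := F.hpp
  have hmu := F.hmu
  have huw := F.huw
  have hmp := F.hmp
  have hup := F.hup
  have hhc := C.height_root
  have hhp := F.hhp
  have hhm := F.hhm
  have hab := C.a_ne_b
  obtain ⟨hca, hcb⟩ := mem_rest.1 C.c_mem
  obtain ⟨hpa, hpb⟩ := mem_rest.1 F.hp
  obtain ⟨hma, hmb⟩ := mem_rest.1 F.hm
  obtain ⟨hua, hub⟩ := mem_rest.1 (hmu ▸ C.parent_mem F.hm)
  have hhu := C.height u huc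
  rw [huw] at hhu
  have hlh : ∀ l, π l = p → h l = 2 := fun l hl => by
    have := C.height l (fun e => by rw [e, C.root] at hl; rw [← hl] at hhp; omega)
    rw [hl] at this
    omega
  have hnh : ∀ n, π n = m → h n = h m + 1 := fun n hn => by
    rw [← C.height n (fun e => by rw [e, C.root] at hn; rw [← hn] at hhm; omega), hn]
  obtain ⟨e, he, he'⟩ := F.full 3 (by
    have := Finset.one_lt_card.2 (C.exists_two_free hf)
    omega)
  rcases F.cases with ⟨l, hl, n, hn, hlp, hlm, hlu, hlw, hnm, hcov⟩ |
    ⟨l, hl, hlp, hlm, hlu, hlw, hcov⟩ | ⟨n, hn, hnm, hcov⟩ | hcov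
  · have hhl := hlh l hlp
    have hhn := hnh n hnm
    obtain ⟨hla, hlb⟩ := mem_rest.1 hl
    obtain ⟨hna, hnb⟩ := mem_rest.1 hn
    have hnd : [c, p, u, m, l, n, a, b].Nodup := by
      simp only [List.nodup_cons, List.mem_cons, List.not_mem_nil, or_false, not_or,
        not_false_eq_true, List.nodup_nil, and_true]
      and_intros <;> first
        | assumption | exact Ne.symm (by assumption) | (rintro rfl; omega)
    exact C.false_of_side_both hf hnd (fun t ht => by rcases hcov t ht with e | e | e | e | e | e | e <;> simp [e])
      hpp hmu huw hlp hnm he he'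
  · have hhl := hlh l hlp
    obtain ⟨hla, hlb⟩ := mem_rest.1 hl
    have hnd : [c, p, u, m, l, a, b].Nodup := by
      simp only [List.nodup_cons, List.mem_cons, List.not_mem_nil, or_false, not_or,
        not_false_eq_true, List.nodup_nil, and_true]
      and_intros <;> first
        | assumption | exact Ne.symm (by assumption) | (rintro rfl; omega)
    exact C.false_of_side_left hf hnd (fun t ht => by rcases hcov t ht with e | e | e | e | e | e <;> simp [e])
      hpp hmu huw hlp he he'
  · have hhn := hnh n hnm
    obtain ⟨hna, hnb⟩ := mem_rest.1 hn
    have hnd : [c, p, u, m, n, a, b].Nodup := by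
      simp only [List.nodup_cons, List.mem_cons, List.not_mem_nil, or_false, not_or,
        not_false_eq_true, List.nodup_nil, and_true]
      and_intros <;> first
        | assumption | exact Ne.symm (by assumption) | (rintro rfl; omega)
    exact C.false_of_side_right hf hnd (fun t ht => by rcases hcov t ht with e | e | e | e | e | e <;> simp [e])
      hpp hmu huw hnm he he'
  · obtain ⟨t, ht, h1, h2, h3, h4⟩ := exists_of_cover h5 c p m u
    have := hcov t ht
    tauto


theorem false_of_far_grandchild (C : Critical T G d v c π h a b) {f : W → V}
    (hf : Valid T G v c a b f) (h5 : 5 ≤ (rest a b).card) {p m u : W}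
    (F : Far G v c π h a b f p m u p) (huc : u ≠ c) : False := by
  have hpp := F.hpp
  have hmu := F.hmu
  have huw := F.huw
  have hmp := F.hmp
  have hup := F.hup
  have hhc := C.height_root
  have hhp := F.hhp
  have hhm := F.hhm
  have hab := C.a_ne_b
  obtain ⟨hca, hcb⟩ := mem_rest.1 C.c_mem
  obtain ⟨hpa, hpb⟩ := mem_rest.1 F.hp
  obtain ⟨hma, hmb⟩ := mem_rest.1 F.hm
  obtain ⟨hua, hub⟩ := mem_rest.1 (hmu ▸ C.parent_mem F.hm)
  have hhu := C.height u huc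
  rw [huw] at hhu
  have hlh : ∀ l, π l = p → h l = 2 := fun l hl => by
    have := C.height l (fun e => by rw [e, C.root] at hl; rw [← hl] at hhp; omega)
    rw [hl] at this
    omega
  have hnh : ∀ n, π n = m → h n = h m + 1 := fun n hn => by
    rw [← C.height n (fun e => by rw [e, C.root] at hn; rw [← hn] at hhm; omega), hn]
  obtain ⟨e, he, he'⟩ := F.full 3 (by
    have := Finset.one_lt_card.2 (C.exists_two_free hf)
    omega)
  rcases F.cases with ⟨l, hl, n, hn, hlp, hlm, hlu, hlw, hnm, hcov⟩ |
    ⟨l, hl, hlp, hlm, hlu, hlw, hcov⟩ | ⟨n, hn, hnm, hcov⟩ | hcov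
  · have hhl := hlh l hlp
    have hhn := hnh n hnm
    obtain ⟨hla, hlb⟩ := mem_rest.1 hl
    obtain ⟨hna, hnb⟩ := mem_rest.1 hn
    have hnd : [c, p, u, m, l, n, a, b].Nodup := by
      simp only [List.nodup_cons, List.mem_cons, List.not_mem_nil, or_false, not_or,
        not_false_eq_true, List.nodup_nil, and_true]
      and_intros <;> first
        | assumption | exact Ne.symm (by assumption) | (rintro rfl; omega)
    by_cases hvl : G.Adj v (f l)
    · exact C.false_of_grandchild_adj hf hnd (fun t ht => by rcases hcov t ht with e | e | e | e | e | e | e <;> simp [e])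
        hpp hmu huw hlp hnm hvl he he'
    have h3 := C.le_card_free_add hf
    have h4 : ((rest a b).erase c).filter (fun t => G.Adj v (f t)) ⊆
        ((rest a b).erase c).erase l := by
      intro t ht
      rw [Finset.mem_filter] at ht
      refine Finset.mem_erase.2 ⟨?_, ht.1⟩
      rintro rfl
      exact hvl ht.2
    have h6 : l ∈ (rest a b).erase c := Finset.mem_erase.2 ⟨by rintro rfl; omega, hl⟩
    have h7 := Finset.card_le_card h4
    rw [Finset.card_erase_of_mem h6, Finset.card_erase_of_mem C.c_mem, C.card_rest] at h7
    obtain ⟨e, he, he'⟩ := F.full 4 (by omega)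
    exact C.false_of_grandchild_not_adj hf hnd (fun t ht => by rcases hcov t ht with e | e | e | e | e | e | e <;> simp [e])
      hpp hmu huw hlp hnm he he'
  · have hhl := hlh l hlp
    obtain ⟨hla, hlb⟩ := mem_rest.1 hl
    have hnd : [c, p, u, m, l, a, b].Nodup := by
      simp only [List.nodup_cons, List.mem_cons, List.not_mem_nil, or_false, not_or,
        not_false_eq_true, List.nodup_nil, and_true]
      and_intros <;> first
        | assumption | exact Ne.symm (by assumption) | (rintro rfl; omega)
    exact C.false_of_grandchild_left hf hnd (fun t ht => by rcases hcov t ht with e | e | e | e | e | e <;> simp [e])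
      hpp hmu huw hlp he he'
  · have hhn := hnh n hnm
    obtain ⟨hna, hnb⟩ := mem_rest.1 hn
    have hnd : [c, p, u, m, n, a, b].Nodup := by
      simp only [List.nodup_cons, List.mem_cons, List.not_mem_nil, or_false, not_or,
        not_false_eq_true, List.nodup_nil, and_true]
      and_intros <;> first
        | assumption | exact Ne.symm (by assumption) | (rintro rfl; omega)
    exact C.false_of_grandchild_right hf hnd (fun t ht => by rcases hcov t ht with e | e | e | e | e | e <;> simp [e])
      hpp hmu huw hnm he he'
  · obtain ⟨t, ht, h1, h2, h3, h4⟩ := exists_of_cover h5 c p m u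
    have := hcov t ht
    tauto


theorem false_of_far_deep (C : Critical T G d v c π h a b) {f : W → V}
    (hf : Valid T G v c a b f) {p m u w : W}
    (F : Far G v c π h a b f p m u w) (huc : u ≠ c) (hwc : w ≠ c)
    (hwp : π w = p) : False := by
  have hpp := F.hpp
  have hmu := F.hmu
  have huw := F.huw
  have hmp := F.hmp
  have hup := F.hup
  have hhc := C.height_root
  have hhp := F.hhp
  have hhm := F.hhm
  have hab := C.a_ne_b
  obtain ⟨hca, hcb⟩ := mem_rest.1 C.c_mem
  obtain ⟨hpa, hpb⟩ := mem_rest.1 F.hp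
  obtain ⟨hma, hmb⟩ := mem_rest.1 F.hm
  obtain ⟨hua, hub⟩ := mem_rest.1 (hmu ▸ C.parent_mem F.hm)
  have hhu := C.height u huc
  rw [huw] at hhu
  obtain ⟨hwa, hwb⟩ := mem_rest.1 (huw ▸ hmu ▸ C.parent_mem (C.parent_mem F.hm))
  have hhw := C.height w hwc
  rw [hwp] at hhw
  have hlh : ∀ l, π l = p → h l = 2 := fun l hl => by
    have := C.height l (fun e => by rw [e, C.root] at hl; rw [← hl] at hhp; omega)
    rw [hl] at this
    omega
  have hnh : ∀ n, π n = m → h n = h m + 1 := fun n hn => by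
    rw [← C.height n (fun e => by rw [e, C.root] at hn; rw [← hn] at hhm; omega), hn]
  obtain ⟨e, he, he'⟩ := F.full 3 (by
    have := Finset.one_lt_card.2 (C.exists_two_free hf)
    omega)
  rcases F.cases with ⟨l, hl, n, hn, hlp, hlm, hlu, hlw, hnm, hcov⟩ |
    ⟨l, hl, hlp, hlm, hlu, hlw, hcov⟩ | ⟨n, hn, hnm, hcov⟩ | hcov
  · have hhl := hlh l hlp
    have hhn := hnh n hnm
    obtain ⟨hla, hlb⟩ := mem_rest.1 hl
    obtain ⟨hna, hnb⟩ := mem_rest.1 hn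
    have hnd : [c, p, w, u, m, l, n, a, b].Nodup := by
      simp only [List.nodup_cons, List.mem_cons, List.not_mem_nil, or_false, not_or,
        not_false_eq_true, List.nodup_nil, and_true]
      and_intros <;> first
        | assumption | exact Ne.symm (by assumption) | (rintro rfl; omega)
    exact C.false_of_deep_both hf hnd (fun t ht => by rcases hcov t ht with e | e | e | e | e | e | e <;> simp [e])
      hpp hmu huw hwp hlp hnm he he'
  · have hhl := hlh l hlp
    obtain ⟨hla, hlb⟩ := mem_rest.1 hl
    have hnd : [c, p, w, u, m, l, a, b].Nodup := by
      simp only [List.nodup_cons, List.mem_cons, List.not_mem_nil, or_false, not_or,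
        not_false_eq_true, List.nodup_nil, and_true]
      and_intros <;> first
        | assumption | exact Ne.symm (by assumption) | (rintro rfl; omega)
    exact C.false_of_deep_left hf hnd (fun t ht => by rcases hcov t ht with e | e | e | e | e | e <;> simp [e])
      hpp hmu huw hwp hlp he he'
  · have hhn := hnh n hnm
    obtain ⟨hna, hnb⟩ := mem_rest.1 hn
    have hnd : [c, p, w, u, m, n, a, b].Nodup := by
      simp only [List.nodup_cons, List.mem_cons, List.not_mem_nil, or_false, not_or,
        not_false_eq_true, List.nodup_nil, and_true]
      and_intros <;> first
        | assumption | exact Ne.symm (by assumption) | (rintro rfl; omega)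
    exact C.false_of_deep_right hf hnd (fun t ht => by rcases hcov t ht with e | e | e | e | e | e <;> simp [e])
      hpp hmu huw hwp hnm he he'
  · have hnd : [c, p, w, u, m, a, b].Nodup := by
      simp only [List.nodup_cons, List.mem_cons, List.not_mem_nil, or_false, not_or,
        not_false_eq_true, List.nodup_nil, and_true]
      and_intros <;> first
        | assumption | exact Ne.symm (by assumption) | (rintro rfl; omega)
    exact C.false_of_deep hf hnd (fun t ht => by rcases hcov t ht with e | e | e | e | e <;> simp [e])
      hpp hmu huw hwp he he'


theorem false_of_two_le (C : Critical T G d v c π h a b) (hd : 2 ≤ d) {f : W → V}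
    (hf : Valid T G v c a b f) : False := by
  obtain ⟨p, hp, m, hm, hpc, hmc, hmp, hpp, hmiss, hcov⟩ := C.exists_miss_eq_pair hd hf
  have h5 := C.five_le_card_rest hf hmp hmiss
  have hroot := C.root
  have hh0 := C.height_root
  have hh := C.height
  have hhp := hh p hpc
  have hhm := hh m hmc
  rw [hpp] at hhp
  have hc := C.c_mem
  have hpar : ∀ t ∈ rest a b, π t ∈ rest a b := fun t ht => C.parent_mem ht
  have htc : ∀ t, π t ≠ c → t ≠ c := by
    rintro t ht rfl
    exact ht hroot
  have hchild_p : ∀ t ∈ rest a b, π t = p → t ≠ m → t ≠ π m → t ≠ π (π m) →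
      ∀ u ∈ rest a b, π u ≠ t := by
    rintro t ht htp htm h1 h2 u hu rfl
    have ht0 := htc (π u) (htp ▸ hpc)
    have hu0 := htc u ht0
    have e1 := hh u hu0
    have e2 := hh (π u) ht0
    rcases hcov u hu with rfl | rfl | rfl | e | e | rfl
    · exact hu0 rfl
    · exact ht0 hpp
    · exact h1 rfl
    · rw [e] at ht0 htp
      exact ht0 (by rw [← htp, hpp])
    · exact htm e
    · exact h2 rfl
  have hchild_m : ∀ t ∈ rest a b, π t = m → ∀ u ∈ rest a b, π u ≠ t := by
    rintro t ht htp u hu rfl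
    have ht0 := htc (π u) (htp ▸ hmc)
    have hu0 := htc u ht0
    have e1 := hh u hu0
    have e2 := hh (π u) ht0
    rw [htp] at e2
    rcases hcov u hu with rfl | rfl | rfl | e | e | rfl
    · exact hu0 rfl
    · exact ht0 hpp
    · omega
    · rw [e] at htp
      exact hmc (htp.symm.trans hpp)
    · rw [e] at htp
      rw [htp] at hhm
      omega
    · omega
  have hn_eq : ∀ t ∈ rest a b, ∀ t' ∈ rest a b, π t = m → π t' = m → t = t' :=
    fun t ht t' ht' e e' => C.eq_of_childless hmc ht ht' e e' (hchild_m t ht e) (hchild_m t' ht' e')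
  have hl_eq : ∀ t ∈ rest a b, ∀ t' ∈ rest a b, π t = p → π t' = p → t ≠ m → t ≠ π m →
      t ≠ π (π m) → t' ≠ m → t' ≠ π m → t' ≠ π (π m) → t = t' :=
    fun t ht t' ht' e e' h1 h2 h3 h1' h2' h3' => C.eq_of_childless hpc ht ht' e e'
      (hchild_p t ht e h1 h2 h3) (hchild_p t' ht' e' h1' h2' h3')
  by_cases hpm : π m = p
  · obtain ⟨z, hz, z', hz', hzz⟩ := C.exists_two_free hf
    have hadj : ∀ z ∈ free G v a b f, ∀ t ∈ rest a b, t ≠ p → t ≠ m → G.Adj z (f t) := by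
      intro z hz t ht h1 h2
      by_contra hcon
      have := mem_miss.2 ⟨ht, hcon⟩
      rw [hmiss z hz, Finset.mem_insert, Finset.mem_singleton] at this
      tauto
    have hl : ∃ l ∈ rest a b, π l = p ∧ l ≠ m := by
      by_contra! hno
      by_cases hn : ∃ n ∈ rest a b, π n = m
      · obtain ⟨n, hn, hnm⟩ := hn
        obtain ⟨t, ht, h1, h2, h3, h4⟩ := exists_of_cover h5 c p m n
        rcases hcov t ht with e | e | e | e | e | e
        · exact h1 e
        · exact h2 e
        · exact h3 e
        · exact h3 (hno t ht e)
        · exact h4 (hn_eq t ht n hn e hnm)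
        · exact h2 (e.trans hpm)
      · push Not at hn
        obtain ⟨t, ht, h1, h2, h3, h4⟩ := exists_of_cover h5 c p m c
        rcases hcov t ht with e | e | e | e | e | e
        · exact h1 e
        · exact h2 e
        · exact h3 e
        · exact h3 (hno t ht e)
        · exact hn t ht e
        · exact h2 (e.trans hpm)
    obtain ⟨l, hl, hlp, hlm⟩ := hl
    have hside : ∀ t, π t = p → t ≠ π m ∧ t ≠ π (π m) := by
      rintro t ht
      rw [hpm, hpp]
      refine ⟨?_, ?_⟩
      · rintro rfl
        exact hpc (ht.symm.trans hpp)
      · rintro rfl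
        exact hpc (ht.symm.trans hroot)
    have hl_uniq : ∀ t ∈ rest a b, π t = p → t ≠ m → t = l := fun t ht e h1 =>
      hl_eq t ht l hl e hlp h1 (hside t e).1 (hside t e).2 hlm (hside l hlp).1 (hside l hlp).2
    have hn : ∃ n ∈ rest a b, π n = m := by
      by_contra! hno
      obtain ⟨t, ht, h1, h2, h3, h4⟩ := exists_of_cover h5 c p m l
      rcases hcov t ht with e | e | e | e | e | e
      · exact h1 e
      · exact h2 e
      · exact h3 e
      · exact h4 (hl_uniq t ht e h3)
      · exact hno t ht e
      · exact h2 (e.trans hpm)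
    obtain ⟨n, hn, hnm⟩ := hn
    refine C.false_of_adj hf hp hm hl hn hpc hmp hpp hpm hlp hnm hlm ?_ hzz (mem_free.1 hz).2
      (mem_free.1 hz').2 (hadj z hz) (hadj z' hz')
    intro t ht
    rcases hcov t ht with e | e | e | e | e | e
    · tauto
    · tauto
    · tauto
    · by_cases e' : t = m
      · tauto
      · exact Or.inr (Or.inr (Or.inr (Or.inl (hl_uniq t ht e e'))))
    · exact Or.inr (Or.inr (Or.inr (Or.inr (hn_eq t ht n hn e hnm))))
    · exact Or.inr (Or.inl (e.trans hpm))
  have F : Far G v c π h a b f p m (π m) (π (π m)) := by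
    refine ⟨hp, hm, hpp, rfl, rfl, hmp, hpm, by omega, hhm, fun t ht => ?_, fun t ht t' ht' e e' =>
      hl_eq t ht t' ht' e.1 e'.1 e.2.1 e.2.2.1 e.2.2.2 e'.2.1 e'.2.2.1 e'.2.2.2, hn_eq,
      fun k hk => C.exists_full hd hf hp hpc hmc hpp hpm hmiss hk⟩
    have := hcov t ht
    tauto
  have hw := hpar _ (hpar m hm)
  by_cases huc : π m = c
  · rw [huc, hroot] at F
    exact C.false_of_far_root hf h5 F
  have e1 := hh _ huc
  by_cases hwc : π (π m) = c
  · rw [hwc] at F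
    exact C.false_of_far_side hf h5 F huc
  have e2 := hh _ hwc
  rcases hcov _ hw with e | e | e | e | e | e
  · exact hwc e
  · rw [e] at F
    exact C.false_of_far_grandchild hf h5 F huc
  · rw [e] at e1
    omega
  · exact C.false_of_far_deep hf F huc hwc e
  · rw [e] at e2
    omega
  · rw [e] at e1
    omega

end Critical

end ErdosSos

namespace ErdosSos

open scoped Classical

variable {V W : Type*} {T : SimpleGraph W} {G : SimpleGraph V} [Fintype V] [Fintype W]

theorem Critical.false_of_eq_one {v : V} {c : W} {π : W → W} {h : W → ℕ} {a b : W}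
    (C : Critical T G 1 v c π h a b) {f : W → V} (hf : Valid T G v c a b f) : False := by
  obtain ⟨z, hz, z', hz', hne⟩ := C.exists_two_free hf
  have hone : ∀ z ∈ free G v a b f, ∀ p ∈ miss G a b f z, ∀ q ∈ miss G a b f z, p = q := by
    intro z hz
    have h1 := C.card_miss hf hz
    have h2 := C.lt_deg (by omega) z
    exact Finset.card_le_one.1 (by omega)
  obtain ⟨p, hp, hpc, hpp⟩ := C.exists_child_mem_miss hf hz hz' hne
  have hpr := (mem_miss.1 hp).1
  have hp' : p ∈ miss G a b f z' := by
    rcases C.mem_miss_or_exists hf hz hz' hne hpr hpc with e | ⟨m, hm, e⟩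
    · exact e
    · rw [hone z hz m hm p hp] at e
      exact absurd e (T.irrefl)
  have hl : ∃ l ∈ rest a b, l ≠ c ∧ l ≠ p := by
    by_contra! hcon
    have h1 : rest a b ⊆ {c, p} := by
      intro t ht
      rw [Finset.mem_insert, Finset.mem_singleton]
      have := hcon t ht
      tauto
    have h2 := (Finset.card_le_card h1).trans Finset.card_le_two
    have h3 := C.card_rest
    omega
  obtain ⟨l, hlr, hlc, hlp⟩ := hl
  have hcov : ∀ t ∈ rest a b, t = c ∨ t = p ∨ t = l := by
    intro t ht
    by_contra! hcon
    have h1 : ({c, p, l, t} : Finset W) ⊆ rest a b := by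
      intro s hs
      simp only [Finset.mem_insert, Finset.mem_singleton] at hs
      rcases hs with rfl | rfl | rfl | rfl
      · exact C.c_mem
      · exact hpr
      · exact hlr
      · exact ht
    have h2 := Finset.card_le_card h1
    rw [C.card_rest, Finset.card_insert_of_notMem, Finset.card_insert_of_notMem,
      Finset.card_pair hcon.2.2.symm] at h2
    · omega
    · simpa using ⟨hlp.symm, hcon.2.1.symm⟩
    · simpa using ⟨hpc.symm, hlc.symm, hcon.1.symm⟩
  have hpl : π l = p := by
    rcases C.mem_miss_or_exists hf hz hz' hne hlr hlc with e | ⟨m, hm, e⟩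
    · exact absurd (hone z' hz' l e p hp') hlp
    · rw [hone z hz m hm p hp] at e
      rcases ((C.adj_iff _ _).1 e).2 with e | e
      · exact e
      · exact absurd (e.symm.trans hpp) hlc
  have hadj : G.Adj z' (f l) := by
    by_contra hcon
    exact hlp (hone z' hz' l (mem_miss.2 ⟨hlr, hcon⟩) p hp')
  have hvp : G.Adj (f c) (f p) :=
    (hpp ▸ C.adj_parent hf p (mem_rest.1 hpr).1 (mem_rest.1 hpr).2 hpc).symm
  have hpl' : G.Adj (f p) (f l) :=
    (hpl ▸ C.adj_parent hf l (mem_rest.1 hlr).1 (mem_rest.1 hlr).2 hlc).symm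
  have hvz : G.Adj z (f c) := hf.2.symm ▸ (mem_free.1 hz).1.symm
  obtain ⟨hca, hcb⟩ := mem_rest.1 C.c_mem
  obtain ⟨hpa, hpb⟩ := mem_rest.1 hpr
  obtain ⟨hla, hlb⟩ := mem_rest.1 hlr
  have hab := C.a_ne_b
  have hinj := hf.1.inj
  have h1 : f c ≠ f p := hvp.ne
  have h2 : f p ≠ f l := hpl'.ne
  have h3 : f c ≠ f l := fun e => hlc (hinj l hlr c C.c_mem e.symm)
  have hzf := (mem_free.1 hz).2
  have hzf' := (mem_free.1 hz').2
  obtain ⟨g, hg⟩ := C.exists_emb_of_list (G := G)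
    [(a, z), (b, f c), (c, f p), (p, f l), (l, z')]
    (by
      intro t
      have h1 := C.eq_or_eq_or_mem_rest t
      have h2 := hcov t
      simp only [List.map_cons, List.map_nil, List.mem_cons, List.not_mem_nil, or_false]
      tauto)
    (by simp [hab, hca.symm, hcb.symm, hpa.symm, hpb.symm, hla.symm, hlb.symm,
      hpc.symm, hlc.symm, hlp.symm])
    (by simp [hne, h1, h2, h3, hzf' c C.c_mem, hzf' p hpr, hzf' l hlr, (hzf c C.c_mem).symm,
      (hzf p hpr).symm, (hzf l hlr).symm])
    (by simp [C.parent_a, C.parent_b, hpp, hpl, hvz, hvp, hpl', hpl'.symm, hadj])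
  exact C.not_emb g hg

/-- The case of minimum degree at least `d` and average degree greater than `d + 2`,
for trees of order `d + 4`. -/
theorem exists_emb_of_lt_sum (hT : T.IsTree) {d : ℕ} (hd1 : 1 ≤ d)
    (hd : ∀ x, d ≤ (nb G x).card) (hsm : d ≤ 2 → ∀ x, d + 1 ≤ (nb G x).card)
    (hW : Fintype.card W = d + 4) (havg : (d + 2) * Fintype.card V < ∑ x, (nb G x).card) :
    ∃ f, Emb T G Finset.univ f := by
  by_contra hno
  obtain ⟨v, hv, hbad⟩ := exists_not_bad havg
  have hone : ∀ p l l', T.Adj p l → (∀ u, T.Adj l u → u = p) → T.Adj p l' →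
      (∀ u, T.Adj l' u → u = p) → l = l' := by
    intro p l l' h1 h2 h3 h4
    by_contra hne
    exact hno (exists_emb_of_two_leaves hT hd hsm hW hv hbad ⟨h1, h2⟩ ⟨h3, h4⟩ hne)
  obtain ⟨c, π, h, a, b, P⟩ := exists_pendant hT (by omega) hone
  have C : Critical T G d v c π h a b :=
    { P with
      not_emb := fun f hf => hno ⟨f, hf⟩
      le_deg := hd
      lt_deg := hsm
      card_eq := hW
      le_deg_v := hv
      not_bad := hbad
      leaf_unique := by
        intro t t' ht ht' e h1 h2
        have key : ∀ t, (∀ u, π u ≠ t) → ∀ u, T.Adj t u → u = π t := by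
          intro t h1 u hu
          rcases ((P.adj_iff _ _).1 hu).2 with e | e
          · exact e.symm
          · exact absurd e (h1 u)
        exact hone (π t) t t' (P.adj ht).symm (key t h1) (e ▸ (P.adj ht').symm)
          (e ▸ key t' h2) }
  rcases exists_emb_or_exists_rooted hT P.toIsParent hd hsm hW hv hbad C.c_mem
    (fun t ht => C.parent_mem ht) C.card_rest (by
      intro u hu hpu
      rw [mem_rest, not_and_or, not_not, not_not] at hu
      rcases hu with rfl | rfl
      · rw [P.parent_a] at hpu
        exact absurd rfl (mem_rest.1 hpu).2
      · exact P.parent_b) with h | ⟨f, hf, hfc⟩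
  · exact hno h
  · by_cases hd2 : 2 ≤ d
    · exact C.false_of_two_le hd2 ⟨hf, hfc⟩
    · obtain rfl : d = 1 := by omega
      exact C.false_of_eq_one ⟨hf, hfc⟩

theorem exists_emb_of_le_four (hT : T.IsTree) {q : ℕ} (hq : q ≤ 2) (hW : Fintype.card W = q + 2)
    (hdeg : ∀ x, q + 1 ≤ 2 * (nb G x).card) (havg : q * Fintype.card V < ∑ x, (nb G x).card) :
    ∃ f, Emb T G Finset.univ f := by
  have hv : ∃ v, q + 1 ≤ (nb G v).card := by
    by_contra! hcon
    have := Finset.sum_le_card_nsmul Finset.univ (fun x => (nb G x).card) q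
      (fun x _ => by have := hcon x; omega)
    rw [Finset.card_univ, smul_eq_mul, mul_comm] at this
    omega
  obtain ⟨v, hv⟩ := hv
  have hnt : Nontrivial W := Fintype.one_lt_card_iff_nontrivial.1 (by omega)
  obtain ⟨l, hl⟩ := hT.exists_vert_degree_one_of_nontrivial
  obtain ⟨p, hp, hp'⟩ := degree_eq_one_iff_existsUnique_adj.1 hl
  refine exists_emb_of_leaves hT (d := q) (p := p) (P := {l}) (v := v)
    (fun x => by have := hdeg x; omega) ?_ ?_ (by omega)
  · intro t ht
    rw [Finset.mem_singleton.1 ht]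
    exact ⟨hp.symm, hp'⟩
  · rw [Finset.card_singleton]
    omega

/-- A graph of large average degree has an induced subgraph which also has large minimum degree. -/
theorem exists_induce_le_two_mul_card {q : ℕ} (havg : q * Fintype.card V < ∑ x, (nb G x).card) :
    ∃ U : Finset V, q * Fintype.card U < ∑ x : U, (nb (G.induce (U : Set V)) x).card ∧
      ∀ x : U, q + 1 ≤ 2 * (nb (G.induce (U : Set V)) x).card := by
  set P := Finset.univ.filter fun U : Finset V => q * U.card < ∑ x ∈ U, (nb G x ∩ U).card with hP
  obtain ⟨U, hU, hmin⟩ := Finset.exists_min_image P Finset.card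
    ⟨Finset.univ, by simpa [hP] using havg⟩
  have hmem : ∀ U, U ∈ P ↔ q * U.card < ∑ x ∈ U, (nb G x ∩ U).card := by simp [hP]
  rw [hmem] at hU
  have hcard : ∀ x : U, (nb (G.induce (U : Set V)) x).card = (nb G x ∩ U).card := by
    intro x
    rw [← Finset.card_map (Function.Embedding.subtype (· ∈ U))]
    congr 1
    ext y
    simp only [Finset.mem_map, mem_nb, Finset.mem_inter]
    constructor
    · rintro ⟨y, hy, rfl⟩
      exact ⟨hy, y.2⟩
    · rintro ⟨hy, hyU⟩
      exact ⟨⟨y, hyU⟩, hy, rfl⟩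
  refine ⟨U, ?_, fun x => ?_⟩
  · simp only [hcard]
    rw [Finset.sum_coe_sort U (fun x => (nb G x ∩ U).card), Fintype.card_coe]
    exact hU
  · rw [hcard]
    obtain ⟨x, hx⟩ := x
    have h1 : ¬ U.erase x ∈ P := fun e => by
      have := hmin _ e
      have := Finset.card_erase_lt_of_mem hx
      omega
    rw [hmem, not_lt] at h1
    have h2 : ∀ y ∈ U.erase x, (nb G y ∩ U).card =
        (nb G y ∩ U.erase x).card + if y ∈ nb G x then 1 else 0 := by
      intro y _
      rw [Finset.inter_erase]
      split_ifs with e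
      · rw [Finset.card_erase_add_one]
        rw [mem_nb] at e
        simpa [hx] using e.symm
      · rw [Finset.erase_eq_of_notMem, add_zero]
        rw [mem_nb] at e
        simpa [hx] using fun e' => e (G.adj_symm e')
    have h3 : (∑ y ∈ U.erase x, if y ∈ nb G x then 1 else 0) = (nb G x ∩ U).card := by
      rw [← Finset.card_filter, Finset.filter_mem_eq_inter, Finset.inter_comm]
      congr 1
      ext y
      simp only [Finset.mem_inter, Finset.mem_erase, mem_nb]
      constructor
      · tauto
      · exact fun ⟨h, h'⟩ => ⟨h, h.ne', h'⟩
    rw [← Finset.sum_erase_add _ _ hx, Finset.sum_congr rfl h2, Finset.sum_add_distrib, h3,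
      ← Finset.card_erase_add_one hx, mul_add] at hU
    simp only
    omega

omit [Fintype V] [Fintype W] in
theorem Emb.of_induce {U : Set V} {S : Finset W} {f : W → U} (hf : Emb T (G.induce U) S f) :
    Emb T G S (fun t => (f t : V)) :=
  ⟨fun s hs t ht e => hf.inj s hs t ht (Subtype.ext e), fun s hs t ht e => hf.adj s hs t ht e⟩

theorem exists_emb (hT : T.IsTree) {q : ℕ} (hW : Fintype.card W = q + 2)
    (hdeg : ∀ x, q ≤ (nb G x).card + 2) (havg : q * Fintype.card V < ∑ x, (nb G x).card) :
    ∃ f, Emb T G Finset.univ f := by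
  by_cases hq : q ≤ 4
  · obtain ⟨U, hU, hdeg'⟩ := exists_induce_le_two_mul_card havg
    by_cases hq2 : q ≤ 2
    · obtain ⟨f, hf⟩ := exists_emb_of_le_four hT hq2 hW hdeg' hU
      exact ⟨_, hf.of_induce⟩
    · obtain ⟨d, rfl⟩ : ∃ d, q = d + 2 := ⟨q - 2, by omega⟩
      obtain ⟨f, hf⟩ := exists_emb_of_lt_sum hT (d := d) (by omega)
        (fun x => by have := hdeg' x; omega) (fun _ x => by have := hdeg' x; omega) hW hU
      exact ⟨_, hf.of_induce⟩
  · obtain ⟨d, rfl⟩ : ∃ d, q = d + 2 := ⟨q - 2, by omega⟩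
    exact exists_emb_of_lt_sum hT (d := d) (by omega) (fun x => by have := hdeg x; omega)
      (fun _ => by omega) hW havg

end ErdosSos

theorem erdos_sos_minDegree {V : Type*} [Fintype V] (G : SimpleGraph V) [DecidableRel G.Adj]
    (k : ℕ) (hk : 2 ≤ k)
    (hmin : (k : ℝ) - 4 ≤ (G.minDegree : ℝ))
    (havg : (k : ℝ) - 2 < 2 * G.edgeFinset.card / Fintype.card V) :
    ∀ (W : Type) [Fintype W] (T : SimpleGraph W), T.IsTree → Fintype.card W = k →
      ∃ f : T →g G, Function.Injective f := by
  intro W _ T hT hW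
  obtain ⟨q, rfl⟩ : ∃ q, k = q + 2 := ⟨k - 2, by omega⟩
  have hnb : ∀ x, (ErdosSos.nb G x).card = G.degree x := by
    intro x
    rw [← G.card_neighborFinset_eq_degree]
    congr 1
    ext y
    simp
  have hdeg : ∀ x, q ≤ (ErdosSos.nb G x).card + 2 := by
    intro x
    have h1 : (q : ℝ) ≤ (G.minDegree + 2 : ℕ) := by
      push_cast at hmin ⊢
      linarith
    have h2 : q ≤ G.minDegree + 2 := by exact_mod_cast h1
    have h3 := G.minDegree_le_degree x
    rw [hnb]
    omega
  have hsum : q * Fintype.card V < ∑ x, (ErdosSos.nb G x).card := by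
    simp only [hnb]
    rw [G.sum_degrees_eq_twice_card_edges]
    push_cast at havg
    have hpos : (0 : ℝ) < Fintype.card V := by
      rcases (Nat.cast_nonneg (Fintype.card V) : (0 : ℝ) ≤ _).lt_or_eq with h | h
      · exact h
      · rw [← h, div_zero] at havg
        have : (0 : ℝ) ≤ q := Nat.cast_nonneg q
        linarith
    rw [lt_div_iff₀ hpos] at havg
    have : ((q * Fintype.card V : ℕ) : ℝ) < (2 * G.edgeFinset.card : ℕ) := by
      push_cast
      linarith
    exact_mod_cast this
  obtain ⟨f, hf⟩ := ErdosSos.exists_emb hT hW hdeg hsum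
  exact ⟨⟨f, fun {s t} h => hf.adj s (Finset.mem_univ s) t (Finset.mem_univ t) h⟩,
    fun s t h => hf.inj s (Finset.mem_univ s) t (Finset.mem_univ t) h⟩
end

section
/- Let k be an integer with 2 ≤ k ≤ 8 and let G be a finite simple graph of order n whose average degree 2·e(G)/n is strictly greater than k−2. Then G contains every tree of order k as a subgraph. -/
open SimpleGraph

namespace ErdosSos

/-- The graph on `ℕ` with an edge between `i + 1` and the `i`-th entry `p` of `ps`
whenever `p ≤ i`, so that `p` is the parent of `i + 1` in a tree on `0, …, ps.length`. -/
def parentGraph (ps : List ℕ) : SimpleGraph ℕ :=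
  SimpleGraph.fromRel fun a b => a < b ∧ ps[b - 1]? = some a

/-- Whether `f` holds at one of the `n` highest bits set in `m`. -/
def anyBit (f : ℕ → Bool) : ℕ → ℕ → Bool
  | 0, _ => false
  | n + 1, m => bif Nat.beq m 0 then false else f m.log2 || anyBit f n (m ^^^ 2 ^ m.log2)

/-- Whether a partial embedding of a tree into the graph with adjacency matrix `adj` extends to
all vertices. Here `ps` lists the parents of the vertices not yet embedded, `l` the images of
`i, …, 0`, and `free` the vertices not yet used. -/
def extendsTo (adj : ℕ) : List ℕ → ℕ → List ℕ → ℕ → Bool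
  | [], _, _, _ => true
  | p :: ps, i, l, free =>
      anyBit (fun w => extendsTo adj ps (i + 1) (w :: l) (free ^^^ 2 ^ w)) 16
        (adj >>> (16 * l.getD (i - p) 0) &&& free)

/-- Whether the tree with parents `ps` embeds into the graph on `0, …, n - 1` in which `u` and `v`
are adjacent if bit `16 * u + v` of `adj` is set. -/
def embeds (adj n : ℕ) (ps : List ℕ) : Bool :=
  anyBit (fun r => extendsTo adj ps 0 [r] ((2 ^ n - 1) ^^^ 2 ^ r)) 16 (2 ^ n - 1)

/-- Partial knowledge about a graph in which the vertices `0, …, order - 1` have been named.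
Bit `16 * u + v` of `adj` says that `u` and `v` are adjacent. Bit `16 * u + v` of `non` says that
they are not if `v` is named, and that `u` has no unnamed neighbour otherwise. -/
structure PartialGraph where
  order : ℕ
  adj : ℕ
  non : ℕ

/-- The matrix with a single bit set, at row `u` and column `v`. -/
def cell (u v : ℕ) : ℕ := 2 ^ (16 * u + v)

namespace PartialGraph

variable (G : PartialGraph)

def adjacent (u v : ℕ) : Bool := G.adj.testBit (16 * u + v)

def apart (u v : ℕ) : Bool := G.non.testBit (16 * u + v)

/-- Name a neighbour of `v`. -/
def extend (v : ℕ) : PartialGraph :=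
  ⟨G.order + 1, G.adj ||| cell v G.order ||| cell G.order v, G.non⟩

/-- Record that all neighbours of `v` are named. -/
def close (v : ℕ) : PartialGraph :=
  ⟨G.order, G.adj, G.non ||| (2 ^ (16 - G.order) - 1) <<< (16 * v + G.order)⟩

/-- Record that `u` and `v` are adjacent. -/
def join (u v : ℕ) : PartialGraph := ⟨G.order, G.adj ||| cell u v ||| cell v u, G.non⟩

/-- Record that `u` and `v` are not adjacent. -/
def sever (u v : ℕ) : PartialGraph := ⟨G.order, G.adj, G.non ||| cell u v ||| cell v u⟩

def closed (v : ℕ) : Bool := G.apart v G.order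

/-- The number of named vertices that may be neighbours of `v`. -/
def potential (v : ℕ) : ℕ := (List.range G.order).countP fun w => !Nat.beq w v && !G.apart v w

/-- Whether the knowledge about `v` contradicts itself or the degree conditions. -/
def contradictory (k v : ℕ) : Bool :=
  (G.closed v && Nat.blt (G.potential v) (bif Nat.beq v 0 then k - 1 else k / 2)) ||
    (List.range G.order).any fun w => G.adjacent v w &&
      (G.apart v w || (G.closed v && (G.closed w && Nat.blt (G.potential v + G.potential w) k)))

/-- Whether the case distinctions in a script show that every graph that fits one of the given
descriptions contains the tree with parents `ps`. Each entry `16 * u + v` of the script treats the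
first description: the tree is found if it is `255`, a contradiction at `u` is observed if `u = v`,
a neighbour of `u` is named, if there is one, if `v = 15`, and otherwise the adjacency of `u`
and `v` is decided. -/
def forces (k : ℕ) (ps : List ℕ) : List ℕ → List PartialGraph → Bool
  | _, [] => true
  | [], _ :: _ => false
  | c :: cs, G :: Gs =>
    bif Nat.beq c 255 then embeds G.adj G.order ps && forces k ps cs Gs
    else bif Nat.beq (c / 16) (c % 16) then G.contradictory k (c / 16) && forces k ps cs Gs
    else bif Nat.beq (c % 16) 15 then
      Nat.blt (c / 16) G.order && (Nat.blt G.order 15 &&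
        forces k ps cs (G.extend (c / 16) :: G.close (c / 16) :: Gs))
    else
      Nat.blt (c / 16) G.order && (Nat.blt (c % 16) G.order &&
        forces k ps cs (G.join (c / 16) (c % 16) :: G.sever (c / 16) (c % 16) :: Gs))

end PartialGraph

/-- Prepend the last `n` base `256` digits of `c` to `l`. -/
def prependBytes : ℕ → ℕ → List ℕ → List ℕ
  | 0, _, l => l
  | n + 1, c, l => prependBytes n (c / 256) (c % 256 :: l)

/-- The adjacency matrix of `parentGraph ps`. -/
def adjMatrix (ps : List ℕ) : ℕ :=
  (ps.zipIdx 1).foldr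
    (fun e m => bif Nat.blt e.1 e.2 then m ||| cell e.1 e.2 ||| cell e.2 e.1 else m) 0

/-- The number whose base `16` digits are the degrees in `parentGraph ps`. -/
def degrees (ps : List ℕ) : ℕ :=
  (ps.zipIdx 1).foldr (fun e d => d + 16 ^ e.1 + 16 ^ e.2) 0

/-- The number whose base `16` digits count the vertices of each degree in `parentGraph ps`. -/
def degreeCounts (ps : List ℕ) : ℕ :=
  (List.range (ps.length + 1)).foldr (fun v c => c + 16 ^ ((degrees ps >>> (4 * v)) % 16)) 0

/-- For `1 ≤ k ≤ 8`, the parent lists of all trees of order `k` up to isomorphism, each with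
a script for `PartialGraph.forces` in blocks of 44 bytes. -/
def scripts : ℕ → List (List ℕ × List ℕ)
  | 1 => [
      ([], [
        0xff00000000000000000000000000000000000000000000000000000000000000000000000000000000000000])]
  | 2 => [
      ([0], [
        0x0fff000000000000000000000000000000000000000000000000000000000000000000000000000000000000])]
  | 3 => [
      ([0, 1], [
        0x0f0fff0000000000000000000000000000000000000000000000000000000000000000000000000000000000])]
  | 4 => [
      ([0, 1, 2], [
        0x0f1f0fff00110000000000000000000000000000000000000000000000000000000000000000000000000000]),
      ([0, 1, 1], [
        0x0f0f0fff00000000000000000000000000000000000000000000000000000000000000000000000000000000])]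
  | 5 => [
      ([0, 1, 2, 3], [
        0x0f1f2f0fff00201f0fff00112211000000000000000000000000000000000000000000000000000000000000]),
      ([0, 1, 1, 3], [
        0x0f1f0f0fff000011000000000000000000000000000000000000000000000000000000000000000000000000]),
      ([0, 1, 1, 1], [
        0x0f0f0f0fff000000000000000000000000000000000000000000000000000000000000000000000000000000])]
  | 6 => [
      ([0, 1, 2, 3, 4], [
        0x0f1f2f3f0fff000f4fff433342310fff00334400221100000000000000000000000000000000000000000000]),
      ([0, 1, 1, 3, 4], [
        0x0f1f2f0f0fff0000221100000000000000000000000000000000000000000000000000000000000000000000]),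
      ([0, 1, 1, 3, 3], [
        0x0f1f1f0f0fff0000111100000000000000000000000000000000000000000000000000000000000000000000]),
      ([0, 0, 2, 2, 4], [
        0x0f1f0f3f0fff000f43334fff42310fff00334400001100000000000000000000000000000000000000000000]),
      ([0, 1, 1, 3, 1], [
        0x0f0f2f0f0fff0000220000000000000000000000000000000000000000000000000000000000000000000000]),
      ([0, 1, 1, 1, 1], [
        0x0f0f0f0f0fff0000000000000000000000000000000000000000000000000000000000000000000000000000])]
  | 7 => [
      ([0, 1, 2, 3, 4, 5], [
        0x0f1f2f3f4f5fff0fff000f5fff544453421fff0fff00412fff0fff004440513fff2fff5241310fff0030421f,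
        0xff0fff00443331420fff004433555552413fff0fff004455000f4f5fff533352314fff0fff003351304fff2f,
        0xff425031433341201fff0fff0022443355223355433342310f5fff54445333515241302fff0fff0033445555,
        0x0033440022110000000000000000000000000000000000000000000000000000000000000000000000000000]),
      ([0, 1, 1, 3, 4, 5], [
        0x0f1f2f3f0f0fff0000302f1f1fff040fff000f0fff000043334f0fff00410f0fff0000442233221100000000]),
      ([0, 0, 2, 3, 4, 2], [
        0x0f1f2f0f0f5fff4fff0f6555644454ff6fff0f7666755574447fff2763ff61ff662673ff772573ff772473ff,
        0x777361ff66772653ff51ff552563ff662463ff666351ff556600000022110000000000000000000000000000]),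
      ([0, 1, 1, 1, 4, 5], [
        0x0f1f2f0f0f0fff00000022110000000000000000000000000000000000000000000000000000000000000000]),
      ([0, 1, 2, 3, 3, 1], [
        0x0f1f2f2f0f0fff0000133f0f0fff00003303023f4222414f0fff003f54445222510fff000fff00334f355222,
        0x510fff000fff001552225fff4fff444fff3f05ff65644462226104ff440fff0064446222610fff000fff0033,
        0x443322023f1442224f0fff003f0fff00333f0fff003333222211000000000000000000000000000000000000]),
      ([0, 1, 1, 3, 3, 5], [
        0x0f1f2f1f0f0fff00002f130f0fff000011222211000000000000000000000000000000000000000000000000]),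
      ([0, 1, 1, 1, 4, 4], [
        0x0f1f1f0f0f1fff0fff0000001111000000000000000000000000000000000000000000000000000000000000]),
      ([0, 1, 2, 2, 3, 4], [
        0x0f1f2f1f0f4fff0f45ff654326ff2fff25ff0f744473ff7fff72227653ff5fff71ff51ff40ff20ff13756444,
        0x6fff63ff423fff1f8777770f8777770044771f877786ff855584448fff82228342ff448875644463ff6fff42,
        0x30ff3f16ff1133447775644463ff6fff71ff777740ff0042365fff52ff1f76ff755574447fff73ff40ff440f,
        0x755574447fff73ff72ff51ff76711177775140ff444016ff13ff11443564446fff62ff1f766675ff74447fff,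
        0x73ff40ff440f766674447fff73ff72ff61ff666140ff446630ff3f4017ff16ff1fff15ff3f13ff1113ff1144,
        0x33446444635fff52ff536fff62ff432fff1f7666755574447fff72227342ff70ff77770f7666755574447fff,
        0x7222737111777761ff66421f7666755574447fff73ff40ff440f7666755574447fff72ff737111777761ff66,
        0x44556253ff5fff3fff43ff6f755574447fff733371ff52ff5552423061ff663344556f53ff5fff52ff756fff,
        0x4327ff2fff61ff66423761ff6630ff3f61ff66334455660000303f0f5fff4fff542fff3fff0fff0053420f65,
        0x556fff6444511163611162ff6662411113ff1166004111445242130fff001141114455002f4333404f5fff53,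
        0x3352130f65556fff63333300115111554111444f4f310665533333633333050f76ff733333000f760f85ff84,
        0xff83333300750f86ff84ff83333300740f86ff85ff83333300733333003331050f633333000f650f74447333,
        0x33006444633333003344223f3f255fff134fff050fff000fff0011244fff135fff050fff000fff00112f65ff,
        0x6fff64ff631354ff5fff4fff062fff05ff5505ff5511606111666622200f54132fff0f63333300115333525f,
        0xff0f511155005f13642fff26ff24ff226333331155002f5fff54134fff050fff000fff001153335051115555,
        0x2233221100000000000000000000000000000000000000000000000000000000000000000000000000000000]),
      ([0, 0, 2, 2, 4, 2], [
        0x0f1f0f0f0f5fff4fff3fff0f65556444633354ff53ff43ff6fff6251ff556600000000110000000000000000]),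
      ([0, 1, 1, 1, 4, 1], [
        0x0f0f2f0f0f0fff00000022000000000000000000000000000000000000000000000000000000000000000000]),
      ([0, 1, 1, 1, 1, 1], [
        0x0f0f0f0f0f0fff00000000000000000000000000000000000000000000000000000000000000000000000000])]
  | 8 => [
      ([0, 1, 2, 3, 4, 5, 6], [
        0x0f1f2f3f4f5f6fff0fff000f6fff655564532fff1fff0fff00523fff1fff630fff00510fff00555550614fff,
        0x3fff2fff625141360fff0066403653421fff0fff00445242310fff00301fff0fff00334455664441530fff00,
        0x553652421fff0fff00445566666663524fff1fff0fff005566000f5f6fff644463425fff1fff0fff00446241,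
        0x5fff3fff0fff004466544453421f6fff6444620fff0060655566660f6fff6555644461116600445500332211,
        0x0000000000000000000000000000000000000000000000000000000000000000000000000000000000000000]),
      ([0, 1, 1, 3, 4, 5, 6], [
        0x0f1f2f3f4f0f656fff5fff4fff3fff2fff0fff004fff0fff00000f5f64445fff3fff6f24ff44635444240fff,
        0x004454442453062fff0fff0066062f744473337f86668555844483337fff8fff81766675557062ff66778876,
        0x6675557716405231625141300fff00334455663355446666445444532f64443fff2fff6f7444733371ff6fff,
        0x7f51ff55755577630fff0006416555664466240f655564443fff0fff00004455003322110000000000000000]),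
      ([0, 1, 1, 3, 4, 5, 5], [
        0x0f1f2f3f0f3f0fff000f350fff0065642fff54265fff314fff1fff0fff0033256fff314fff1fff0fff003324,
        0x6fff5fff0fff00225f24ff265fff31ff332541ff4fff67ff6fff31ff3322256fff310fff0033556f24ff2fff,
        0x57276fff54ff5fff31ff332654ff5fff31ff33256fff31ff33225427ff2641ff4fff5fff31ff33256fff31ff,
        0x33225f27ff265fff31ff332568ff6fff31ff3322276fff7473337fff03ff3373337f7fff04ff03ff3331ff33,
        0x256fff31ff3355542fff265fff310fff0033245fff4fff0fff00164fff30205fff511fff310fff0033311fff,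
        0x5263336655332233665f24ff2fff275fff7473337fff03ff3373337f7fff04ff03ff33633331ff33265fff31,
        0xff33144fff5fff4752ff224413ff33244fff63332f76667555744473337f7fff08866685558fff8444833361,
        0xff660761ff6677770f7666755574447f7fff73332671ff7766733377002f6333766675557473337fff164fff,
        0x04ff446673337f7fff2884ff83338fff866685550861ff66882f98977794ff93339fff9666955531ff339777,
        0x966695559493339fff71ff7793339f9fff0aa8ffa666a555a4ffafffa777a33371ff770971ff779999088666,
        0x8555848fff26ff668f8fff26ff6661ff6607615131ff33556677770f76667555747f26ff25ff226241ff4fff,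
        0x44614fff7333722277667f7f26ff25ff2226733371633325ff557725733371633366772273337700646f25ff,
        0x2fff276fff7473337fff03ff3373337f7fff04ff03ff333124ff755fff30ff3370ff7733246fff47ff4fff07,
        0xff0fff001745ff4fff7530ff3370307fff62ff22337f30ff333062ff22331547ff4fff13ff331f47ff45ff4f,
        0xff878630ff338530ff33833382228f30ff338013ff3388868530ff338013ff338f30ff3330ff338583338222,
        0x8fff84633362ff228884833382228f8fff633362ff2288833382228f8fff8888575f41ff4fff26ff22555f5f,
        0x47ff41ff4fff26ff225555256333612fff5f41ff4fff5fff3107ff0fff0033514fff310fff003355662f6333,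
        0x1745ff4fff24ff2fff7540ff625fff556673337f40ff74ff44706131ff33665f5fff55551547ff4fff04ff0f,
        0xff001f47ff45ff4fff8773337fff86668562ff66833382ff8f62ff6680ff888666855fff55833382ff8f8f62,
        0xff6680ff88887666757473337fff03ff3373337f41ff40ff4fff7fff03ff33777473337fff7773337f7fff77,
        0x77154fff63335f42ff625fff54ff5566551f45ff4fff766675733372227f633362ff667042ff6333625fff55,
        0x6677733372227f7f633362ff667042ff63336274ff776677775f5f42ff41ff4fff26ff2255556f6f25ff24ff,
        0x2fff286fff8784ff83338fff04ff03ff338483338fff07ff03ff3383338f8fff07ff04ff03ff3331ff33276f,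
        0xff7874ff73337fff04ff03ff337473337fff08ff03ff3373337f7fff08ff04ff03ff3331ff33585726ff2254,
        0x41ff4fff26ff225f26ff2255575441ff4fff26ff225f26ff22555441ff4fff5f26ff22555f5f26ff22555525,
        0x63336124ff2fff544fff47ff5fff3107ff0fff00335f5fff3157ff08ff07ff0fff00333107ff0fff00336624,
        0x47ff4fff63334507ff0fff00575fff555f5fff55552f63338784ff83338fff86668504ff03ff333175ff74ff,
        0x7fff70ff27ff2fff80ff88338666858483338fff07ff03ff3383338f8fff07ff04ff03ff336107ff04ff0fff,
        0x00668483338fff1745ff4fff8075ff73337fff74ff72ff77881647ff45ff4fff07ff04ff446683338f8fff59,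
        0x57ff54ff5fff555754ff5fff55545fff555f5fff555588575426ff614fff47ff13ff33665f26ff275fff31ff,
        0x33225554625fff55614fff47ff5f27ff2255665f5f27ff26ff225555545f26ff6626614fff512fff310fff00,
        0x335566665f5f26ff66265124ff2fff6333665566550000332211000000000000000000000000000000000000]),
      ([0, 1, 1, 2, 3, 5, 6], [
        0x0f1f2f3f4f0f3fff1fff656fff2fff0fff006f25ff05ff2fff0fff004f35ff15ff07766636ff16ff660536ff,
        0x16ff660f36ff16ff66000f36ff16ff6600000f5f2fff0fff0054443f64446fff655506251fff413fff2fff0f,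
        0xff004455660f65556fff644435261fff412fff0fff0044665500003322110000000000000000000000000000]),
      ([0, 0, 2, 3, 4, 4, 2], [
        0x0f1f2f2f0f0f6fff5fff4fff3fff2f74447fff733364ff63ff54ff53ff43ff440f76667fff755565ff46ff45,
        0xff36ff6600000022221100000000000000000000000000000000000000000000000000000000000000000000]),
      ([0, 1, 1, 3, 3, 2, 5], [
        0x0f1f1f3f0f5f0fff00250f65556fff640fff003654610fff006626510fff0055666600240f65556fff36540f,
        0xff005535640fff006655002f540fff0055220033111100000000000000000000000000000000000000000000]),
      ([0, 1, 2, 3, 3, 5, 6], [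
        0x0f1f2f3f4f0f652fff1fff0fff006f7527ff15ff04ff2fff1fff0fff007427ff25ff15ff05ff2fff1fff0fff,
        0x0027ff15ff7f28ff18ff05ff04ff2fff1fff0fff002fff1fff736407ff772513ff04ff0fff00245314ff13ff,
        0x05ff0fff0050ff13ff5fff550726ff2277772fff640fff004f25ff07ff05ff0f87ff866685ff26ff66000f76,
        0x6675ff26ff6600000f5f64446f17ff04ff441fff635444240fff00445f7666744416ff663f7666744414ff44,
        0x54442453062fff0fff00660616405231625141302fff0fff00334455663355446666445444532f64446f7444,
        0x7314ff447140ff4414ff440fff00240f655564446f7555744473ff722271ff15ff55630fff00660044550033,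
        0x2211000000000000000000000000000000000000000000000000000000000000000000000000000000000000]),
      ([0, 1, 1, 1, 4, 5, 6], [
        0x0f1f2f3f0f0f0fff000000332211000000000000000000000000000000000000000000000000000000000000]),
      ([0, 1, 2, 3, 3, 5, 5], [
        0x0f1f1f3f4f2f2fff060fff000f0fff00000f0fff000024041f5f5fff362fff0fff003fff260fff002fff060f,
        0xff000fff003f3fff260fff002fff0654440fff000fff002f2fff0654440fff000fff000f0fff00003f54445f,
        0x2fff0fff005111552f54445f0fff005111550f54445f633362226fff5f744473337fff722271117751113206,
        0x6444666633511155004444331111000000000000000000000000000000000000000000000000000000000000]),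
      ([0, 0, 2, 3, 2, 5, 4], [
        0x0f0f2f3f1f0f6fff651fff0f76667fff74ff71117564ff61ff14ff7362ff66777700610f76667fff75ff74ff,
        0x7364ff62ff6677000f76667fff7564ff667164ff661f0874ff770f98ff977796669fff95ff9174ff77877786,
        0x668594ff99849374ff77998394ff998f94ff99880574ff77000f877786668fff8574ff778111548374ff7788,
        0x538472ff77885f84ff8855547364ff6677537462ff66775f74ff775500003f140f6fff652fff0f76667fff72,
        0x22711175ff7700640f76667fff75ff71117461117362ff66777700620f76667fff75ff746111667271117777,
        0x00660011142f0f6fff652fff0f76667fff7333722271117700620f76667fff75ff7333746333611166770061,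
        0x1166004f0f6fff650f76667fff7222711175ff770063336222660024130421030f54445f5f76ff7444733372,
        0x227fff7753335222555333550033224411221133220000000000000000000000000000000000000000000000]),
      ([0, 0, 2, 2, 4, 5, 2], [
        0x0f1f2f0f0f0f6fff5fff4fff0f76667555744465ff64ff54ff7fff7361ff6677000000002211000000000000]),
      ([0, 1, 1, 1, 1, 5, 6], [
        0x0f1f2f0f0f0f0fff000000002211000000000000000000000000000000000000000000000000000000000000]),
      ([0, 1, 1, 1, 4, 5, 5], [
        0x0f1f2f2f0f0f0fff000000222211000000000000000000000000000000000000000000000000000000000000]),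
      ([0, 1, 1, 1, 4, 5, 4], [
        0x0f1f1f3f0f0f0fff000000331111000000000000000000000000000000000000000000000000000000000000]),
      ([0, 1, 1, 1, 4, 4, 4], [
        0x0f1f1f1f0f0f0fff000000111111000000000000000000000000000000000000000000000000000000000000]),
      ([0, 0, 0, 3, 3, 5, 5], [
        0x0f1f2f2f0f1f0fff000f150fff00142fff134fff3fff65046fff5fff460fff00450fff00430f63ff62ff6600,
        0x440f64ff6fff63ff62ff54ff4400646fff0fff006f6fff63ff62ff66630fff00661111000022221100000000]),
      ([0, 0, 2, 3, 2, 5, 5], [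
        0x0f1f1f2f3f0f2fff0fff00000f342f2fff0fff000f250fff006453335fff65301fff0fff0033556333622254,
        0x6fff6653336f5fff576fff077465ff6673337222657fff0f87778666855584ff833382228fff881723ff2277,
        0x660f8666855584ff833382228fff880055660033002211110000000000000000000000000000000000000000]),
      ([0, 1, 2, 2, 2, 5, 5], [
        0x0f0f2f2f0f0f6fff5fff1fff0f76667fff7555711165ff61ff51ff0f877786668fff85558111848372ff7788,
        0x88747362ff667777000000222200000000000000000000000000000000000000000000000000000000000000]),
      ([0, 1, 1, 1, 4, 1, 4], [
        0x0f0f2f2f0f0f0fff000000222200000000000000000000000000000000000000000000000000000000000000]),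
      ([0, 0, 1, 3, 1, 1, 6], [
        0x0f0f2f1f0f0f6fff5fff0f7666755565ff7fff7461ff51ff1fff6471ff540f87778666855581118fff848372,
        0xff7788887362ff667755667362ff52ff2fff6451ff5566770000001122000000000000000000000000000000]),
      ([0, 1, 1, 1, 1, 4, 5], [
        0x0f1f0f3f0f0f0fff000000330011000000000000000000000000000000000000000000000000000000000000]),
      ([0, 1, 1, 1, 1, 1, 4], [
        0x0f0f0f3f0f0f0fff000000330000000000000000000000000000000000000000000000000000000000000000]),
      ([0, 1, 1, 1, 1, 1, 1], [
        0x0f0f0f0f0f0f0fff000000000000000000000000000000000000000000000000000000000000000000000000])]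
  | _ => []

lemma natBeq_eq_false {a b : ℕ} (h : a ≠ b) : Nat.beq a b = false :=
  Bool.eq_false_iff.2 fun hab => h (Nat.eq_of_beq_eq_true hab)

lemma exists_of_anyBit {f : ℕ → Bool} {n m : ℕ} (h : anyBit f n m = true) :
    ∃ w, m.testBit w = true ∧ f w = true := by
  induction n generalizing m with
  | zero => simp [anyBit] at h
  | succ n ih =>
    rw [anyBit] at h
    rcases eq_or_ne m 0 with rfl | hm
    · simp at h
    · rw [natBeq_eq_false hm, cond_false, Bool.or_eq_true] at h
      rcases h with h | h
      · exact ⟨_, Nat.testBit_log2 hm, h⟩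
      · obtain ⟨w, hw, hf⟩ := ih h
        rw [Nat.testBit_xor, Nat.testBit_two_pow] at hw
        rcases eq_or_ne m.log2 w with rfl | hne
        · exact ⟨_, Nat.testBit_log2 hm, hf⟩
        · exact ⟨w, by simpa [hne] using hw, hf⟩

lemma exists_of_extendsTo {adj : ℕ} {ps : List ℕ} {i : ℕ} {l : List ℕ} {free : ℕ}
    (hl : l.length = i + 1) (h : extendsTo adj ps i l free = true) :
    ∃ φ : ℕ → ℕ, (∀ j ≤ i, l[i - j]? = some (φ j)) ∧
      (∀ j, ∀ p ≤ i + j, ps[j]? = some p → adj.testBit (16 * φ p + φ (i + j + 1)) = true) ∧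
      (∀ j < ps.length, free.testBit (φ (i + j + 1)) = true) ∧
      Set.InjOn φ (Set.Ioc i (i + ps.length)) := by
  induction ps generalizing i l free with
  | nil =>
    refine ⟨fun j => l.getD (i - j) 0, fun j hj => ?_, by simp, by simp, by simp⟩
    simp [List.getD_eq_getElem?_getD, List.getElem?_eq_getElem (show i - j < l.length by omega)]
  | cons p ps ih =>
    obtain ⟨w, hw, h⟩ := exists_of_anyBit h
    rw [Nat.testBit_and, Nat.testBit_shiftRight, Bool.and_eq_true] at hw
    obtain ⟨φ, himg, hadj, hfree, hinj⟩ := ih (by simp [hl]) h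
    have hφw : φ (i + 1) = w := by simpa using (himg (i + 1) le_rfl).symm
    have hne : ∀ j < ps.length, φ (i + 1 + j + 1) ≠ w ∧
        free.testBit (φ (i + 1 + j + 1)) = true := by
      intro j hj
      have := hfree j hj
      rw [Nat.testBit_xor, Nat.testBit_two_pow] at this
      rcases eq_or_ne w (φ (i + 1 + j + 1)) with he | he
      · simp [← he, hw.2] at this
      · exact ⟨he.symm, by simpa [he] using this⟩
    have himg' : ∀ j ≤ i, l[i - j]? = some (φ j) := by
      intro j hj
      have := himg j (by omega)
      rwa [show i + 1 - j = i - j + 1 by omega, List.getElem?_cons_succ] at this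
    refine ⟨φ, himg', fun j q hq hj => ?_, fun j hj => ?_, ?_⟩
    · cases j with
      | zero =>
        obtain rfl : p = q := by simpa using hj
        have hp := himg' p (by omega)
        rw [List.getD_eq_getElem?_getD, hp, Option.getD_some] at hw
        rw [add_zero, hφw]
        exact hw.1
      | succ j =>
        have := hadj j q (by omega) (by simpa using hj)
        rwa [show i + 1 + j + 1 = i + (j + 1) + 1 by ring] at this
    · cases j with
      | zero => rw [add_zero, hφw]; exact hw.2
      | succ j =>
        have := (hne j (by simpa using hj)).2
        rwa [show i + 1 + j + 1 = i + (j + 1) + 1 by ring] at this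
    · have hset : Set.Ioc i (i + (p :: ps).length) =
          insert (i + 1) (Set.Ioc (i + 1) (i + 1 + ps.length)) := by
        ext j; simp only [Set.mem_Ioc, List.length_cons, Set.mem_insert_iff]; omega
      rw [hset, Set.injOn_insert (by simp)]
      refine ⟨hinj, ?_⟩
      rintro ⟨j, hj, he⟩
      rw [Set.mem_Ioc] at hj
      refine (hne (j - (i + 2)) (by omega)).1 ?_
      rw [show i + 1 + (j - (i + 2)) + 1 = j by omega, he, hφw]

lemma parentGraph_adj_lt {ps : List ℕ} {a b : ℕ} (h : (parentGraph ps).Adj a b) :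
    a < ps.length + 1 ∧ b < ps.length + 1 := by
  rw [parentGraph, SimpleGraph.fromRel_adj] at h
  rcases h.2 with ⟨hab, h⟩ | ⟨hab, h⟩ <;>
  · have := (List.getElem?_eq_some_iff.1 h).1
    omega

lemma exists_of_embeds {adj n : ℕ} {ps : List ℕ} (h : embeds adj n ps = true) :
    ∃ φ : ℕ → ℕ, Set.MapsTo φ (Set.Iio (ps.length + 1)) (Set.Iio n) ∧
      Set.InjOn φ (Set.Iio (ps.length + 1)) ∧ ∀ a b, (parentGraph ps).Adj a b →
        adj.testBit (16 * φ a + φ b) = true ∨ adj.testBit (16 * φ b + φ a) = true := by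
  obtain ⟨r, hr, h⟩ := exists_of_anyBit h
  obtain ⟨φ, himg, hadj, hfree, hinj⟩ := exists_of_extendsTo rfl h
  have hφr : φ 0 = r := by simpa using (himg 0 le_rfl).symm
  have hne : ∀ j, 0 < j → j < ps.length + 1 → φ j ≠ r ∧ φ j < n := by
    intro j hj hlt
    have := hfree (j - 1) (by omega)
    rw [show 0 + (j - 1) + 1 = j by omega, Nat.testBit_xor, Nat.testBit_two_pow] at this
    rcases eq_or_ne r (φ j) with he | he
    · simp [← he, hr] at this
    · exact ⟨he.symm, by simpa [he] using this⟩
  refine ⟨φ, fun j hj => ?_, ?_, ?_⟩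
  · rcases Nat.eq_zero_or_pos j with rfl | h0
    · rw [hφr]; simpa using hr
    · exact (hne j h0 hj).2
  · have hset : Set.Iio (ps.length + 1) = insert 0 (Set.Ioc 0 (0 + ps.length)) := by
      ext j; simp only [Set.mem_Iio, Set.mem_insert_iff, Set.mem_Ioc]; omega
    rw [hset, Set.injOn_insert (by simp)]
    refine ⟨hinj, ?_⟩
    rintro ⟨j, hj, he⟩
    rw [Set.mem_Ioc] at hj
    exact (hne j hj.1 (by omega)).1 (he.trans hφr)
  · have key : ∀ a b, a < b → ps[b - 1]? = some a → adj.testBit (16 * φ a + φ b) = true := by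
      intro a b hab hp
      have := hadj (b - 1) a (by omega) hp
      rwa [show 0 + (b - 1) + 1 = b by omega] at this
    intro a b hab
    rw [parentGraph, SimpleGraph.fromRel_adj] at hab
    exact hab.2.imp (fun h => key a b h.1 h.2) fun h => key b a h.1 h.2

lemma testBit_cell {a b u v : ℕ} (hb : b < 16) (hv : v < 16) :
    (cell u v).testBit (16 * a + b) = true ↔ a = u ∧ b = v := by
  rw [cell, Nat.testBit_two_pow, decide_eq_true_iff]
  omega

/-- The naming `g` of vertices of `H`, starting with `x`, agrees with the partial graph `G`. -/
structure PartialGraph.Fits {V : Type*} (G : PartialGraph) (H : SimpleGraph V) (x : V)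
    (g : ℕ → V) : Prop where
  root : g 0 = x
  order_le : G.order ≤ 15
  injOn : Set.InjOn g (Set.Iio G.order)
  adj : ∀ u v, v < 16 → G.adjacent u v = true → u < G.order ∧ v < G.order ∧ H.Adj (g u) (g v)
  non : ∀ u v, v < 16 → G.apart u v = true → u < G.order ∧ (v < G.order → ¬H.Adj (g u) (g v)) ∧
    (G.order ≤ v → ∀ z, H.Adj (g u) z → ∃ w < G.order, g w = z)

namespace PartialGraph.Fits

variable {V : Type*} {G : PartialGraph} {H : SimpleGraph V} {x : V} {g : ℕ → V} {u v : ℕ}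

lemma extend (h : G.Fits H x g) (hv : v < G.order) (hn : G.order < 15) {z : V}
    (hz : H.Adj (g v) z) (hnew : ∀ w < G.order, g w ≠ z) :
    (G.extend v).Fits H x (Function.update g G.order z) := by
  have hg : ∀ w < G.order, Function.update g G.order z w = g w := fun w hw =>
    Function.update_of_ne hw.ne _ _
  have hgz : Function.update g G.order z G.order = z := Function.update_self ..
  refine ⟨?_, ?_, ?_, fun a b hb hab => ?_, fun a b hb hab => ?_⟩
  · rw [hg 0 (by omega), h.root]
  · exact hn
  · have hset : Set.Iio (G.extend v).order = insert G.order (Set.Iio G.order) := by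
      ext j; simp only [PartialGraph.extend, Set.mem_Iio, Set.mem_insert_iff]; omega
    rw [hset, Set.injOn_insert (by simp)]
    refine ⟨h.injOn.congr fun w hw => (hg w hw).symm, ?_⟩
    rintro ⟨w, hw, he⟩
    rw [hg w hw, hgz] at he
    exact hnew w hw he
  · simp only [adjacent, PartialGraph.extend, Nat.testBit_or, Bool.or_eq_true] at hab ⊢
    rcases hab with (hab | hab) | hab
    · obtain ⟨h1, h2, h3⟩ := h.adj a b hb hab
      rw [hg a h1, hg b h2]
      exact ⟨by omega, by omega, h3⟩
    · obtain ⟨rfl, rfl⟩ := (testBit_cell hb (by omega)).1 hab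
      rw [hg _ hv, hgz]
      exact ⟨by omega, by omega, hz⟩
    · obtain ⟨rfl, rfl⟩ := (testBit_cell hb (by omega)).1 hab
      rw [hg _ hv, hgz]
      exact ⟨by omega, by omega, hz.symm⟩
  · obtain ⟨h1, h2, h3⟩ := h.non a b hb hab
    simp only [PartialGraph.extend]
    rw [hg a h1]
    refine ⟨by omega, fun hb' => ?_, fun hb' y hy => ?_⟩
    · rcases Nat.lt_succ_iff_lt_or_eq.1 hb' with hb' | rfl
      · rw [hg b hb']
        exact h2 hb'
      · rw [hgz]
        intro hadj
        obtain ⟨w, hw, he⟩ := h3 le_rfl z hadj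
        exact hnew w hw he
    · obtain ⟨w, hw, he⟩ := h3 (by omega) y hy
      exact ⟨w, by omega, by rw [hg w hw, he]⟩

lemma close (h : G.Fits H x g) (hv : v < G.order)
    (hz : ∀ z, H.Adj (g v) z → ∃ w < G.order, g w = z) : (G.close v).Fits H x g := by
  refine ⟨h.root, h.order_le, h.injOn, h.adj, fun a b hb hab => ?_⟩
  have hn := h.order_le
  simp only [apart, PartialGraph.close, Nat.testBit_or, Bool.or_eq_true] at hab ⊢
  rcases hab with hab | hab
  · exact h.non a b hb hab
  · rw [Nat.testBit_shiftLeft, Nat.testBit_two_pow_sub_one, Bool.and_eq_true,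
      decide_eq_true_iff, decide_eq_true_iff] at hab
    obtain ⟨rfl, hb'⟩ : a = v ∧ G.order ≤ b := by omega
    exact ⟨hv, fun hlt => by omega, fun _ => hz⟩

lemma join (h : G.Fits H x g) (hu : u < G.order) (hv : v < G.order) (huv : H.Adj (g u) (g v)) :
    (G.join u v).Fits H x g := by
  refine ⟨h.root, h.order_le, h.injOn, fun a b hb hab => ?_, h.non⟩
  have hn := h.order_le
  simp only [adjacent, PartialGraph.join, Nat.testBit_or, Bool.or_eq_true] at hab ⊢
  rcases hab with (hab | hab) | hab
  · exact h.adj a b hb hab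
  · obtain ⟨rfl, rfl⟩ := (testBit_cell hb (by omega)).1 hab
    exact ⟨hu, hv, huv⟩
  · obtain ⟨rfl, rfl⟩ := (testBit_cell hb (by omega)).1 hab
    exact ⟨hv, hu, huv.symm⟩

lemma sever (h : G.Fits H x g) (hu : u < G.order) (hv : v < G.order) (huv : ¬H.Adj (g u) (g v)) :
    (G.sever u v).Fits H x g := by
  refine ⟨h.root, h.order_le, h.injOn, h.adj, fun a b hb hab => ?_⟩
  have hn := h.order_le
  simp only [apart, PartialGraph.sever, Nat.testBit_or, Bool.or_eq_true] at hab ⊢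
  rcases hab with (hab | hab) | hab
  · exact h.non a b hb hab
  · obtain ⟨rfl, rfl⟩ := (testBit_cell hb (by omega)).1 hab
    exact ⟨hu, fun _ => huv, fun hle => by omega⟩
  · obtain ⟨rfl, rfl⟩ := (testBit_cell hb (by omega)).1 hab
    exact ⟨hv, fun _ hadj => huv hadj.symm, fun hle => by omega⟩

lemma degree_le_potential [Fintype V] [DecidableRel H.Adj] (h : G.Fits H x g)
    (hv : G.closed v = true) : H.degree (g v) ≤ G.potential v := by
  classical
  have hn := h.order_le
  obtain ⟨hv', -, hz⟩ := h.non v G.order (by omega) hv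
  let l := ((List.range G.order).filter fun w => !Nat.beq w v && !G.apart v w).map g
  have hsub : H.neighborFinset (g v) ⊆ l.toFinset := by
    intro z hadj
    rw [SimpleGraph.mem_neighborFinset] at hadj
    obtain ⟨w, hw, rfl⟩ := hz le_rfl z hadj
    have hne : w ≠ v := by rintro rfl; exact H.irrefl hadj
    have hap : G.apart v w = false := by
      by_contra hap
      exact (h.non v w (by omega) (by simpa using hap)).2.1 hw hadj
    rw [List.mem_toFinset, List.mem_map]
    exact ⟨w, by simp [hw, natBeq_eq_false hne, hap], rfl⟩
  calc H.degree (g v) ≤ l.toFinset.card := Finset.card_le_card hsub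
    _ ≤ l.length := l.toFinset_card_le
    _ = G.potential v := by rw [potential, List.countP_eq_length_filter, List.length_map]

end PartialGraph.Fits

/-- The degree conditions met by a graph of average degree greater than `k - 2` all of whose
proper induced subgraphs have smaller average degree. -/
structure DegreeCondition {V : Type*} [Fintype V] (H : SimpleGraph V) [DecidableRel H.Adj]
    (k : ℕ) (x : V) : Prop where
  root : k - 1 ≤ H.degree x
  half_le : ∀ v, k / 2 ≤ H.degree v
  le_add : ∀ u v, H.Adj u v → k ≤ H.degree u + H.degree v

section

variable {V : Type*} [Fintype V] {H : SimpleGraph V} [DecidableRel H.Adj] {k : ℕ} {x : V}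

lemma PartialGraph.Fits.not_contradictory {G : PartialGraph} {g : ℕ → V} (h : G.Fits H x g)
    (hH : DegreeCondition H k x) (v : ℕ) : G.contradictory k v = false := by
  by_contra hc
  rw [Bool.not_eq_false, contradictory, Bool.or_eq_true, Bool.and_eq_true, List.any_eq_true] at hc
  have hn := h.order_le
  rcases hc with ⟨hv, hp⟩ | ⟨w, hw, hc⟩
  · have hd := h.degree_le_potential hv
    rw [Nat.blt_eq] at hp
    rcases Nat.eq_zero_or_pos v with rfl | h0
    · have := hH.root
      rw [h.root] at hd
      simp at hp
      omega
    · have := hH.half_le (g v)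
      rw [natBeq_eq_false h0.ne', cond_false] at hp
      omega
  · simp only [Bool.and_eq_true, Bool.or_eq_true, List.mem_range, Nat.blt_eq] at hw hc
    obtain ⟨-, -, hadj⟩ := h.adj v w (by omega) hc.1
    rcases hc.2 with hc | ⟨hv, hw', hp⟩
    · exact (h.non v w (by omega) hc).2.1 hw hadj
    · have := hH.le_add _ _ hadj
      have := h.degree_le_potential hv
      have := h.degree_le_potential hw'
      omega

lemma PartialGraph.exists_hom_of_forces (hH : DegreeCondition H k x) {ps cs : List ℕ}
    {Gs : List PartialGraph} (hf : forces k ps cs Gs = true) :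
    ∀ G ∈ Gs, ∀ g, G.Fits H x g →
      ∃ φ : parentGraph ps →g H, Set.InjOn φ (Set.Iio (ps.length + 1)) := by
  induction cs generalizing Gs with
  | nil =>
    cases Gs with
    | nil => simp
    | cons G Gs => simp [forces] at hf
  | cons c cs ih =>
    cases Gs with
    | nil => simp
    | cons G Gs =>
      simp only [forces, Bool.cond_eq_ite] at hf
      simp only [List.mem_cons, forall_eq_or_imp]
      split_ifs at hf <;> simp only [Bool.and_eq_true, Nat.blt_eq] at hf
      · refine ⟨fun g hg => ?_, ih hf.2⟩
        obtain ⟨φ, hmaps, hinj, hadj⟩ := exists_of_embeds hf.1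
        have hn := hg.order_le
        have hbit : ∀ a b, a < ps.length + 1 → b < ps.length + 1 →
            G.adj.testBit (16 * φ a + φ b) = true → H.Adj (g (φ a)) (g (φ b)) := by
          intro a b ha hb hab
          have := Set.mem_Iio.1 (hmaps hb)
          exact (hg.adj _ _ (by omega) hab).2.2
        refine ⟨⟨g ∘ φ, fun {a b} hab => ?_⟩, hg.injOn.comp hinj hmaps⟩
        obtain ⟨ha, hb⟩ := parentGraph_adj_lt hab
        exact (hadj a b hab).elim (hbit a b ha hb) fun h => (hbit b a hb ha h).symm
      · refine ⟨fun g hg => ?_, ih hf.2⟩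
        rw [hg.not_contradictory hH] at hf
        simp at hf
      · obtain ⟨hu, hn, hf⟩ := hf
        have := ih hf
        simp only [List.mem_cons, forall_eq_or_imp] at this
        refine ⟨fun g hg => ?_, this.2.2⟩
        by_cases hz : ∀ z, H.Adj (g (c / 16)) z → ∃ w < G.order, g w = z
        · exact this.2.1 g (hg.close hu hz)
        · push Not at hz
          obtain ⟨z, hadj, hnew⟩ := hz
          exact this.1 _ (hg.extend hu hn hadj hnew)
      · obtain ⟨hu, hv, hf⟩ := hf
        have := ih hf
        simp only [List.mem_cons, forall_eq_or_imp] at this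
        refine ⟨fun g hg => ?_, this.2.2⟩
        by_cases hadj : H.Adj (g (c / 16)) (g (c % 16))
        · exact this.1 g (hg.join hu hv hadj)
        · exact this.2.1 g (hg.sever hu hv hadj)

lemma exists_hom_of_forces_start (hH : DegreeCondition H k x) {ps cs : List ℕ}
    (hf : PartialGraph.forces k ps cs [⟨1, 0, 0⟩] = true) :
    ∃ φ : parentGraph ps →g H, Set.InjOn φ (Set.Iio (ps.length + 1)) := by
  refine PartialGraph.exists_hom_of_forces hH hf _ (List.mem_singleton_self _) (fun _ => x)
    ⟨rfl, by simp, ?_, by simp [PartialGraph.adjacent], by simp [PartialGraph.apart]⟩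
  intro a ha b hb _
  simp only [Set.mem_Iio] at ha hb
  omega

end

lemma forces_scripts : ∀ k ∈ List.range 9, ∀ t ∈ scripts k,
    PartialGraph.forces k t.1 (t.2.foldr (prependBytes 44) []) [⟨1, 0, 0⟩] = true := by
  decide +kernel

lemma length_of_mem_scripts : ∀ k ∈ List.range 9, ∀ t ∈ scripts k, t.1.length + 1 = k := by
  decide +kernel

lemma any_embeds_scripts : ∀ k ∈ List.range 8, ∀ t ∈ scripts k, ∀ a ∈ List.range k,
    (scripts (k + 1)).any (fun s =>
      bif Nat.beq (degreeCounts s.1) (degreeCounts (t.1 ++ [a]))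
      then embeds (adjMatrix s.1) (k + 1) (t.1 ++ [a]) else false) = true := by
  decide +kernel

lemma parentGraph_adj_of_testBit {ps : List ℕ} (hps : ps.length < 16) {a b : ℕ} (hb : b < 16)
    (h : (adjMatrix ps).testBit (16 * a + b) = true) : (parentGraph ps).Adj a b := by
  have key : ∀ l : List (ℕ × ℕ), (∀ e ∈ l, e.2 < 16) →
      (l.foldr (fun e m => bif Nat.blt e.1 e.2 then m ||| cell e.1 e.2 ||| cell e.2 e.1 else m)
        0).testBit (16 * a + b) = true →
      ∃ e ∈ l, e.1 < e.2 ∧ (a = e.1 ∧ b = e.2 ∨ a = e.2 ∧ b = e.1) := by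
    intro l hl h
    induction l with
    | nil => simp at h
    | cons e l ih =>
      rw [List.foldr_cons, Bool.cond_eq_ite] at h
      have ih := ih fun e he => hl e (List.mem_cons_of_mem _ he)
      have he := hl e List.mem_cons_self
      split_ifs at h with hlt
      · rw [Nat.blt_eq] at hlt
        rw [Nat.testBit_or, Nat.testBit_or, Bool.or_eq_true, Bool.or_eq_true,
          testBit_cell hb he, testBit_cell hb (hlt.trans he)] at h
        rcases h with (h | h) | h
        · obtain ⟨e', he', h⟩ := ih h
          exact ⟨e', List.mem_cons_of_mem _ he', h⟩
        · exact ⟨e, List.mem_cons_self, hlt, Or.inl h⟩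
        · exact ⟨e, List.mem_cons_self, hlt, Or.inr h⟩
      · obtain ⟨e', he', h⟩ := ih h
        exact ⟨e', List.mem_cons_of_mem _ he', h⟩
  have hmem : ∀ e ∈ ps.zipIdx 1, 1 ≤ e.2 ∧ ps[e.2 - 1]? = some e.1 := fun e he =>
    List.mk_mem_zipIdx_iff_le_and_getElem?_sub.1 he
  obtain ⟨e, he, hlt, hab⟩ := key _ (fun e he => by
    have := (List.getElem?_eq_some_iff.1 (hmem e he).2).1
    omega) h
  rw [parentGraph, SimpleGraph.fromRel_adj]
  rcases hab with ⟨rfl, rfl⟩ | ⟨rfl, rfl⟩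
  · exact ⟨hlt.ne, Or.inl ⟨hlt, (hmem e he).2⟩⟩
  · exact ⟨hlt.ne', Or.inr ⟨hlt, (hmem e he).2⟩⟩

lemma exists_hom_parentGraph_append {k a : ℕ} (hk : k < 8) {t : List ℕ × List ℕ}
    (ht : t ∈ scripts k) (ha : a < k) :
    ∃ s ∈ scripts (k + 1), ∃ φ : parentGraph (t.1 ++ [a]) →g parentGraph s.1,
      Set.MapsTo φ (Set.Iio (k + 1)) (Set.Iio (k + 1)) ∧ Set.InjOn φ (Set.Iio (k + 1)) := by
  have hany := any_embeds_scripts k (by simpa using hk) t ht a (by simpa using ha)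
  obtain ⟨s, hs, h⟩ := List.any_eq_true.1 hany
  rw [Bool.cond_eq_ite] at h
  split_ifs at h
  have hlt := length_of_mem_scripts k (by simp; omega) t ht
  have hls := length_of_mem_scripts (k + 1) (by simp; omega) s hs
  obtain ⟨φ, hmaps, hinj, hadj⟩ := exists_of_embeds h
  rw [List.length_append, List.length_singleton, hlt] at hmaps hinj
  have hφ : ∀ b < k + 1, φ b < 16 := fun b hb => (Set.mem_Iio.1 (hmaps hb)).trans (by omega)
  refine ⟨s, hs, ⟨φ, fun {b c} hbc => ?_⟩, hmaps, hinj⟩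
  have hlen := parentGraph_adj_lt hbc
  rw [List.length_append, List.length_singleton, hlt] at hlen
  exact (hadj b c hbc).elim (parentGraph_adj_of_testBit (by omega) (hφ c hlen.2))
    fun h => (parentGraph_adj_of_testBit (by omega) (hφ b hlen.1) h).symm

lemma exists_hom_parentGraph {k : ℕ} (hk : k < 8) {W : Type*} [Fintype W] {T : SimpleGraph W}
    (hT : T.IsTree) (hW : Fintype.card W = k + 1) :
    ∃ t ∈ scripts (k + 1), ∃ f : T →g parentGraph t.1, Function.Injective f ∧
      ∀ w, f w < k + 1 := by
  classical
  induction k generalizing W with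
  | zero =>
    have := Fintype.card_le_one_iff_subsingleton.1 hW.le
    exact ⟨_, List.mem_singleton_self _,
      ⟨fun _ => 0, fun {a b} h => (h.ne (Subsingleton.elim a b)).elim⟩,
      Function.injective_of_subsingleton _, by simp⟩
  | succ k ih =>
    have : Nontrivial W := Fintype.one_lt_card_iff_nontrivial.1 (by omega)
    obtain ⟨v, hv⟩ := hT.exists_vert_degree_one_of_nontrivial
    have hT' : (T.induce {v}ᶜ).IsTree :=
      ⟨hT.connected.induce_compl_singleton_of_degree_eq_one hv, hT.isAcyclic.induce _⟩
    obtain ⟨u, huv, hu⟩ := SimpleGraph.degree_eq_one_iff_existsUnique_adj.1 hv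
    have huv' : u ∈ ({v}ᶜ : Set W) := huv.ne'
    have hcard : Fintype.card ({v}ᶜ : Set W) = k + 1 := by
      rw [Fintype.card_compl_set, hW]; simp
    obtain ⟨t, ht, f, hf, hlt⟩ := ih (by omega) hT' hcard
    obtain ⟨s, hs, φ, hmaps, hinj⟩ := exists_hom_parentGraph_append hk ht (hlt ⟨u, huv'⟩)
    have hlen := length_of_mem_scripts (k + 1) (by simp; omega) t ht
    let F : W → ℕ := fun w => if h : w = v then k + 1 else f ⟨w, h⟩
    have hFv : F v = k + 1 := dif_pos rfl
    have hFne : ∀ w (h : w ≠ v), F w = f ⟨w, h⟩ := fun w h => dif_neg h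
    have hFlt : ∀ w, F w < k + 2 := by
      intro w
      by_cases h : w = v
      · rw [h, hFv]; omega
      · rw [hFne w h]; exact (hlt _).trans (by omega)
    have hFinj : Function.Injective F := by
      intro a b hab
      by_cases ha : a = v <;> by_cases hb : b = v
      · rw [ha, hb]
      · rw [ha, hFv, hFne b hb] at hab
        exact absurd hab (hlt _).ne'
      · rw [hb, hFv, hFne a ha] at hab
        exact absurd hab (hlt _).ne
      · rw [hFne a ha, hFne b hb] at hab
        exact congrArg Subtype.val (hf hab)
    have hnew : ∀ w, T.Adj v w → (parentGraph (t.1 ++ [f ⟨u, huv'⟩])).Adj (F v) (F w) := by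
      intro w hw
      obtain rfl := hu w hw
      rw [hFv, hFne w huv', parentGraph, SimpleGraph.fromRel_adj]
      refine ⟨(hlt _).ne', Or.inr ⟨hlt _, ?_⟩⟩
      rw [List.getElem?_append_right (by omega), show k + 1 - 1 - t.1.length = 0 by omega]
      rfl
    have hold : ∀ a b, a < b ∧ t.1[b - 1]? = some a →
        a < b ∧ (t.1 ++ [f ⟨u, huv'⟩])[b - 1]? = some a := fun a b h =>
      ⟨h.1, by rw [List.getElem?_append_left (List.getElem?_eq_some_iff.1 h.2).1, h.2]⟩
    have hF : ∀ a b, T.Adj a b → (parentGraph (t.1 ++ [f ⟨u, huv'⟩])).Adj (F a) (F b) := by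
      intro a b hab
      by_cases ha : a = v
      · subst ha; exact hnew b hab
      by_cases hb : b = v
      · subst hb; exact (hnew a hab.symm).symm
      have := f.map_adj (show (T.induce {v}ᶜ).Adj ⟨a, ha⟩ ⟨b, hb⟩ from hab)
      rw [hFne a ha, hFne b hb]
      simp only [parentGraph, SimpleGraph.fromRel_adj] at this ⊢
      exact ⟨this.1, this.2.imp (hold _ _) (hold _ _)⟩
    exact ⟨s, hs, φ.comp ⟨F, fun {a b} h => hF a b h⟩,
      fun a b hab => hFinj (hinj (hFlt a) (hFlt b) hab), fun w => hmaps (hFlt w)⟩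

lemma exists_hom_of_degreeCondition {k : ℕ} (hk1 : 1 ≤ k) (hk : k ≤ 8) {V : Type*} [Fintype V]
    {H : SimpleGraph V} [DecidableRel H.Adj] {x : V} (hH : DegreeCondition H k x)
    {W : Type*} [Fintype W] {T : SimpleGraph W} (hT : T.IsTree) (hW : Fintype.card W = k) :
    ∃ f : T →g H, Function.Injective f := by
  obtain ⟨k, rfl⟩ := Nat.exists_eq_add_of_le' hk1
  obtain ⟨t, ht, f, hf, hlt⟩ := exists_hom_parentGraph hk hT hW
  have hmem : k + 1 ∈ List.range 9 := by simp; omega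
  obtain ⟨φ, hφ⟩ := exists_hom_of_forces_start hH (forces_scripts _ hmem t ht)
  rw [length_of_mem_scripts _ hmem t ht] at hφ
  exact ⟨φ.comp f, fun a b hab => hf (hφ (hlt a) (hlt b) hab)⟩

section

variable {V : Type*} (G : SimpleGraph V) [DecidableRel G.Adj]

lemma card_filter_adj_insert [DecidableEq V] {u : V} {t : Finset V} (hu : u ∉ t) (v : V) :
    ((insert u t).filter (G.Adj v)).card =
      (t.filter (G.Adj v)).card + if G.Adj v u then 1 else 0 := by
  rw [Finset.filter_insert]
  split_ifs
  · rw [Finset.card_insert_of_notMem (by simp [hu])]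
  · rfl

lemma sum_card_filter_adj_insert [DecidableEq V] {u : V} {t : Finset V} (hu : u ∉ t) :
    ∑ v ∈ insert u t, ((insert u t).filter (G.Adj v)).card =
      ∑ v ∈ t, (t.filter (G.Adj v)).card + 2 * ((insert u t).filter (G.Adj u)).card := by
  have hcomm : t.filter (fun v => G.Adj v u) = t.filter (G.Adj u) := by
    simp only [G.adj_comm]
  simp_rw [Finset.sum_insert hu, card_filter_adj_insert G hu, Finset.sum_add_distrib,
    ← Finset.card_filter, hcomm]
  simp
  ring

lemma exists_minimal_dense [Fintype V] {m : ℕ}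
    (h : m * Fintype.card V < 2 * G.edgeFinset.card) :
    ∃ s : Finset V, m * s.card < ∑ v ∈ s, (s.filter (G.Adj v)).card ∧
      ∀ t ⊂ s, ∑ v ∈ t, (t.filter (G.Adj v)).card ≤ m * t.card := by
  have huniv : m * (Finset.univ : Finset V).card <
      ∑ v, (Finset.univ.filter (G.Adj v)).card := by
    rw [Finset.card_univ]
    refine h.trans_eq ?_
    rw [← G.sum_degrees_eq_twice_card_edges]
    exact Finset.sum_congr rfl fun v _ => by
      rw [← G.card_neighborFinset_eq_degree, G.neighborFinset_eq_filter]
  obtain ⟨s, hs, hmin⟩ := WellFounded.has_min (wellFounded_lt (α := Finset V))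
    {s | m * s.card < ∑ v ∈ s, (s.filter (G.Adj v)).card} ⟨_, huniv⟩
  exact ⟨s, hs, fun t ht => not_lt.1 fun h => hmin t h ht⟩

lemma degree_induce_coe {s : Finset V} {v : V} (hv : v ∈ s) :
    (G.induce (s : Set V)).degree ⟨v, hv⟩ = (s.filter (G.Adj v)).card := by
  rw [← SimpleGraph.card_neighborFinset_eq_degree]
  refine Finset.card_bij (fun w _ => w) (fun w hw => ?_) (fun _ _ _ _ => Subtype.ext)
    fun w hw => ?_
  · simpa using hw
  · rw [Finset.mem_filter] at hw
    exact ⟨⟨w, hw.1⟩, by simpa using hw.2, rfl⟩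

lemma exists_degreeCondition [Fintype V] {k : ℕ} (hk : 2 ≤ k)
    (h : (k - 2) * Fintype.card V < 2 * G.edgeFinset.card) :
    ∃ (s : Finset V) (x : (s : Set V)), DegreeCondition (G.induce (s : Set V)) k x := by
  classical
  obtain ⟨s, hs, hmin⟩ := exists_minimal_dense G h
  obtain ⟨m, rfl⟩ := Nat.exists_eq_add_of_le' hk
  rw [Nat.add_sub_cancel] at hs hmin
  obtain ⟨x, hx, hdeg⟩ : ∃ x ∈ s, m < (s.filter (G.Adj x)).card := by
    refine Finset.exists_lt_of_sum_lt ?_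
    rwa [Finset.sum_const, smul_eq_mul, mul_comm]
  refine ⟨s, ⟨x, hx⟩, ?_, ?_, ?_⟩
  · rw [degree_induce_coe G hx]
    omega
  · rintro ⟨v, hv⟩
    rw [degree_induce_coe G hv]
    have ht := hmin _ (Finset.erase_ssubset hv)
    have hsum := sum_card_filter_adj_insert G (Finset.notMem_erase v s)
    rw [Finset.insert_erase hv] at hsum
    have hcard : m * s.card = m * (s.erase v).card + m := by
      rw [← Finset.card_erase_add_one hv]; ring
    omega
  · rintro ⟨u, hu⟩ ⟨v, hv⟩ huv
    rw [degree_induce_coe G hu, degree_induce_coe G hv]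
    have huv : G.Adj u v := huv
    have hv' : v ∈ s.erase u := Finset.mem_erase.2 ⟨huv.ne', hv⟩
    have ht := hmin _ ((Finset.erase_ssubset hv').trans (Finset.erase_ssubset hu))
    have hsum := sum_card_filter_adj_insert G (Finset.notMem_erase u s)
    have hsum' := sum_card_filter_adj_insert G (Finset.notMem_erase v (s.erase u))
    have hd := card_filter_adj_insert G (Finset.notMem_erase u s) v
    rw [Finset.insert_erase hu] at hsum hd
    rw [Finset.insert_erase hv'] at hsum'
    rw [if_pos huv.symm] at hd
    have hcard : m * s.card = m * ((s.erase u).erase v).card + 2 * m := by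
      rw [← Finset.card_erase_add_one hu, ← Finset.card_erase_add_one hv']; ring
    omega

end

end ErdosSos

/-- Eaton–Tiner: the Erdős–Sós conjecture holds for `k ≤ 8`. -/
theorem erdos_sos_k_le_eight {V : Type*} [Fintype V] (G : SimpleGraph V) [DecidableRel G.Adj]
    (k : ℕ) (hk : 2 ≤ k) (hk8 : k ≤ 8)
    (havg : (k : ℝ) - 2 < 2 * G.edgeFinset.card / Fintype.card V) :
    ∀ (W : Type) [Fintype W] (T : SimpleGraph W), T.IsTree → Fintype.card W = k →
      ∃ f : T →g G, Function.Injective f := by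
  intro W _ T hT hW
  have hpos : (0 : ℝ) < Fintype.card V := by
    rcases (Nat.cast_nonneg (α := ℝ) (Fintype.card V)).eq_or_lt with h0 | h0
    · rw [← h0, div_zero] at havg
      have : (2 : ℝ) ≤ k := by exact_mod_cast hk
      linarith
    · exact h0
  rw [lt_div_iff₀ hpos] at havg
  have h : (k - 2) * Fintype.card V < 2 * G.edgeFinset.card := by
    rw [← Nat.cast_lt (α := ℝ)]
    push_cast [Nat.cast_sub hk]
    exact havg
  obtain ⟨s, x, hx⟩ := ErdosSos.exists_degreeCondition G hk h
  obtain ⟨f, hf⟩ := ErdosSos.exists_hom_of_degreeCondition (by omega) hk8 hx hT hW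
  exact ⟨(SimpleGraph.Embedding.induce (G := G) (s : Set V)).toHom.comp f,
    (SimpleGraph.Embedding.induce (G := G) (s : Set V)).injective.comp hf⟩
end

section
/- Let G be a finite simple graph of order n whose average degree 2·e(G)/n is strictly greater than n−2. Then G contains every tree of order n as a subgraph (i.e., the Erdős–Sós conjecture holds when k = n). -/
open SimpleGraph

open Finset in
/-- The number of ordered adjacent pairs of a finite graph is twice its number of edges. -/
theorem SimpleGraph.card_filter_adj {V : Type*} [Fintype V] (G : SimpleGraph V)
    [DecidableRel G.Adj] :
    #{p : V × V | G.Adj p.1 p.2} = 2 * #G.edgeFinset := by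
  classical
  rw [← G.sum_degrees_eq_twice_card_edges, card_filter, Fintype.sum_prod_type]
  refine sum_congr rfl fun v _ => ?_
  rw [← card_filter, ← G.card_neighborFinset_eq_degree, G.neighborFinset_eq_filter]

/-- The symmetric group acts transitively on ordered pairs of distinct points. -/
theorem Equiv.Perm.exists_map_pair {α : Type*} {a b c d : α} (hab : a ≠ b) (hcd : c ≠ d) :
    ∃ σ : Equiv.Perm α, σ a = c ∧ σ b = d := by
  classical
  refine ⟨(Equiv.swap a c).trans (Equiv.swap (Equiv.swap a c b) d), ?_, ?_⟩
  · have h : Equiv.swap a c b ≠ c := fun h =>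
      hab ((Equiv.swap a c).injective ((Equiv.swap_apply_left a c).trans h.symm))
    simp [Equiv.swap_apply_of_ne_of_ne h.symm hcd]
  · simp

open Finset in
/-- Double counting of the bijections that send a given pair of distinct points to an edge. -/
theorem SimpleGraph.card_equiv_adj {V W : Type*} [Fintype V] [Fintype W] [DecidableEq V]
    [DecidableEq W] (H : SimpleGraph V) [DecidableRel H.Adj] {a b : W} (hab : a ≠ b) :
    Fintype.card W * (Fintype.card W - 1) * #{f : W ≃ V | H.Adj (f a) (f b)} =
      Fintype.card (W ≃ V) * (2 * #H.edgeFinset) := by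
  have hconst : ∀ p ∈ (univ : Finset W).offDiag,
      #{f : W ≃ V | H.Adj (f p.1) (f p.2)} = #{f : W ≃ V | H.Adj (f a) (f b)} := by
    rintro ⟨c, d⟩ hp
    obtain ⟨σ, rfl, rfl⟩ := Equiv.Perm.exists_map_pair hab (mem_offDiag.1 hp).2.2
    exact card_equiv (σ.symm.equivCongr (Equiv.refl V)) (by simp)
  have hpairs (f : W ≃ V) :
      #{p ∈ (univ : Finset W).offDiag | H.Adj (f p.1) (f p.2)} = 2 * #H.edgeFinset := by
    rw [← H.card_filter_adj]
    refine card_equiv (f.prodCongr f) fun p => ?_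
    simp only [mem_filter, mem_offDiag, mem_univ, true_and, Equiv.prodCongr_apply, Prod.map_fst,
      Prod.map_snd, and_iff_right_iff_imp]
    exact fun h heq => h.ne (congrArg f heq)
  calc
    _ = ∑ p ∈ (univ : Finset W).offDiag, #{f : W ≃ V | H.Adj (f p.1) (f p.2)} := by
      rw [sum_congr rfl hconst, sum_const, offDiag_card, card_univ, smul_eq_mul, Nat.mul_sub_one]
    _ = ∑ f : W ≃ V, #{p ∈ (univ : Finset W).offDiag | H.Adj (f p.1) (f p.2)} := by
      simp only [card_filter]
      exact sum_comm
    _ = _ := by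
      rw [sum_congr rfl fun f _ => hpairs f, sum_const, card_univ, smul_eq_mul]

open Finset in
/-- Sauer–Spencer: two graphs of order `n` whose numbers of edges have product less than
`n.choose 2` can be packed. -/
theorem SimpleGraph.exists_equiv_packing {V W : Type*} [Fintype V] [Fintype W]
    (T : SimpleGraph W) (H : SimpleGraph V) [DecidableRel T.Adj] [DecidableRel H.Adj]
    (hcard : Fintype.card W = Fintype.card V)
    (hlt : 2 * (#T.edgeFinset * #H.edgeFinset) < Fintype.card W * (Fintype.card W - 1)) :
    ∃ f : W ≃ V, ∀ a b, T.Adj a b → ¬ H.Adj (f a) (f b) := by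
  classical
  by_contra! hbad
  have htwo (f : W ≃ V) : 2 ≤ #{p ∈ {p : W × W | T.Adj p.1 p.2} | H.Adj (f p.1) (f p.2)} := by
    obtain ⟨a, b, hT, hH⟩ := hbad f
    have hne : (a, b) ≠ (b, a) := fun h => hT.ne (Prod.ext_iff.1 h).1
    rw [← card_pair hne]
    refine card_le_card fun p hp => ?_
    obtain rfl | rfl := by simpa only [mem_insert, mem_singleton] using hp
    · simp [hT, hH]
    · simp [hT.symm, hH.symm]
  have hcount : Fintype.card (W ≃ V) * 2 ≤
      ∑ p : W × W with T.Adj p.1 p.2, #{f : W ≃ V | H.Adj (f p.1) (f p.2)} := by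
    calc
      _ = ∑ _f : W ≃ V, 2 := by simp
      _ ≤ ∑ f : W ≃ V, #{p ∈ {p : W × W | T.Adj p.1 p.2} | H.Adj (f p.1) (f p.2)} :=
        sum_le_sum fun f _ => htwo f
      _ = _ := by
        simp only [card_filter]
        exact sum_comm
  have hpos : 0 < Fintype.card (W ≃ V) :=
    Fintype.card_pos_iff.2 ⟨Fintype.equivOfCardEq hcard⟩
  have hmul := Nat.mul_le_mul_left (Fintype.card W * (Fintype.card W - 1)) hcount
  rw [mul_sum, sum_congr rfl fun p hp => H.card_equiv_adj (mem_filter.1 hp).2.ne, sum_const,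
    T.card_filter_adj, smul_eq_mul] at hmul
  nlinarith [Nat.mul_lt_mul_of_pos_left hlt hpos]

/-- Zhou (1984): the Erdős–Sós conjecture holds for `k = n`. -/
theorem erdos_sos_k_eq_n {V : Type*} [Fintype V] (G : SimpleGraph V) [DecidableRel G.Adj]
    (havg : (Fintype.card V : ℝ) - 2 < 2 * G.edgeFinset.card / Fintype.card V) :
    ∀ (W : Type) [Fintype W] (T : SimpleGraph W), T.IsTree →
      Fintype.card W = Fintype.card V →
      ∃ f : T →g G, Function.Injective f := by
  classical
  intro W _ T hT hcard
  have : Nonempty W := hT.connected.nonempty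
  have hedges := hT.card_edgeFinset
  obtain hW | hW := subsingleton_or_nontrivial W
  · let e := Fintype.equivOfCardEq hcard
    exact ⟨⟨e, fun h => (h.ne (Subsingleton.elim _ _)).elim⟩, e.injective⟩
  have hone : 1 < Fintype.card V := hcard ▸ Fintype.one_lt_card
  have hcompl : G.edgeFinset.card + Gᶜ.edgeFinset.card = (Fintype.card V).choose 2 := by
    rw [← card_edgeFinset_top_eq_card_choose_two, ← Finset.card_union_of_disjoint
      (disjoint_edgeFinset.2 disjoint_compl_right), ← edgeFinset_sup]
    congr 1
    ext e
    simp only [mem_edgeFinset, sup_compl_eq_top]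
  have hfew : 2 * Gᶜ.edgeFinset.card < Fintype.card V := by
    have hn : (0 : ℝ) < Fintype.card V := by positivity
    rw [lt_div_iff₀ hn] at havg
    have hchoose := congrArg (Nat.cast (R := ℝ)) hcompl
    rw [Nat.cast_choose_two] at hchoose
    push_cast at hchoose
    have : (2 * Gᶜ.edgeFinset.card : ℝ) < Fintype.card V := by nlinarith
    exact_mod_cast this
  obtain ⟨f, hf⟩ := T.exists_equiv_packing Gᶜ hcard (by
    rw [← hcard] at hfew hone
    rw [← hedges] at hfew hone ⊢
    rw [Nat.add_sub_cancel]
    nlinarith)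
  refine ⟨⟨f, fun {a b} h => ?_⟩, f.injective⟩
  by_contra hG
  exact hf a b h ((G.compl_adj _ _).2 ⟨f.injective.ne h.ne, hG⟩)
end
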